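/- arXiv:1301.6190 — 2 statements merged into one kernel-verified Lean document; each statement's English description precedes it below -/
import Mathlib

section
/- For the source coding problem with action-dependent side information, the operational rate-distortion-cost function equals the single-letter expression: R(D,C) = min I(X;A) + I(X;U|Y,A), where the minimum is over all finite auxiliary alphabets 𝒰 with |𝒰| ≤ |𝒳||𝒜| + 2, all conditional pmfs P_{U|X} and deterministic functions η : 𝒰 → 𝒜 such that, under the joint pmf P_{X,Y,A,U}(x,y,a,u) = P_X(x) P_{U|X}(u|x) 1{η(u)=a} P_{Y|X,A}(y|x,a), the constraints E[d(X, X̂^opt(U,Y))] ≤ D and E[Δ(A)] ≤ C hold, where X̂^opt(u,y) = argmin_{x̂ ∈ X̂} E[d(X,x̂) | U=u, Y=y]. -/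
open Finset

noncomputable section

/-- A probability mass function on a finite alphabet. -/
def IsPMF {α : Type} [Fintype α] (p : α → ℝ) : Prop :=
  (∀ a, 0 ≤ p a) ∧ ∑ a, p a = 1

/-- A conditional probability mass function. -/
def IsCondPMF {α β : Type} [Fintype α] [Fintype β] (p : α → β → ℝ) : Prop :=
  ∀ a, IsPMF (p a)

/-- A Shannon strategy: an estimate function `Y → Xh` together with an action in `A`. -/
abbrev Strat (Y Xh A : Type) : Type := (Y → Xh) × A

variable {X Y A Xh : Type} [Fintype X] [Fintype Y] [Fintype A] [Fintype Xh]
  [DecidableEq X] [DecidableEq Y] [DecidableEq A] [DecidableEq Xh]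

/-- Joint pmf `P_{X,Y,U}(x,y,u) = P_X(x) P_{U|X}(u|x) P_{Y|X,A}(y|x,η(u))`
for an auxiliary alphabet `Fin n`. -/
def pUJoint (PX : X → ℝ) (PW : A → X → Y → ℝ) {n : ℕ} (PU : X → Fin n → ℝ)
    (η : Fin n → A) (x : X) (y : Y) (u : Fin n) : ℝ :=
  PX x * PU x u * PW (η u) x y

def pAu (PX : X → ℝ) {n : ℕ} (PU : X → Fin n → ℝ) (η : Fin n → A) (a : A) : ℝ :=
  ∑ x, ∑ u, if η u = a then PX x * PU x u else 0

def pXAu (PX : X → ℝ) {n : ℕ} (PU : X → Fin n → ℝ) (η : Fin n → A) (x : X) (a : A) : ℝ :=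
  ∑ u, if η u = a then PX x * PU x u else 0

def pYAu (PX : X → ℝ) (PW : A → X → Y → ℝ) {n : ℕ} (PU : X → Fin n → ℝ)
    (η : Fin n → A) (y : Y) (a : A) : ℝ :=
  ∑ x, ∑ u, if η u = a then pUJoint PX PW PU η x y u else 0

def pXYAu (PX : X → ℝ) (PW : A → X → Y → ℝ) {n : ℕ} (PU : X → Fin n → ℝ)
    (η : Fin n → A) (x : X) (y : Y) (a : A) : ℝ :=
  ∑ u, if η u = a then pUJoint PX PW PU η x y u else 0

def pYUu (PX : X → ℝ) (PW : A → X → Y → ℝ) {n : ℕ} (PU : X → Fin n → ℝ)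
    (η : Fin n → A) (y : Y) (u : Fin n) : ℝ :=
  ∑ x, pUJoint PX PW PU η x y u

/-- Mutual information `I(X;A)` with `A = η(U)` (base-2 logarithms). -/
def IXAu (PX : X → ℝ) {n : ℕ} (PU : X → Fin n → ℝ) (η : Fin n → A) : ℝ :=
  ∑ x, ∑ a, pXAu PX PU η x a * Real.logb 2 (pXAu PX PU η x a / (PX x * pAu PX PU η a))

/-- Conditional mutual information `I(X;U|Y,A)` with `A = η(U)` (base-2 logarithms). -/
def IXUcondYAu (PX : X → ℝ) (PW : A → X → Y → ℝ) {n : ℕ} (PU : X → Fin n → ℝ)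
    (η : Fin n → A) : ℝ :=
  ∑ x, ∑ y, ∑ u, pUJoint PX PW PU η x y u *
    Real.logb 2 (pUJoint PX PW PU η x y u * pYAu PX PW PU η y (η u) /
      (pXYAu PX PW PU η x y (η u) * pYUu PX PW PU η y u))

/-- Average distortion `E[d(X, X̂ᵒᵖᵗ(U,Y))]` with the optimal estimator
`X̂ᵒᵖᵗ(u,y) = argmin_{xh} E[d(X,xh)|U=u,Y=y]`, written as
`∑_{y,u} min_{xh} ∑_x P(x,y,u) d(x,xh)`. -/
def expDistU [Nonempty Xh] (PX : X → ℝ) (PW : A → X → Y → ℝ) (dist : X → Xh → ℝ)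
    {n : ℕ} (PU : X → Fin n → ℝ) (η : Fin n → A) : ℝ :=
  ∑ y, ∑ u, Finset.univ.inf' Finset.univ_nonempty
    (fun xh : Xh => ∑ x, pUJoint PX PW PU η x y u * dist x xh)

/-- Average action cost `E[Δ(η(U))]`. -/
def expCostU (PX : X → ℝ) (cost : A → ℝ) {n : ℕ} (PU : X → Fin n → ℝ)
    (η : Fin n → A) : ℝ :=
  ∑ x, ∑ u, PX x * PU x u * cost (η u)

/-- The single-letter minimization `min I(X;A) + I(X;U|Y,A)` over all finite auxiliary
alphabets (represented as `Fin n`), conditional pmfs `P_{U|X}` and functions `η : U → A`,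
subject to the distortion and cost constraints. -/
def RDCU [Nonempty Xh] (PX : X → ℝ) (PW : A → X → Y → ℝ) (dist : X → Xh → ℝ)
    (cost : A → ℝ) (D C : ℝ) : ℝ :=
  sInf { r : ℝ | ∃ n : ℕ, ∃ PU : X → Fin n → ℝ, ∃ η : Fin n → A, IsCondPMF PU ∧
    expDistU PX PW dist PU η ≤ D ∧ expCostU PX cost PU η ≤ C ∧
    r = IXAu PX PU η + IXUcondYAu PX PW PU η }

/-- The same single-letter minimization with the auxiliary-alphabet cardinality
restricted as `|U| ≤ |X||A| + 2`. -/
def RDCUbdd [Nonempty Xh] (PX : X → ℝ) (PW : A → X → Y → ℝ) (dist : X → Xh → ℝ)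
    (cost : A → ℝ) (D C : ℝ) : ℝ :=
  sInf { r : ℝ | ∃ n : ℕ, n ≤ Fintype.card X * Fintype.card A + 2 ∧
    ∃ PU : X → Fin n → ℝ, ∃ η : Fin n → A, IsCondPMF PU ∧
    expDistU PX PW dist PU η ≤ D ∧ expCostU PX cost PU η ≤ C ∧
    r = IXAu PX PU η + IXUcondYAu PX PW PU η }
/-- Probability of an i.i.d. source block. -/
def iidProb (PX : X → ℝ) {n : ℕ} (xs : Fin n → X) : ℝ := ∏ i, PX (xs i)

/-- Conditional probability of the side-information block given source and actions. -/
def sideProb (PW : A → X → Y → ℝ) {n : ℕ} (as : Fin n → A) (xs : Fin n → X)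
    (ys : Fin n → Y) : ℝ :=
  ∏ i, PW (as i) (xs i) (ys i)

/-- Expected total block distortion `E[∑ i, d(X_i, X̂_i)]` of a code `(f, g, h)`. -/
def blockDist (PX : X → ℝ) (PW : A → X → Y → ℝ) (dist : X → Xh → ℝ) {n m : ℕ}
    (f : (Fin n → X) → Fin m) (g : Fin m → Fin n → A)
    (h : Fin m → (Fin n → Y) → Fin n → Xh) : ℝ :=
  ∑ xs : Fin n → X, ∑ ys : Fin n → Y,
    iidProb PX xs * sideProb PW (g (f xs)) xs ys * ∑ i, dist (xs i) (h (f xs) ys i)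

/-- Expected total block action cost `E[∑ i, Δ(A_i)]` of a code `(f, g)`. -/
def blockCost (PX : X → ℝ) (cost : A → ℝ) {n m : ℕ}
    (f : (Fin n → X) → Fin m) (g : Fin m → Fin n → A) : ℝ :=
  ∑ xs : Fin n → X, iidProb PX xs * ∑ i, cost (g (f xs) i)

/-- The tuple `(R,D,C)` is (operationally) achievable. -/
def Achievable (PX : X → ℝ) (PW : A → X → Y → ℝ) (dist : X → Xh → ℝ) (cost : A → ℝ)
    (R D C : ℝ) : Prop :=
  ∀ ε : ℝ, 0 < ε → ∃ N : ℕ, ∀ n : ℕ, N ≤ n →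
    ∃ f : (Fin n → X) → Fin ⌊(2:ℝ) ^ ((n : ℝ) * R)⌋₊,
    ∃ g : Fin ⌊(2:ℝ) ^ ((n : ℝ) * R)⌋₊ → Fin n → A,
    ∃ h : Fin ⌊(2:ℝ) ^ ((n : ℝ) * R)⌋₊ → (Fin n → Y) → Fin n → Xh,
      blockDist PX PW dist f g h ≤ n * (D + ε) ∧
      blockCost PX cost f g ≤ n * (C + ε)

/-- The operational rate-distortion-cost function: the infimum of all achievable rates. -/
def opRDC (PX : X → ℝ) (PW : A → X → Y → ℝ) (dist : X → Xh → ℝ) (cost : A → ℝ)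
    (D C : ℝ) : ℝ :=
  sInf { R : ℝ | Achievable PX PW dist cost R D C }

set_option linter.unusedSectionVars false

/-! ### Finite sums over words -/

lemma sum_prod_word {Z : Type*} [Fintype Z] {n : ℕ} (w : Fin n → Z → ℝ) :
    ∑ z : Fin n → Z, ∏ i, w i (z i) = ∏ i, ∑ z, w i z := by
  rw [Finset.prod_univ_sum, Fintype.piFinset_univ]

lemma prod_ite_one_zero {n : ℕ} (P : Fin n → Prop) [DecidablePred P] [Decidable (∀ i, P i)] :
    (∏ i, if P i then (1 : ℝ) else 0) = if ∀ i, P i then 1 else 0 := by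
  split_ifs with h
  · exact Finset.prod_eq_one fun i _ => if_pos (h i)
  · push Not at h
    obtain ⟨i, hi⟩ := h
    exact Finset.prod_eq_zero (Finset.mem_univ i) (if_neg hi)

/-- A weighted average is attained from below. -/
lemma exists_le_of_weighted_sum_le {Z : Type*} [Fintype Z] (w G : Z → ℝ) (b : ℝ)
    (hw : ∀ z, 0 ≤ w z) (hw1 : ∑ z, w z = 1) (h : ∑ z, w z * G z ≤ b) : ∃ z, G z ≤ b := by
  by_contra! hc
  have hpos : ∃ z, 0 < w z := by
    by_contra! hz
    have : ∑ z, w z ≤ 0 := Finset.sum_nonpos fun z _ => hz z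
    linarith
  obtain ⟨z₀, hz₀⟩ := hpos
  have : ∑ z, w z * b < ∑ z, w z * G z :=
    Finset.sum_lt_sum (fun z _ => mul_le_mul_of_nonneg_left (hc z).le (hw z))
      ⟨z₀, Finset.mem_univ _, mul_lt_mul_of_pos_left (hc z₀) hz₀⟩
  rw [← Finset.sum_mul, hw1, one_mul] at this
  linarith

/-- Chernoff bound for sums of independent letters. -/
lemma exists_chernoff {Z : Type*} [Fintype Z] (p f : Z → ℝ) (hp : ∀ z, 0 ≤ p z)
    (hp1 : ∑ z, p z = 1) (μ : ℝ) (hμ : ∑ z, p z * f z < μ) :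
    ∃ ρ : ℝ, 0 ≤ ρ ∧ ρ < 1 ∧ ∀ n : ℕ,
      ∑ z : Fin n → Z, (∏ i, p (z i)) * (if n * μ < ∑ i, f (z i) then 1 else 0) ≤ ρ ^ n := by
  obtain ⟨K, hK0, hK⟩ : ∃ K : ℝ, 0 < K ∧ ∀ z, |f z - μ| ≤ K := by
    refine ⟨1 + ∑ z, |f z - μ|, by positivity, fun z => ?_⟩
    have := Finset.single_le_sum (f := fun z => |f z - μ|) (fun z _ => abs_nonneg _)
      (Finset.mem_univ z)
    linarith
  set δ := μ - ∑ z, p z * f z with hδ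
  have hδ0 : 0 < δ := by linarith
  obtain ⟨s, hs0, hsK, hsδ⟩ : ∃ s : ℝ, 0 < s ∧ s * K ≤ 1 ∧ s * K ^ 2 < δ := by
    refine ⟨min (1 / K) (δ / (2 * K ^ 2)), by positivity, ?_, ?_⟩
    · calc _ ≤ 1 / K * K := by gcongr; exact min_le_left _ _
        _ = 1 := by field_simp
    · calc _ ≤ δ / (2 * K ^ 2) * K ^ 2 := by gcongr; exact min_le_right _ _
        _ = δ / 2 := by field_simp
        _ < δ := by linarith
  set ρ := ∑ z, p z * Real.exp (s * (f z - μ)) with hρ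
  refine ⟨ρ, Finset.sum_nonneg fun z _ => mul_nonneg (hp z) (Real.exp_pos _).le, ?_, fun n => ?_⟩
  · have hz : ∀ z, Real.exp (s * (f z - μ)) ≤ 1 + s * (f z - μ) + s ^ 2 * K ^ 2 := by
      intro z
      have h1 : |s * (f z - μ)| ≤ 1 := by
        rw [abs_mul, abs_of_pos hs0]
        exact (mul_le_mul_of_nonneg_left (hK z) hs0.le).trans hsK
      have h2 := (abs_le.mp (Real.abs_exp_sub_one_sub_id_le h1)).2
      have h3 : (f z - μ) ^ 2 ≤ K ^ 2 := sq_le_sq' (abs_le.mp (hK z)).1 (abs_le.mp (hK z)).2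
      nlinarith [mul_le_mul_of_nonneg_left h3 (sq_nonneg s)]
    have h4 : ρ ≤ ∑ z, p z * (1 + s * (f z - μ) + s ^ 2 * K ^ 2) :=
      Finset.sum_le_sum fun z _ => mul_le_mul_of_nonneg_left (hz z) (hp z)
    have h5 : ∑ z, p z * (1 + s * (f z - μ) + s ^ 2 * K ^ 2) =
        (1 - s * μ + s ^ 2 * K ^ 2) * ∑ z, p z + s * ∑ z, p z * f z := by
      rw [Finset.mul_sum, Finset.mul_sum, ← Finset.sum_add_distrib]
      exact Finset.sum_congr rfl fun z _ => by ring
    rw [h5, hp1] at h4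
    nlinarith [mul_lt_mul_of_pos_left hsδ hs0]
  · rw [hρ, ← Fin.prod_const, ← sum_prod_word]
    refine Finset.sum_le_sum fun z _ => ?_
    rw [Finset.prod_mul_distrib, ← Real.exp_sum, ← Finset.mul_sum, Finset.sum_sub_distrib]
    refine mul_le_mul_of_nonneg_left ?_ (Finset.prod_nonneg fun i _ => hp _)
    split_ifs with h
    · refine Real.one_le_exp (mul_nonneg hs0.le ?_)
      simp only [Finset.sum_const, Finset.card_univ, Fintype.card_fin, nsmul_eq_mul]
      linarith
    · exact (Real.exp_pos _).le

/-! ### Random coding bounds for a single block -/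

lemma one_sub_pow_le_of_div_le {q t K : ℝ} (M : ℕ) (hq1 : q ≤ 1) (hK : 0 < K)
    (ht0 : 0 ≤ t) (ht1 : t ≤ 1) (h : t ≤ K * q) :
    (1 - q) ^ M ≤ 1 - t + Real.exp (-(M / K)) := by
  have h1 : (1 - q) ^ M ≤ Real.exp (-(M * q)) := by
    calc (1 - q) ^ M ≤ (Real.exp (-q)) ^ M :=
          pow_le_pow_left₀ (by linarith) (Real.one_sub_le_exp_neg q) M
      _ = Real.exp (-(M * q)) := by rw [← Real.exp_nat_mul]; ring_nf
  have h2 : Real.exp (-(M * q)) ≤ Real.exp ((1 - t) * 0 + t * (-(M / K))) := by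
    apply Real.exp_le_exp.mpr
    have : t / K ≤ q := by rw [div_le_iff₀ hK]; linarith
    have h3 : (M : ℝ) * (t / K) ≤ M * q := mul_le_mul_of_nonneg_left this (Nat.cast_nonneg M)
    have h4 : t * (-(M / K)) = -(M * (t / K)) := by ring
    linarith
  have h3 := convexOn_exp.2 (Set.mem_univ (0 : ℝ)) (Set.mem_univ (-(M / K)))
    (by linarith : (0 : ℝ) ≤ 1 - t) ht0 (by ring)
  simp only [smul_eq_mul, Real.exp_zero, mul_one] at h3
  have h4 : t * Real.exp (-(M / K)) ≤ Real.exp (-(M / K)) :=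
    mul_le_of_le_one_left (Real.exp_pos _).le ht1
  rw [mul_zero] at h2 h3
  linarith

open Classical in
/-- The probability that none of `M` independent codewords falls in `S`. -/
lemma sum_word_forall_notMem {Z : Type*} [Fintype Z] (q : Z → ℝ) (hq1 : ∑ z, q z = 1)
    (S : Z → Prop) (M : ℕ) :
    ∑ c : Fin M → Z, (∏ i, q (c i)) * (if ∀ i, ¬ S (c i) then 1 else 0) =
      (1 - ∑ z, q z * (if S z then 1 else 0)) ^ M := by
  have h1 : 1 - ∑ z, q z * (if S z then 1 else 0) = ∑ z, q z * (if ¬ S z then 1 else 0) := by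
    nth_rewrite 1 [← hq1]
    rw [← Finset.sum_sub_distrib]
    refine Finset.sum_congr rfl fun z _ => ?_
    by_cases h : S z <;> simp [h]
  rw [h1, ← Fin.prod_const, ← sum_prod_word]
  refine Finset.sum_congr rfl fun c _ => ?_
  rw [Finset.prod_mul_distrib, prod_ite_one_zero]

open Classical in
/-- Covering lemma: some codebook of size `M` covers most source symbols. -/
lemma exists_covering_codebook {𝒳 Z : Type*} [Fintype 𝒳] [Fintype Z] (w : 𝒳 → ℝ)
    (hw : ∀ x, 0 ≤ w x) (q : Z → ℝ) (hq : ∀ z, 0 ≤ q z) (hq1 : ∑ z, q z = 1)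
    (S : 𝒳 → Z → Prop) (t : 𝒳 → ℝ) (ht0 : ∀ x, 0 ≤ t x) (ht1 : ∀ x, t x ≤ 1) {K : ℝ}
    (hK : 0 < K) (h : ∀ x, t x ≤ K * ∑ z, q z * (if S x z then 1 else 0)) (M : ℕ) :
    ∑ c : Fin M → Z, (∏ i, q (c i)) * ∑ x, w x * (if ∀ i, ¬ S x (c i) then 1 else 0) ≤
      ∑ x, w x * (1 - t x + Real.exp (-(M / K))) := by
  simp_rw [Finset.mul_sum]
  rw [Finset.sum_comm]
  refine Finset.sum_le_sum fun x _ => ?_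
  have : ∀ c : Fin M → Z, (∏ i, q (c i)) * (w x * (if ∀ i, ¬ S x (c i) then 1 else 0)) =
      w x * ((∏ i, q (c i)) * (if ∀ i, ¬ S x (c i) then 1 else 0)) := fun c => by ring
  simp_rw [this]
  rw [← Finset.mul_sum, sum_word_forall_notMem q hq1]
  refine mul_le_mul_of_nonneg_left ?_ (hw x)
  refine one_sub_pow_le_of_div_le M ?_ hK (ht0 x) (ht1 x) (h x)
  refine le_of_le_of_eq (Finset.sum_le_sum fun z _ => ?_) hq1
  have := hq z
  split_ifs <;> simp [this]

lemma sum_word_collision {L B : ℕ} {l l' : Fin L} (h : l ≠ l') :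
    ∑ b : Fin L → Fin B, (∏ _i : Fin L, (1 / B : ℝ)) * (if b l' = b l then 1 else 0) ≤
      1 / B := by
  rcases Nat.eq_zero_or_pos B with hB | hB
  · subst hB
    have : IsEmpty (Fin L → Fin 0) := ⟨fun b => (b l).elim0⟩
    simp
  have hB' : (B : ℝ) ≠ 0 := by positivity
  have key : ∀ b : Fin L → Fin B, (∏ _i : Fin L, (1 / B : ℝ)) * (if b l' = b l then 1 else 0) =
      ∑ j, ∏ i, (1 / B : ℝ) * ((if i = l then if b i = j then 1 else 0 else 1) *
        (if i = l' then if b i = j then 1 else 0 else 1)) := by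
    intro b
    simp_rw [Finset.prod_mul_distrib]
    rw [← Finset.mul_sum]
    congr 1
    simp [eq_comm]
  simp_rw [key]
  rw [Finset.sum_comm]
  have h2 : ∀ j : Fin B, (∑ b : Fin L → Fin B, ∏ i, (1 / B : ℝ) *
      ((if i = l then if b i = j then 1 else 0 else 1) *
        (if i = l' then if b i = j then 1 else 0 else 1))) = 1 / B * (1 / B) := by
    intro j
    rw [sum_prod_word (fun i z => (1 / B : ℝ) *
      ((if i = l then if z = j then 1 else 0 else 1) *
        (if i = l' then if z = j then 1 else 0 else 1)))]
    have h3 : ∀ i : Fin L, (∑ z : Fin B, (1 / B : ℝ) *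
      ((if i = l then if z = j then 1 else 0 else 1) *
        (if i = l' then if z = j then 1 else 0 else 1))) =
        (if i = l then (1 / B : ℝ) else 1) * (if i = l' then (1 / B : ℝ) else 1) := by
      intro i
      by_cases h1 : i = l
      · have : i ≠ l' := fun h4 => h (h1.symm.trans h4)
        simp [h1, h]
      · by_cases h2 : i = l'
        · simp [h2, h.symm]
        · simp [h1, h2, hB']
    simp_rw [h3, Finset.prod_mul_distrib]
    simp
  simp_rw [h2]
  simp [hB']

lemma sum_word_marginal {Z : Type*} [Fintype Z] (q : Z → ℝ) (hq1 : ∑ z, q z = 1) {L : ℕ}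
    (g : Z → ℝ) (l : Fin L) :
    ∑ u : Fin L → Z, (∏ i, q (u i)) * g (u l) = ∑ z, q z * g z := by
  have key : ∀ u : Fin L → Z, (∏ i, q (u i)) * g (u l) =
      ∏ i, q (u i) * (if i = l then g (u i) else 1) := by
    intro u
    rw [Finset.prod_mul_distrib]
    simp
  simp_rw [key]
  rw [sum_prod_word (fun i z => q z * (if i = l then g z else 1)),
    Finset.prod_eq_single l]
  · simp
  · intro i _ hi
    simp [hi, hq1]
  · simp

open Classical in
/-- Random codebook together with random binning, for a fixed action word. -/
lemma exists_binned_codebook {𝒳 𝒰 𝒴 : Type*} [Fintype 𝒳] [Fintype 𝒰] [Fintype 𝒴]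
    (w : 𝒳 → ℝ) (hw : ∀ x, 0 ≤ w x) (V : 𝒳 → 𝒴 → ℝ) (hV : ∀ x y, 0 ≤ V x y)
    (hV1 : ∀ x, ∑ y, V x y = 1) (q : 𝒰 → ℝ) (hq : ∀ u, 0 ≤ q u) (hq1 : ∑ u, q u = 1)
    (F : 𝒳 → 𝒰 → Prop) (S : 𝒰 → 𝒴 → Prop) {s K κ : ℝ} (hs0 : 0 ≤ s) (hs1 : s ≤ 1)
    (hK : 0 < K) (hF : ∀ x, 0 < w x → 1 - s ≤ K * ∑ u, q u * (if F x u then 1 else 0))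
    (hS : ∀ y, ∑ u, q u * (if S u y then 1 else 0) ≤ κ) {L B : ℕ} (hL : 0 < L) (hB : 0 < B) :
    ∃ (u : Fin L → 𝒰) (b : Fin L → Fin B) (r : 𝒳 → Fin L),
      ∑ x, w x * ((if ¬ F x (u (r x)) then 1 else 0) + ∑ y, V x y *
        (if ∃ l, l ≠ r x ∧ b l = b (r x) ∧ S (u l) y then 1 else 0)) ≤
      ∑ x, w x * (s + Real.exp (-(L / K)) + L * κ / B) := by
  have hB' : (0 : ℝ) < B := by exact_mod_cast hB
  obtain ⟨u, hu⟩ : ∃ u : Fin L → 𝒰,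
      ∑ x, w x * (if ∀ l, ¬ F x (u l) then 1 else 0) +
        ∑ x, w x * ∑ y, V x y * ∑ l, (if S (u l) y then 1 else 0) * (1 / B : ℝ) ≤
      ∑ x, w x * (s + Real.exp (-(L / K)) + L * κ / B) := by
    refine exists_le_of_weighted_sum_le (fun u : Fin L → 𝒰 => ∏ i, q (u i)) _ _
      (fun u => Finset.prod_nonneg fun i _ => hq _) ?_ ?_
    · rw [sum_prod_word (fun _ z => q z)]
      simp [hq1]
    simp_rw [mul_add]
    rw [Finset.sum_add_distrib, Finset.sum_add_distrib]
    simp_rw [← mul_add]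
    refine add_le_add ?_ ?_
    · refine (exists_covering_codebook w hw q hq hq1 F (fun x => if 0 < w x then 1 - s else 0)
        ?_ ?_ hK ?_ L).trans ?_
      · intro x; split_ifs <;> linarith
      · intro x; split_ifs <;> linarith
      · intro x
        split_ifs with h
        · exact hF x h
        · refine mul_nonneg hK.le (Finset.sum_nonneg fun u _ => mul_nonneg (hq u) ?_)
          split_ifs <;> norm_num
      · refine Finset.sum_le_sum fun x _ => ?_
        split_ifs with h
        · linarith
        · have : w x = 0 := le_antisymm (not_lt.mp h) (hw x)
          simp [this]
    · have hswap : ∑ u : Fin L → 𝒰, (∏ i, q (u i)) * ∑ x, w x * ∑ y, V x y *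
          ∑ l, (if S (u l) y then 1 else 0) * (1 / B : ℝ) =
          ∑ x, w x * ∑ y, V x y * ∑ l : Fin L, ∑ u : Fin L → 𝒰, (∏ i, q (u i)) *
            ((if S (u l) y then 1 else 0) * (1 / B : ℝ)) := by
        simp_rw [Finset.mul_sum]
        rw [Finset.sum_comm]
        refine Finset.sum_congr rfl fun x _ => ?_
        rw [Finset.sum_comm]
        refine Finset.sum_congr rfl fun y _ => ?_
        rw [Finset.sum_comm]
        refine Finset.sum_congr rfl fun l _ => Finset.sum_congr rfl fun u _ => ?_
        ring
      rw [hswap]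
      refine Finset.sum_le_sum fun x _ => mul_le_mul_of_nonneg_left ?_ (hw x)
      calc _ ≤ ∑ y, V x y * (L * κ / B) := by
            refine Finset.sum_le_sum fun y _ => mul_le_mul_of_nonneg_left ?_ (hV x y)
            have : ∀ l : Fin L, ∑ u : Fin L → 𝒰, (∏ i, q (u i)) *
                ((if S (u l) y then 1 else 0) * (1 / B : ℝ)) ≤ κ / B := by
              intro l
              rw [sum_word_marginal q hq1 (fun z => (if S z y then 1 else 0) * (1 / B : ℝ)) l]
              simp_rw [← mul_assoc]
              rw [← Finset.sum_mul, mul_one_div]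
              exact div_le_div_of_nonneg_right (hS y) hB'.le
            refine (Finset.sum_le_sum fun l _ => this l).trans (le_of_eq ?_)
            simp
            ring
        _ = L * κ / B := by rw [← Finset.sum_mul, hV1, one_mul]
  set r : 𝒳 → Fin L := fun x => if h : ∃ l, F x (u l) then h.choose else ⟨0, hL⟩ with hr
  obtain ⟨b, hb⟩ : ∃ b : Fin L → Fin B, ∑ x, w x * ∑ y, V x y *
        (if ∃ l, l ≠ r x ∧ b l = b (r x) ∧ S (u l) y then 1 else 0) ≤
      ∑ x, w x * ∑ y, V x y * ∑ l, (if S (u l) y then 1 else 0) * (1 / B : ℝ) := by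
    refine exists_le_of_weighted_sum_le (fun b : Fin L → Fin B => ∏ _i : Fin L, (1 / B : ℝ)) _ _
      (fun u => Finset.prod_nonneg fun i _ => by positivity) ?_ ?_
    · rw [sum_prod_word (fun _ _ => (1 / B : ℝ))]
      simp [hB'.ne']
    simp_rw [Finset.mul_sum]
    rw [Finset.sum_comm]
    refine Finset.sum_le_sum fun x _ => ?_
    rw [Finset.sum_comm]
    refine Finset.sum_le_sum fun y _ => ?_
    have h1 : ∀ b : Fin L → Fin B, (if ∃ l, l ≠ r x ∧ b l = b (r x) ∧ S (u l) y
        then (1 : ℝ) else 0) ≤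
        ∑ l, (if S (u l) y then 1 else 0) *
          (if l ≠ r x then if b l = b (r x) then 1 else 0 else 0) := by
      intro b
      have hnn : ∀ l ∈ univ, 0 ≤ (if S (u l) y then (1 : ℝ) else 0) *
          (if l ≠ r x then if b l = b (r x) then 1 else 0 else 0) := by
        intro l _
        split_ifs <;> norm_num
      split_ifs with h
      · obtain ⟨l, hl1, hl2, hl3⟩ := h
        refine le_trans ?_ (Finset.single_le_sum hnn (Finset.mem_univ l))
        simp [hl1, hl2, hl3]
      · exact Finset.sum_nonneg hnn
    calc _ ≤ ∑ b : Fin L → Fin B, ∑ l, w x * (V x y * ((if S (u l) y then 1 else 0) *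
          ((∏ _i : Fin L, (1 / B : ℝ)) *
            (if l ≠ r x then if b l = b (r x) then 1 else 0 else 0)))) := by
          refine Finset.sum_le_sum fun b _ => ?_
          have h2 : 0 ≤ (∏ _i : Fin L, (1 / B : ℝ)) * (w x * V x y) :=
            mul_nonneg (Finset.prod_nonneg fun i _ => by positivity)
              (mul_nonneg (hw x) (hV x y))
          have h3 := mul_le_mul_of_nonneg_left (h1 b) h2
          rw [Finset.mul_sum] at h3
          refine le_trans (le_of_eq (by ring)) (h3.trans (le_of_eq ?_))
          exact Finset.sum_congr rfl fun l _ => by ring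
      _ = ∑ l, w x * (V x y * ((if S (u l) y then 1 else 0) *
          ∑ b : Fin L → Fin B, ((∏ _i : Fin L, (1 / B : ℝ)) *
            (if l ≠ r x then if b l = b (r x) then 1 else 0 else 0)))) := by
          rw [Finset.sum_comm]
          simp_rw [Finset.mul_sum]
      _ ≤ _ := by
          refine Finset.sum_le_sum fun l _ => ?_
          refine mul_le_mul_of_nonneg_left (mul_le_mul_of_nonneg_left
            (mul_le_mul_of_nonneg_left ?_ (by split_ifs <;> norm_num)) (hV x y)) (hw x)
          by_cases hl : l = r x
          · simp [hl]
          · simp only [ne_eq, hl, not_false_eq_true, if_true]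
            exact sum_word_collision (Ne.symm hl)
  refine ⟨u, b, r, ?_⟩
  simp_rw [mul_add] at hu ⊢
  rw [Finset.sum_add_distrib]
  refine le_trans (add_le_add (le_of_eq ?_) hb) hu
  refine Finset.sum_congr rfl fun x _ => ?_
  congr 1
  by_cases h : ∃ l, F x (u l)
  · have h1 : F x (u (r x)) := by
      simp only [hr, h, dite_true]
      exact h.choose_spec
    rw [if_neg (not_not.mpr h1), if_neg]
    push Not
    exact h
  · push Not at h
    rw [if_pos (h _), if_pos h]

open Classical in
/-- One-shot coding theorem with an action codebook, a superimposed codebook and random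
binning. `T` is the set of good triples and `S` is the decoder's compatibility test. -/
lemma exists_block_code {𝒳 𝒜 𝒰 𝒴 : Type*} [Fintype 𝒳] [Fintype 𝒜] [Fintype 𝒰] [Fintype 𝒴]
    [DecidableEq 𝒜] (p : 𝒳 → ℝ) (hp : ∀ x, 0 ≤ p x) (hp1 : ∑ x, p x = 1)
    (γ : 𝒳 → 𝒰 → ℝ) (hγ : ∀ x u, 0 ≤ γ x u) (hγ1 : ∀ x, ∑ u, γ x u = 1) (η : 𝒰 → 𝒜)
    (W : 𝒜 → 𝒳 → 𝒴 → ℝ) (hW : ∀ a x y, 0 ≤ W a x y) (hW1 : ∀ a x, ∑ y, W a x y = 1)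
    (qA : 𝒜 → ℝ) (hqA : ∀ a, 0 ≤ qA a) (hqA1 : ∑ a, qA a = 1)
    (qU : 𝒜 → 𝒰 → ℝ) (hqU : ∀ a u, 0 ≤ qU a u) (hqU1 : ∀ a, ∑ u, qU a u = 1)
    (α : 𝒳 → 𝒜 → ℝ) (hα : ∀ x a, α x a = ∑ u, if η u = a then γ x u else 0)
    (T : 𝒳 → 𝒰 → 𝒴 → Prop) (S : 𝒜 → 𝒰 → 𝒴 → Prop) {K₁ K₂ κ s : ℝ} (hK₁ : 0 < K₁)
    (hK₂ : 0 < K₂) (hs0 : 0 < s) (hs1 : s < 1)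
    (hT₁ : ∀ x u y, T x u y → α x (η u) ≤ K₁ * qA (η u))
    (hT₂ : ∀ x u y, T x u y → γ x u ≤ K₂ * (α x (η u) * qU (η u) u))
    (hTS : ∀ x u y, T x u y → S (η u) u y)
    (hS : ∀ a y, ∑ u, qU a u * (if S a u y then 1 else 0) ≤ κ) (hκ : 0 ≤ κ)
    (hT : ∑ x, p x * ∑ u, γ x u * ∑ y, W (η u) x y * (if ¬ T x u y then 1 else 0) ≤ s ^ 3)
    {M L B : ℕ} (hM : 0 < M) (hL : 0 < L) (hB : 0 < B) :
    ∃ (c : Fin M → 𝒜) (enc : 𝒳 → Fin M × Fin B) (dec : Fin M × Fin B → 𝒴 → 𝒰),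
      ∑ x, p x * ∑ y, W (c (enc x).1) x y *
        (if η (dec (enc x) y) = c (enc x).1 ∧ T x (dec (enc x) y) y then 0 else 1) ≤
      3 * s + Real.exp (-(M / K₁)) + Real.exp (-(L / K₂)) + L * κ / B := by
  have ite_nonneg : ∀ (P : Prop) [Decidable P], (0 : ℝ) ≤ if P then 1 else 0 := fun P _ => by
    split_ifs <;> norm_num
  have hα0 : ∀ x a, 0 ≤ α x a := fun x a => by
    rw [hα]
    exact Finset.sum_nonneg fun u _ => by split_ifs <;> simp [hγ]
  have hα1 : ∀ x, ∑ a, α x a = 1 := fun x => by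
    simp_rw [hα]
    rw [Finset.sum_comm]
    simp [hγ1]
  obtain ⟨F, hF⟩ : ∃ F : 𝒳 → 𝒰 → Prop, ∀ x u, F x u ↔
      ∑ y, W (η u) x y * (if ¬ T x u y then 1 else 0) ≤ s := ⟨_, fun _ _ => Iff.rfl⟩
  obtain ⟨F₁, hF₁⟩ : ∃ F₁ : 𝒳 → 𝒜 → Prop, ∀ x a, F₁ x a ↔
      ∑ u, (if η u = a then γ x u else 0) * (if ¬ F x u then 1 else 0) < s * α x a :=
    ⟨_, fun _ _ => Iff.rfl⟩
  have hFT : ∀ x u, F x u → ∃ y, T x u y := by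
    intro x u h
    by_contra! hn
    have : ∑ y, W (η u) x y * (if ¬ T x u y then 1 else 0) = 1 := by
      simp [hn, hW1]
    have h1 := (hF x u).mp h
    linarith
  have hF₁pos : ∀ x a, F₁ x a → 0 < α x a := by
    intro x a h
    have h1 : 0 ≤ ∑ u, (if η u = a then γ x u else 0) * (if ¬ F x u then (1 : ℝ) else 0) :=
      Finset.sum_nonneg fun u _ => mul_nonneg (by split_ifs <;> simp [hγ]) (ite_nonneg _)
    have h2 : 0 < s * α x a := h1.trans_lt ((hF₁ x a).mp h)
    exact pos_of_mul_pos_right h2 hs0.le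
  have hF₁mass : ∀ x a, F₁ x a → (1 - s) * α x a ≤
      ∑ u, (if η u = a then γ x u else 0) * (if F x u then 1 else 0) := by
    intro x a h
    have h1 : α x a = ∑ u, (if η u = a then γ x u else 0) * (if F x u then 1 else 0) +
        ∑ u, (if η u = a then γ x u else 0) * (if ¬ F x u then 1 else 0) := by
      rw [hα, ← Finset.sum_add_distrib]
      refine Finset.sum_congr rfl fun u _ => ?_
      by_cases hFu : F x u <;> simp [hFu]
    have h2 : ∑ u, (if η u = a then γ x u else 0) * (if ¬ F x u then 1 else 0) < s * α x a :=
      (hF₁ x a).mp h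
    linarith
  have hF₁K : ∀ x a, F₁ x a → α x a ≤ K₁ * qA a := by
    intro x a h
    obtain ⟨u, hu1, hu2⟩ : ∃ u, η u = a ∧ F x u := by
      by_contra! hn
      have h1 := hF₁mass x a h
      have h2 : ∑ u, (if η u = a then γ x u else 0) * (if F x u then (1 : ℝ) else 0) = 0 := by
        refine Finset.sum_eq_zero fun u _ => ?_
        by_cases hu : η u = a
        · simp [hn u hu]
        · simp [hu]
      have h3 := mul_pos (sub_pos.mpr hs1) (hF₁pos x a h)
      linarith
    obtain ⟨y, hy⟩ := hFT x u hu2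
    have := hT₁ x u y hy
    rwa [hu1] at this
  have hF₂K : ∀ x a, F₁ x a →
      1 - s ≤ K₂ * ∑ u, qU a u * (if η u = a ∧ F x u then 1 else 0) := by
    intro x a h
    have h0 := hF₁pos x a h
    have h1 := hF₁mass x a h
    have h2 : ∑ u, (if η u = a then γ x u else 0) * (if F x u then (1 : ℝ) else 0) ≤
        ∑ u, α x a * (K₂ * (qU a u * (if η u = a ∧ F x u then 1 else 0))) := by
      refine Finset.sum_le_sum fun u _ => ?_
      by_cases hu : η u = a
      · by_cases hFu : F x u
        · obtain ⟨y, hy⟩ := hFT x u hFu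
          have := hT₂ x u y hy
          rw [hu] at this
          simp only [hu, hFu, if_true, and_self, mul_one]
          linarith
        · simp [hFu]
      · simp [hu]
    rw [← Finset.mul_sum, ← Finset.mul_sum] at h2
    have h3 := h1.trans h2
    rw [mul_comm (1 - s)] at h3
    exact le_of_mul_le_mul_left h3 h0
  have hbadF : ∑ x, p x * ∑ u, γ x u * (if ¬ F x u then 1 else 0) ≤ s ^ 2 := by
    have h1 : s * ∑ x, p x * ∑ u, γ x u * (if ¬ F x u then 1 else 0) ≤ s * s ^ 2 := by
      refine le_trans ?_ (hT.trans (le_of_eq (by ring)))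
      rw [Finset.mul_sum]
      refine Finset.sum_le_sum fun x _ => ?_
      rw [mul_left_comm]
      refine mul_le_mul_of_nonneg_left ?_ (hp x)
      rw [Finset.mul_sum]
      refine Finset.sum_le_sum fun u _ => ?_
      rw [mul_left_comm]
      refine mul_le_mul_of_nonneg_left ?_ (hγ x u)
      by_cases h : F x u
      · simp only [h, not_true, if_false, mul_zero]
        exact Finset.sum_nonneg fun y _ => mul_nonneg (hW _ _ _) (ite_nonneg _)
      · simp only [h, not_false_iff, if_true, mul_one]
        exact (not_le.mp (mt (hF x u).mpr h)).le
    exact le_of_mul_le_mul_left h1 hs0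
  have hbadF₁ : ∑ x, p x * ∑ a, α x a * (if ¬ F₁ x a then 1 else 0) ≤ s := by
    have h1 : s * ∑ x, p x * ∑ a, α x a * (if ¬ F₁ x a then 1 else 0) ≤ s * s := by
      refine le_trans ?_ (hbadF.trans (le_of_eq (by ring)))
      rw [Finset.mul_sum]
      refine Finset.sum_le_sum fun x _ => ?_
      rw [mul_left_comm]
      refine mul_le_mul_of_nonneg_left ?_ (hp x)
      rw [Finset.mul_sum]
      calc _ ≤ ∑ a, ∑ u, (if η u = a then γ x u else 0) * (if ¬ F x u then 1 else 0) := by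
            refine Finset.sum_le_sum fun a _ => ?_
            by_cases h : F₁ x a
            · simp only [h, not_true, if_false, mul_zero]
              exact Finset.sum_nonneg fun u _ =>
                mul_nonneg (by split_ifs <;> simp [hγ]) (ite_nonneg _)
            · simp only [h, not_false_iff, if_true, mul_one]
              exact not_lt.mp (mt (hF₁ x a).mpr h)
        _ = _ := by
            rw [Finset.sum_comm]
            refine Finset.sum_congr rfl fun u _ => ?_
            rw [← Finset.sum_mul]
            simp
    exact le_of_mul_le_mul_left h1 hs0
  obtain ⟨c, hc⟩ : ∃ c : Fin M → 𝒜, ∑ x, p x * (if ∀ i, ¬ F₁ x (c i) then 1 else 0) ≤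
      s + Real.exp (-(M / K₁)) := by
    refine exists_le_of_weighted_sum_le (fun c : Fin M → 𝒜 => ∏ i, qA (c i)) _ _
      (fun c => Finset.prod_nonneg fun i _ => hqA _) ?_ ?_
    · rw [sum_prod_word (fun _ a => qA a)]
      simp [hqA1]
    have h1 : ∀ x, ∑ a, α x a * (if ¬ F₁ x a then 1 else 0) =
        1 - ∑ a, α x a * (if F₁ x a then 1 else 0) := by
      intro x
      rw [eq_sub_iff_add_eq, ← Finset.sum_add_distrib]
      refine Eq.trans ?_ (hα1 x)
      refine Finset.sum_congr rfl fun a _ => ?_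
      by_cases h : F₁ x a <;> simp [h]
    refine (exists_covering_codebook p hp qA hqA hqA1 F₁
      (fun x => ∑ a, α x a * (if F₁ x a then 1 else 0)) ?_ ?_ hK₁ ?_ M).trans ?_
    · exact fun x => Finset.sum_nonneg fun a _ => mul_nonneg (hα0 x a) (ite_nonneg _)
    · intro x
      have h2 : 0 ≤ ∑ a, α x a * (if ¬ F₁ x a then (1 : ℝ) else 0) :=
        Finset.sum_nonneg fun a _ => mul_nonneg (hα0 x a) (ite_nonneg _)
      rw [h1] at h2
      linarith
    · intro x
      rw [Finset.mul_sum]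
      refine Finset.sum_le_sum fun a _ => ?_
      by_cases h : F₁ x a
      · simpa [h] using hF₁K x a h
      · simp [h]
    · simp_rw [← h1, mul_add]
      rw [Finset.sum_add_distrib, ← Finset.sum_mul, hp1, one_mul]
      linarith
  set ι : 𝒳 → Fin M := fun x => if h : ∃ i, F₁ x (c i) then h.choose else ⟨0, hM⟩ with hι
  have hιF : ∀ x, ¬ F₁ x (c (ι x)) → ∀ i, ¬ F₁ x (c i) := by
    intro x h i hi
    have h1 : ∃ i, F₁ x (c i) := ⟨i, hi⟩
    apply h
    simp only [hι, h1, dite_true]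
    exact h1.choose_spec
  set w : Fin M → 𝒳 → ℝ := fun i x => if ι x = i ∧ F₁ x (c i) then p x else 0 with hw
  have hw0 : ∀ i x, 0 ≤ w i x := fun i x => by
    simp only [hw]; split_ifs <;> simp [hp]
  have hwp : ∀ x, w (ι x) x ≤ p x := fun x => by
    simp only [hw]; split_ifs <;> simp [hp]
  obtain ⟨G, hG⟩ : ∃ G : Fin M → 𝒳 → 𝒰 → Prop, ∀ i x u, G i x u ↔ η u = c i ∧ F x u :=
    ⟨_, fun _ _ _ => Iff.rfl⟩
  have hstage : ∀ i, ∃ (u : Fin L → 𝒰) (b : Fin L → Fin B) (r : 𝒳 → Fin L),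
      ∑ x, w i x * ((if ¬ G i x (u (r x)) then 1 else 0) +
        ∑ y, W (c i) x y *
        (if ∃ l, l ≠ r x ∧ b l = b (r x) ∧ S (c i) (u l) y then 1 else 0)) ≤
      ∑ x, w i x * (s + Real.exp (-(L / K₂)) + L * κ / B) := by
    intro i
    refine exists_binned_codebook (w i) (hw0 i) (fun x y => W (c i) x y) (fun x y => hW _ _ _)
      (fun x => hW1 _ _) (qU (c i)) (hqU _) (hqU1 _) (G i) (S (c i))
      hs0.le hs1.le hK₂ ?_ (hS (c i)) hL hB
    intro x hx
    simp only [hw] at hx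
    split_ifs at hx with h
    · simp_rw [hG]
      exact hF₂K x (c i) h.2
    · exact absurd hx (lt_irrefl _)
  choose u b r hubr using hstage
  set dec : Fin M × Fin B → 𝒴 → 𝒰 := fun m y =>
    if h : ∃ l, b m.1 l = m.2 ∧ S (c m.1) (u m.1 l) y then u m.1 h.choose
    else u m.1 ⟨0, hL⟩ with hdec
  refine ⟨c, fun x => (ι x, b (ι x) (r (ι x) x)), dec, ?_⟩
  have hdec_eq : ∀ i l y, S (c i) (u i l) y →
      (¬ ∃ l', l' ≠ l ∧ b i l' = b i l ∧ S (c i) (u i l') y) → dec (i, b i l) y = u i l := by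
    intro i l y h1 h2
    have h3 : ∃ l', b i l' = b i l ∧ S (c i) (u i l') y := ⟨l, rfl, h1⟩
    simp only [hdec, h3, dite_true]
    congr 1
    by_contra h4
    exact h2 ⟨h3.choose, h4, h3.choose_spec.1, h3.choose_spec.2⟩
  have hpt : ∀ x, p x * ∑ y, W (c (ι x)) x y *
      (if η (dec (ι x, b (ι x) (r (ι x) x)) y) = c (ι x) ∧
        T x (dec (ι x, b (ι x) (r (ι x) x)) y) y then 0 else 1) ≤
      p x * (if ∀ i, ¬ F₁ x (c i) then 1 else 0) + p x * s + w (ι x) x *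
        ((if ¬ G (ι x) x (u (ι x) (r (ι x) x)) then 1 else 0) +
        ∑ y, W (c (ι x)) x y * (if ∃ l, l ≠ r (ι x) x ∧ b (ι x) l = b (ι x) (r (ι x) x) ∧
          S (c (ι x)) (u (ι x) l) y then 1 else 0)) := by
    intro x
    have hle1 : ∀ (Q : 𝒴 → Prop) [DecidablePred Q],
        ∑ y, W (c (ι x)) x y * (if Q y then 0 else 1) ≤ 1 := by
      intro Q _
      refine le_of_le_of_eq (Finset.sum_le_sum fun y _ => ?_) (hW1 (c (ι x)) x)
      have := hW (c (ι x)) x y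
      split_ifs <;> simp [this]
    have hfalse : 0 ≤ ∑ y, W (c (ι x)) x y * (if ∃ l, l ≠ r (ι x) x ∧
        b (ι x) l = b (ι x) (r (ι x) x) ∧ S (c (ι x)) (u (ι x) l) y then (1 : ℝ) else 0) :=
      Finset.sum_nonneg fun y _ => mul_nonneg (hW _ _ _) (ite_nonneg _)
    have hps := mul_nonneg (hp x) hs0.le
    have hle := mul_le_mul_of_nonneg_left (hle1 fun y =>
      η (dec (ι x, b (ι x) (r (ι x) x)) y) = c (ι x) ∧
        T x (dec (ι x, b (ι x) (r (ι x) x)) y) y) (hp x)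
    by_cases h1 : F₁ x (c (ι x))
    · have hwx : w (ι x) x = p x := by simp [hw, h1]
      rw [hwx]
      have h2 : ¬ ∀ i, ¬ F₁ x (c i) := fun h => h _ h1
      rw [if_neg h2, mul_zero, zero_add]
      by_cases h3 : G (ι x) x (u (ι x) (r (ι x) x))
      · rw [if_neg (not_not.mpr h3), zero_add, ← mul_add]
        rw [hG] at h3
        refine mul_le_mul_of_nonneg_left ?_ (hp x)
        have h4 : ∑ y, W (η (u (ι x) (r (ι x) x))) x y *
          (if ¬ T x (u (ι x) (r (ι x) x)) y then 1 else 0) ≤ s := (hF _ _).mp h3.2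
        rw [h3.1] at h4
        refine le_trans ?_ (add_le_add_left h4 _)
        rw [← Finset.sum_add_distrib]
        refine Finset.sum_le_sum fun y _ => ?_
        rw [← mul_add]
        refine mul_le_mul_of_nonneg_left ?_ (hW _ _ _)
        by_cases h5 : T x (u (ι x) (r (ι x) x)) y
        · by_cases h6 : ∃ l, l ≠ r (ι x) x ∧ b (ι x) l = b (ι x) (r (ι x) x) ∧
            S (c (ι x)) (u (ι x) l) y
          · rw [if_pos h6, if_neg (not_not.mpr h5)]
            split_ifs <;> norm_num
          · have h7 := hTS _ _ _ h5
            rw [h3.1] at h7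
            rw [hdec_eq _ _ _ h7 h6, if_pos ⟨h3.1, h5⟩]
            exact add_nonneg (ite_nonneg _) (ite_nonneg _)
        · rw [if_pos h5]
          have := ite_nonneg (∃ l, l ≠ r (ι x) x ∧ b (ι x) l = b (ι x) (r (ι x) x) ∧
            S (c (ι x)) (u (ι x) l) y)
          split_ifs at this ⊢ <;> linarith
      · rw [if_pos h3]
        have h4 := mul_nonneg (hp x) hfalse
        rw [mul_add]
        linarith
    · rw [if_pos (hιF x h1)]
      have h4 := mul_nonneg (hw0 (ι x) x) (add_nonneg (ite_nonneg
        (¬ G (ι x) x (u (ι x) (r (ι x) x)))) hfalse)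
      linarith
  refine (Finset.sum_le_sum fun x _ => hpt x).trans ?_
  rw [Finset.sum_add_distrib, Finset.sum_add_distrib, ← Finset.sum_mul, hp1]
  have hE : 0 ≤ s + Real.exp (-(L / K₂)) + L * κ / B := by positivity
  have hfin : ∀ G : Fin M → 𝒳 → ℝ, ∑ x, w (ι x) x * G (ι x) x = ∑ i, ∑ x, w i x * G i x := by
    intro G
    rw [Finset.sum_comm]
    refine Finset.sum_congr rfl fun x _ => ?_
    rw [Finset.sum_eq_single (ι x)]
    · intro i _ hi
      simp [hw, Ne.symm hi]
    · simp
  have h5 := hfin fun i x => (if ¬ G i x (u i (r i x)) then 1 else 0) +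
        ∑ y, W (c i) x y * (if ∃ l, l ≠ r i x ∧ b i l = b i (r i x) ∧
          S (c i) (u i l) y then 1 else 0)
  have h6 := hfin fun _ _ => s + Real.exp (-(L / K₂)) + L * κ / B
  have h7 : ∑ x, w (ι x) x * (s + Real.exp (-(L / K₂)) + L * κ / B) ≤
      ∑ x, p x * (s + Real.exp (-(L / K₂)) + L * κ / B) :=
    Finset.sum_le_sum fun x _ => mul_le_mul_of_nonneg_right (hwp x) hE
  rw [← Finset.sum_mul univ p, hp1] at h7
  rw [h5]
  have h8 := Finset.sum_le_sum fun i (_ : i ∈ univ) => hubr i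
  linarith

/-! ### The single-letter objective -/

section SingleLetter

variable {N : ℕ} {PX : X → ℝ} {PW : A → X → Y → ℝ} {PU : X → Fin N → ℝ} {η : Fin N → A}

lemma pUJoint_nonneg (hPX : ∀ x, 0 < PX x) (hPW : ∀ a x, IsPMF (PW a x))
    (hPU : IsCondPMF PU) (x : X) (y : Y) (u : Fin N) : 0 ≤ pUJoint PX PW PU η x y u :=
  mul_nonneg (mul_nonneg (hPX x).le ((hPU x).1 u)) ((hPW _ x).1 y)

lemma sum_pUJoint (hPW : ∀ a x, IsPMF (PW a x)) (x : X) (u : Fin N) :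
    ∑ y, pUJoint PX PW PU η x y u = PX x * PU x u := by
  simp_rw [pUJoint]
  rw [← Finset.mul_sum, (hPW _ x).2, mul_one]

lemma pXAu_nonneg (hPX : ∀ x, 0 < PX x) (hPU : IsCondPMF PU) (x : X) (a : A) :
    0 ≤ pXAu PX PU η x a :=
  Finset.sum_nonneg fun u _ => by
    split_ifs
    · exact mul_nonneg (hPX x).le ((hPU x).1 u)
    · exact le_rfl

lemma pAu_eq_sum (a : A) : pAu PX PU η a = ∑ x, pXAu PX PU η x a := rfl

lemma sum_pXAu (x : X) (hPU : IsCondPMF PU) : ∑ a, pXAu PX PU η x a = PX x := by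
  simp_rw [pXAu]
  rw [Finset.sum_comm]
  simp [← Finset.mul_sum, (hPU x).2]

lemma sum_pAu (hPX : IsPMF PX) (hPU : IsCondPMF PU) : ∑ a, pAu PX PU η a = 1 := by
  simp_rw [pAu_eq_sum]
  rw [Finset.sum_comm]
  simp_rw [sum_pXAu _ hPU]
  exact hPX.2

lemma pXYAu_eq (x : X) (y : Y) (a : A) :
    pXYAu PX PW PU η x y a = pXAu PX PU η x a * PW a x y := by
  rw [pXYAu, pXAu, Finset.sum_mul]
  refine Finset.sum_congr rfl fun u _ => ?_
  split_ifs with h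
  · rw [pUJoint, h]
  · simp

lemma pYAu_eq (y : Y) (a : A) :
    pYAu PX PW PU η y a = ∑ x, pXAu PX PU η x a * PW a x y :=
  Finset.sum_congr rfl fun x _ => pXYAu_eq x y a

lemma sum_pYAu (hPW : ∀ a x, IsPMF (PW a x)) (a : A) :
    ∑ y, pYAu PX PW PU η y a = pAu PX PU η a := by
  simp_rw [pYAu_eq]
  rw [Finset.sum_comm]
  refine Finset.sum_congr rfl fun x _ => ?_
  rw [← Finset.mul_sum, (hPW a x).2, mul_one]
  rfl

lemma pYAu_eq_sum_pYUu (y : Y) (a : A) :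
    pYAu PX PW PU η y a = ∑ u, if η u = a then pYUu PX PW PU η y u else 0 := by
  rw [pYAu, Finset.sum_comm]
  refine Finset.sum_congr rfl fun u _ => ?_
  split_ifs <;> simp [pYUu]

/-- Grouping a sum over the auxiliary letters by the value of the action. -/
lemma sum_fiberwise_action {ι : Type*} [Fintype ι] (η : ι → A) (g : A → ℝ) (w : ι → ℝ) :
    ∑ a, (∑ u, if η u = a then w u else 0) * g a = ∑ u, w u * g (η u) := by
  simp_rw [Finset.sum_mul]
  rw [Finset.sum_comm]
  simp [ite_mul]

lemma pos_of_pUJoint_pos (hPX : ∀ x, 0 < PX x) (hPW : ∀ a x, IsPMF (PW a x))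
    (hPU : IsCondPMF PU) {x : X} {y : Y} {u : Fin N} (h : 0 < pUJoint PX PW PU η x y u) :
    0 < PU x u ∧ 0 < PW (η u) x y ∧ 0 < pXAu PX PU η x (η u) ∧ 0 < pAu PX PU η (η u) ∧
      0 < pYAu PX PW PU η y (η u) ∧ 0 < pYUu PX PW PU η y u := by
  have h1 : 0 < PU x u := lt_of_le_of_ne ((hPU x).1 u) fun h0 => by
    simp [pUJoint, ← h0] at h
  have h2 : 0 < PW (η u) x y := lt_of_le_of_ne ((hPW _ x).1 y) fun h0 => by
    simp [pUJoint, ← h0] at h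
  have h3 : 0 < pXAu PX PU η x (η u) := by
    refine lt_of_lt_of_le (mul_pos (hPX x) h1) ?_
    refine le_trans ?_ (Finset.single_le_sum (f := fun u' => if η u' = η u then
      PX x * PU x u' else 0) (fun u' _ => ?_) (Finset.mem_univ u))
    · simp
    · split_ifs
      · exact mul_nonneg (hPX x).le ((hPU x).1 u')
      · exact le_rfl
  refine ⟨h1, h2, h3, ?_, ?_, ?_⟩
  · exact lt_of_lt_of_le h3 (Finset.single_le_sum (f := fun x => pXAu PX PU η x (η u))
      (fun x' _ => pXAu_nonneg hPX hPU x' _) (Finset.mem_univ x))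
  · rw [pYAu_eq]
    exact lt_of_lt_of_le (mul_pos h3 h2) (Finset.single_le_sum
      (f := fun x => pXAu PX PU η x (η u) * PW (η u) x y)
      (fun x' _ => mul_nonneg (pXAu_nonneg hPX hPU x' _) ((hPW _ _).1 y)) (Finset.mem_univ x))
  · exact lt_of_lt_of_le h (Finset.single_le_sum (f := fun x => pUJoint PX PW PU η x y u)
      (fun x' _ => pUJoint_nonneg hPX hPW hPU x' y u) (Finset.mem_univ x))

lemma IXAu_eq_sum_pUJoint (hPW : ∀ a x, IsPMF (PW a x)) :
    IXAu PX PU η = ∑ x, ∑ y, ∑ u, pUJoint PX PW PU η x y u *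
      Real.logb 2 (pXAu PX PU η x (η u) / (PX x * pAu PX PU η (η u))) := by
  refine Finset.sum_congr rfl fun x _ => ?_
  rw [Finset.sum_comm]
  simp_rw [← Finset.sum_mul]
  simp_rw [sum_pUJoint hPW]
  exact sum_fiberwise_action η (fun a => Real.logb 2 (pXAu PX PU η x a / (PX x * pAu PX PU η a)))
    fun u => PX x * PU x u

/-- The objective as one expected log-likelihood ratio. -/
lemma objective_eq_sum_logb (hPX : ∀ x, 0 < PX x) (hPW : ∀ a x, IsPMF (PW a x))
    (hPU : IsCondPMF PU) :
    IXAu PX PU η + IXUcondYAu PX PW PU η = ∑ x, ∑ y, ∑ u, pUJoint PX PW PU η x y u *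
      Real.logb 2 (pUJoint PX PW PU η x y u / pYUu PX PW PU η y u *
        (pYAu PX PW PU η y (η u) / pAu PX PU η (η u)) / (PX x * PW (η u) x y)) := by
  rw [IXAu_eq_sum_pUJoint hPW, IXUcondYAu]
  simp_rw [← Finset.sum_add_distrib]
  refine Finset.sum_congr rfl fun x _ => Finset.sum_congr rfl fun y _ =>
    Finset.sum_congr rfl fun u _ => ?_
  rcases (pUJoint_nonneg hPX hPW hPU x y u (η := η)).eq_or_lt with h | h
  · simp [← h]
  obtain ⟨h1, h2, h3, h4, h5, h6⟩ := pos_of_pUJoint_pos hPX hPW hPU h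
  have h7 := hPX x
  rw [← mul_add, pXYAu_eq, ← Real.logb_mul (by positivity) (by positivity)]
  congr 2
  field_simp

/-- Contribution of one auxiliary letter with action `a` and weights `v` to the objective. -/
def letterTerm (PX : X → ℝ) (PW : A → X → Y → ℝ) (a : A) (v : X → ℝ) : ℝ :=
  ∑ x, ∑ y, v x * PW a x y * Real.logb 2 (v x * PW a x y)
    - ∑ y, (∑ x, v x * PW a x y) * Real.logb 2 (∑ x, v x * PW a x y)
    - ∑ x, ∑ y, v x * PW a x y * Real.logb 2 (PX x * PW a x y)

/-- Contribution of the joint law `q` of source and action to the objective. -/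
def actionTerm (PW : A → X → Y → ℝ) (q : X → A → ℝ) : ℝ :=
  ∑ y, ∑ a, (∑ x, q x a * PW a x y) * Real.logb 2 (∑ x, q x a * PW a x y)
    - ∑ a, (∑ x, q x a) * Real.logb 2 (∑ x, q x a)

/-- Contribution of one auxiliary letter to the distortion. -/
def letterDist [Nonempty Xh] (PW : A → X → Y → ℝ) (dist : X → Xh → ℝ) (a : A)
    (v : X → ℝ) : ℝ :=
  ∑ y, Finset.univ.inf' Finset.univ_nonempty
    (fun xh : Xh => ∑ x, v x * PW a x y * dist x xh)

lemma objective_eq_terms (hPX : ∀ x, 0 < PX x) (hPW : ∀ a x, IsPMF (PW a x))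
    (hPU : IsCondPMF PU) :
    IXAu PX PU η + IXUcondYAu PX PW PU η =
      ∑ u, letterTerm PX PW (η u) (fun x => PX x * PU x u) +
        actionTerm PW (pXAu PX PU η) := by
  have h1 : ∀ x y u, pUJoint PX PW PU η x y u *
      Real.logb 2 (pUJoint PX PW PU η x y u / pYUu PX PW PU η y u *
        (pYAu PX PW PU η y (η u) / pAu PX PU η (η u)) / (PX x * PW (η u) x y)) =
      pUJoint PX PW PU η x y u * Real.logb 2 (pUJoint PX PW PU η x y u) -
      pUJoint PX PW PU η x y u * Real.logb 2 (pYUu PX PW PU η y u) -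
      pUJoint PX PW PU η x y u * Real.logb 2 (PX x * PW (η u) x y) +
      (pUJoint PX PW PU η x y u * Real.logb 2 (pYAu PX PW PU η y (η u)) -
      pUJoint PX PW PU η x y u * Real.logb 2 (pAu PX PU η (η u))) := by
    intro x y u
    rcases (pUJoint_nonneg hPX hPW hPU x y u (η := η)).eq_or_lt with h | h
    · simp [← h]
    obtain ⟨h1, h2, h3, h4, h5, h6⟩ := pos_of_pUJoint_pos hPX hPW hPU h
    have h7 := hPX x
    rw [Real.logb_div (by positivity) (by positivity), Real.logb_mul (by positivity)
      (by positivity), Real.logb_div (by positivity) (by positivity),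
      Real.logb_div (by positivity) (by positivity)]
    ring
  have h2 : ∑ x, ∑ y, ∑ u, pUJoint PX PW PU η x y u * Real.logb 2 (pYUu PX PW PU η y u) =
      ∑ u, ∑ y, pYUu PX PW PU η y u * Real.logb 2 (pYUu PX PW PU η y u) := by
    rw [Finset.sum_comm, Finset.sum_comm (s := univ (α := Fin N))]
    refine Finset.sum_congr rfl fun y _ => ?_
    rw [Finset.sum_comm]
    refine Finset.sum_congr rfl fun u _ => ?_
    rw [← Finset.sum_mul]
    rfl
  have h3 : ∑ x, ∑ y, ∑ u, pUJoint PX PW PU η x y u *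
      Real.logb 2 (pYAu PX PW PU η y (η u)) =
      ∑ y, ∑ a, pYAu PX PW PU η y a * Real.logb 2 (pYAu PX PW PU η y a) := by
    rw [Finset.sum_comm]
    refine Finset.sum_congr rfl fun y _ => ?_
    rw [Finset.sum_comm]
    have h := sum_fiberwise_action η (fun a => Real.logb 2 (pYAu PX PW PU η y a))
      (fun u => pYUu PX PW PU η y u)
    refine Eq.trans ?_ (h.symm.trans (Finset.sum_congr rfl fun a _ => ?_))
    swap
    · rw [← pYAu_eq_sum_pYUu]
    refine Finset.sum_congr rfl fun u _ => ?_
    rw [← Finset.sum_mul]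
    rfl
  have h4 : ∑ x, ∑ y, ∑ u, pUJoint PX PW PU η x y u *
      Real.logb 2 (pAu PX PU η (η u)) =
      ∑ a, pAu PX PU η a * Real.logb 2 (pAu PX PU η a) := by
    have h5 : ∀ x, ∑ y, ∑ u, pUJoint PX PW PU η x y u *
      Real.logb 2 (pAu PX PU η (η u)) =
        ∑ a, pXAu PX PU η x a * Real.logb 2 (pAu PX PU η a) := by
      intro x
      rw [Finset.sum_comm]
      simp_rw [← Finset.sum_mul, sum_pUJoint hPW]
      exact (sum_fiberwise_action η (fun a => Real.logb 2 (pAu PX PU η a))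
        fun u => PX x * PU x u).symm
    simp_rw [h5]
    rw [Finset.sum_comm]
    simp_rw [← Finset.sum_mul]
    rfl
  have hcomm : ∀ g : X → Y → Fin N → ℝ, ∑ x, ∑ y, ∑ u, g x y u = ∑ u, ∑ x, ∑ y, g x y u := by
    intro g
    rw [Finset.sum_comm (s := univ (α := Fin N))]
    refine Finset.sum_congr rfl fun x _ => ?_
    rw [Finset.sum_comm]
  rw [objective_eq_sum_logb hPX hPW hPU]
  simp_rw [h1, Finset.sum_add_distrib, Finset.sum_sub_distrib]
  rw [h2, h3, h4, hcomm fun x y u => pUJoint PX PW PU η x y u *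
    Real.logb 2 (pUJoint PX PW PU η x y u), hcomm fun x y u => pUJoint PX PW PU η x y u *
    Real.logb 2 (PX x * PW (η u) x y), ← Finset.sum_sub_distrib, ← Finset.sum_sub_distrib]
  simp_rw [pYAu_eq]
  rfl

lemma expDistU_eq_sum_letterDist [Nonempty Xh] (dist : X → Xh → ℝ) :
    expDistU PX PW dist PU η =
      ∑ u, letterDist PW dist (η u) (fun x => PX x * PU x u) := by
  rw [expDistU, Finset.sum_comm]
  rfl

lemma expCostU_eq_sum_pXAu (cost : A → ℝ) :
    expCostU PX cost PU η = ∑ x, ∑ a, pXAu PX PU η x a * cost a :=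
  Finset.sum_congr rfl fun x _ => (sum_fiberwise_action η cost fun u => PX x * PU x u).symm

/-- Gibbs' inequality for unnormalized weights. -/
lemma sum_mul_logb_div_nonneg {ι : Type*} [Fintype ι] (p q : ι → ℝ) (hp : ∀ i, 0 ≤ p i)
    (hq : ∀ i, 0 ≤ q i) (hpq : ∀ i, 0 < p i → 0 < q i) (h : ∑ i, q i ≤ ∑ i, p i) :
    0 ≤ ∑ i, p i * Real.logb 2 (p i / q i) := by
  have h1 : ∀ i, (p i - q i) / Real.log 2 ≤ p i * Real.logb 2 (p i / q i) := by
    intro i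
    have hl : 0 < Real.log 2 := Real.log_pos one_lt_two
    rw [Real.logb, ← mul_div_assoc]
    refine div_le_div_of_nonneg_right ?_ hl.le
    rcases (hp i).eq_or_lt with h0 | h0
    · simp [← h0, hq i]
    · have h2 := hpq i h0
      have h3 := Real.log_le_sub_one_of_pos (div_pos h2 h0)
      rw [Real.log_div h2.ne' h0.ne'] at h3
      rw [Real.log_div h0.ne' h2.ne']
      have h4 := mul_le_mul_of_nonneg_left h3 h0.le
      have h5 : p i * (q i / p i - 1) = q i - p i := by field_simp
      linarith
  refine le_trans ?_ (Finset.sum_le_sum fun i _ => h1 i)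
  rw [← Finset.sum_div, Finset.sum_sub_distrib]
  exact div_nonneg (by linarith) (Real.log_pos one_lt_two).le

lemma IXAu_nonneg (hPX : IsPMF PX) (hPXpos : ∀ x, 0 < PX x) (hPU : IsCondPMF PU) :
    0 ≤ IXAu PX PU η := by
  have hA : ∀ a, 0 ≤ pAu PX PU η a := fun a =>
    Finset.sum_nonneg fun x _ => pXAu_nonneg hPXpos hPU x a
  have h := sum_mul_logb_div_nonneg (fun z : X × A => pXAu PX PU η z.1 z.2)
    (fun z => PX z.1 * pAu PX PU η z.2) (fun z => pXAu_nonneg hPXpos hPU _ _)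
    (fun z => mul_nonneg (hPXpos _).le (hA _)) ?_ ?_
  · rw [Fintype.sum_prod_type] at h
    exact h
  · intro z hz
    exact mul_pos (hPXpos _) (lt_of_lt_of_le hz (Finset.single_le_sum
      (f := fun x => pXAu PX PU η x z.2)
      (fun x' _ => pXAu_nonneg hPXpos hPU x' _) (Finset.mem_univ z.1)))
  · rw [Fintype.sum_prod_type, Fintype.sum_prod_type]
    simp_rw [← Finset.mul_sum, sum_pAu hPX hPU, sum_pXAu _ hPU, mul_one]
    exact le_rfl

lemma IXUcondYAu_nonneg (hPXpos : ∀ x, 0 < PX x) (hPW : ∀ a x, IsPMF (PW a x))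
    (hPU : IsCondPMF PU) : 0 ≤ IXUcondYAu PX PW PU η := by
  have hP := pUJoint_nonneg hPXpos hPW hPU (η := η)
  have hYU : ∀ y u, 0 ≤ pYUu PX PW PU η y u := fun y u => Finset.sum_nonneg fun x _ => hP x y u
  have hXYA : ∀ x y a, 0 ≤ pXYAu PX PW PU η x y a := fun x y a => by
    rw [pXYAu_eq]
    exact mul_nonneg (pXAu_nonneg hPXpos hPU x a) ((hPW a x).1 y)
  have hYA : ∀ y a, 0 ≤ pYAu PX PW PU η y a := fun y a => Finset.sum_nonneg fun x _ => hXYA x y a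
  have h := sum_mul_logb_div_nonneg (fun z : X × Y × Fin N => pUJoint PX PW PU η z.1 z.2.1 z.2.2)
    (fun z => pXYAu PX PW PU η z.1 z.2.1 (η z.2.2) * pYUu PX PW PU η z.2.1 z.2.2 /
      pYAu PX PW PU η z.2.1 (η z.2.2)) (fun z => hP _ _ _)
    (fun z => div_nonneg (mul_nonneg (hXYA _ _ _) (hYU _ _)) (hYA _ _)) ?_ ?_
  · simp_rw [Fintype.sum_prod_type] at h
    refine h.trans (le_of_eq ?_)
    refine Finset.sum_congr rfl fun x _ => Finset.sum_congr rfl fun y _ =>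
      Finset.sum_congr rfl fun u _ => ?_
    rw [div_div_eq_mul_div]
  · intro z hz
    obtain ⟨-, h2, h3, -, h5, h6⟩ := pos_of_pUJoint_pos hPXpos hPW hPU hz
    rw [pXYAu_eq]
    positivity
  · simp_rw [Fintype.sum_prod_type]
    rw [Finset.sum_comm, Finset.sum_comm (s := univ (α := X))]
    refine Finset.sum_le_sum fun y _ => ?_
    rw [Finset.sum_comm, Finset.sum_comm (s := univ (α := X))]
    refine Finset.sum_le_sum fun u _ => ?_
    rw [← Finset.sum_div, ← Finset.sum_mul]
    refine div_le_of_le_mul₀ (hYA _ _) (hYU y u) (le_of_eq ?_)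
    rw [mul_comm]
    rfl

end SingleLetter

/-! ### Achievability -/

section Achievability

variable {PX : X → ℝ} {PW : A → X → Y → ℝ}

lemma sum_iidProb (hPX : IsPMF PX) (n : ℕ) : ∑ xs : Fin n → X, iidProb PX xs = 1 := by

  simp_rw [iidProb]
  rw [sum_prod_word fun _ => PX]
  simp [hPX.2]

lemma sum_sideProb (hPW : ∀ a x, IsPMF (PW a x)) {n : ℕ} (as : Fin n → A) (xs : Fin n → X) :
    ∑ ys, sideProb PW as xs ys = 1 := by
  simp_rw [sideProb]
  rw [sum_prod_word fun i => PW (as i) (xs i)]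
  simp [(hPW _ _).2]

lemma iidProb_nonneg (hPX : IsPMF PX) {n : ℕ} (xs : Fin n → X) : 0 ≤ iidProb PX xs :=
  Finset.prod_nonneg fun _ _ => hPX.1 _

lemma sideProb_nonneg (hPW : ∀ a x, IsPMF (PW a x)) {n : ℕ} (as : Fin n → A)
    (xs : Fin n → X) (ys : Fin n → Y) : 0 ≤ sideProb PW as xs ys :=
  Finset.prod_nonneg fun _ _ => (hPW _ _).1 _

/-- Affine bounds on a per-block quantity pass to its expectation. -/
lemma expectation_le_of_pointwise (hPX : IsPMF PX) (hPW : ∀ a x, IsPMF (PW a x)) {n : ℕ}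
    (as : (Fin n → X) → Fin n → A) (G b : (Fin n → X) → (Fin n → Y) → ℝ) {τ k e : ℝ}
    (hk : 0 ≤ k) (h : ∀ xs ys, G xs ys ≤ τ + k * b xs ys)
    (he : ∑ xs, iidProb PX xs * ∑ ys, sideProb PW (as xs) xs ys * b xs ys ≤ e) :
    ∑ xs, ∑ ys, iidProb PX xs * sideProb PW (as xs) xs ys * G xs ys ≤ τ + k * e := by
  calc ∑ xs, ∑ ys, iidProb PX xs * sideProb PW (as xs) xs ys * G xs ys
      ≤ ∑ xs, ∑ ys, iidProb PX xs * sideProb PW (as xs) xs ys * (τ + k * b xs ys) :=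
        Finset.sum_le_sum fun xs _ => Finset.sum_le_sum fun ys _ =>
          mul_le_mul_of_nonneg_left (h xs ys)
            (mul_nonneg (iidProb_nonneg hPX xs) (sideProb_nonneg hPW _ _ _))
    _ = ∑ xs, iidProb PX xs * (τ * ∑ ys, sideProb PW (as xs) xs ys) +
        k * ∑ xs, iidProb PX xs * ∑ ys, sideProb PW (as xs) xs ys * b xs ys := by
        rw [Finset.mul_sum, ← Finset.sum_add_distrib]
        refine Finset.sum_congr rfl fun xs _ => ?_
        simp_rw [Finset.mul_sum]
        rw [← Finset.sum_add_distrib]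
        refine Finset.sum_congr rfl fun ys _ => ?_
        ring
    _ = τ + k * ∑ xs, iidProb PX xs * ∑ ys, sideProb PW (as xs) xs ys * b xs ys := by
        simp_rw [sum_sideProb hPW, mul_one]
        rw [← Finset.sum_mul, sum_iidProb hPX, one_mul]
    _ ≤ τ + k * e := by gcongr

open Classical in
lemma exists_code_of_good_event (hPX : IsPMF PX) (hPW : ∀ a x, IsPMF (PW a x))
    {dist : X → Xh → ℝ} {cost : A → ℝ} {U : Type*} {η : U → A} (φ : U → Y → Xh)
    {n m M B : ℕ} (hM : 0 < M) (hB : 0 < B) (hMB : M * B ≤ m)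
    (c : Fin M → Fin n → A) (enc : (Fin n → X) → Fin M × Fin B)
    (dec : Fin M × Fin B → (Fin n → Y) → Fin n → U)
    (T : (Fin n → X) → (Fin n → U) → (Fin n → Y) → Prop) {τD τC k e : ℝ}
    (hτD : 0 ≤ τD) (hτC : 0 ≤ τC) (hk : 0 ≤ k) (hkD : ∀ x xh, dist x xh ≤ k)
    (hkC : ∀ a, cost a ≤ k)
    (hTD : ∀ xs us ys, T xs us ys → ∑ i, dist (xs i) (φ (us i) (ys i)) ≤ τD)
    (hTC : ∀ xs us ys, T xs us ys → ∑ i, cost (η (us i)) ≤ τC)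
    (he : ∑ xs, iidProb PX xs * ∑ ys, sideProb PW (c (enc xs).1) xs ys *
      (if (fun i => η (dec (enc xs) ys i)) = c (enc xs).1 ∧ T xs (dec (enc xs) ys) ys
        then 0 else 1) ≤ e) :
    ∃ (f : (Fin n → X) → Fin m) (g : Fin m → Fin n → A)
      (h : Fin m → (Fin n → Y) → Fin n → Xh),
      blockDist PX PW dist f g h ≤ τD + n * k * e ∧ blockCost PX cost f g ≤ τC + n * k * e := by
  obtain ⟨ι⟩ : Nonempty (Fin M × Fin B ↪ Fin m) :=
    Function.Embedding.nonempty_of_card_le (by simpa using hMB)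
  have : Nonempty (Fin M × Fin B) := ⟨(⟨0, hM⟩, ⟨0, hB⟩)⟩
  obtain ⟨κ, hκ⟩ : ∃ κ : Fin m → Fin M × Fin B, ∀ z, κ (ι z) = z :=
    ⟨Function.invFun ι, Function.leftInverse_invFun ι.injective⟩
  refine ⟨fun xs => ι (enc xs), fun t => c (κ t).1,
    fun t ys i => φ (dec (κ t) ys i) (ys i), ?_, ?_⟩
  · simp_rw [blockDist, hκ]
    refine expectation_le_of_pointwise hPX hPW (fun xs => c (enc xs).1) _ _ (by positivity)
      (fun xs ys => ?_) he
    split_ifs with hT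
    · simpa using hTD _ _ _ hT.2
    · have : ∑ i, dist (xs i) (φ (dec (enc xs) ys i) (ys i)) ≤ ∑ _i : Fin n, k :=
        Finset.sum_le_sum fun i _ => hkD _ _
      simp only [Finset.sum_const, Finset.card_univ, Fintype.card_fin, nsmul_eq_mul] at this
      linarith
  · have h1 := expectation_le_of_pointwise hPX hPW (fun xs => c (enc xs).1)
      (fun xs ys => ∑ i, cost (c (enc xs).1 i)) _ (τ := τC) (k := n * k) (by positivity)
      (fun xs ys => ?_) he
    · refine le_trans (le_of_eq ?_) h1
      simp_rw [blockCost, hκ]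
      refine Finset.sum_congr rfl fun xs _ => ?_
      rw [← Finset.sum_mul, ← Finset.mul_sum, sum_sideProb hPW, mul_one]
    split_ifs with hT
    · have := hTC _ _ _ hT.2
      simp_rw [← hT.1]
      simpa using this
    · have : ∑ i, cost (c (enc xs).1 i) ≤ ∑ _i : Fin n, k :=
        Finset.sum_le_sum fun i _ => hkC _
      simp only [Finset.sum_const, Finset.card_univ, Fintype.card_fin, nsmul_eq_mul] at this
      linarith

end Achievability

section Asymptotics

open Classical in
lemma exists_decay_of_expectation_lt {X U Y ι : Type*} [Fintype X] [Fintype U] [Fintype Y]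
    [Fintype ι] (P : X → U → Y → ℝ) (hP : ∀ x u y, 0 ≤ P x u y)
    (hP1 : ∑ x, ∑ u, ∑ y, P x u y = 1) (f : ι → X → U → Y → ℝ) (μ : ι → ℝ)
    (hμ : ∀ j, ∑ x, ∑ u, ∑ y, P x u y * f j x u y < μ j) :
    ∃ r : ℕ → ℝ, Filter.Tendsto r Filter.atTop (nhds 0) ∧ ∀ n : ℕ,
      ∑ xs : Fin n → X, ∑ us : Fin n → U, ∑ ys : Fin n → Y,
        (∏ i, P (xs i) (us i) (ys i)) *
        (if ∃ j, n * μ j < ∑ i, f j (xs i) (us i) (ys i) then 1 else 0) ≤ r n := by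
  have h : ∀ j, ∃ ρ : ℝ, 0 ≤ ρ ∧ ρ < 1 ∧ ∀ n : ℕ, ∑ z : Fin n → X × U × Y,
      (∏ i, P (z i).1 (z i).2.1 (z i).2.2) *
      (if n * μ j < ∑ i, f j (z i).1 (z i).2.1 (z i).2.2 then 1 else 0) ≤ ρ ^ n := fun j =>
    exists_chernoff (fun z : X × U × Y => P z.1 z.2.1 z.2.2)
      (fun z => f j z.1 z.2.1 z.2.2) (fun z => hP _ _ _)
      (by simpa [Fintype.sum_prod_type] using hP1) (μ j)
      (by simpa [Fintype.sum_prod_type] using hμ j)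
  choose ρ hρ0 hρ1 hρ using h
  refine ⟨fun n => ∑ j, ρ j ^ n, ?_, fun n => ?_⟩
  · rw [← Finset.sum_const_zero (s := (univ : Finset ι))]
    exact tendsto_finsetSum _ fun j _ => tendsto_pow_atTop_nhds_zero_of_lt_one (hρ0 j) (hρ1 j)
  have he : ∀ g : (Fin n → X) → (Fin n → U) → (Fin n → Y) → ℝ,
      ∑ xs, ∑ us, ∑ ys, g xs us ys = ∑ z : Fin n → X × U × Y,
        g (fun i => (z i).1) (fun i => (z i).2.1) (fun i => (z i).2.2) := by
    intro g
    let e : (Fin n → X × U × Y) ≃ (Fin n → X) × (Fin n → U) × (Fin n → Y) :=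
      (Equiv.arrowProdEquivProdArrow (Fin n) _ _).trans
        (Equiv.prodCongr (Equiv.refl _) (Equiv.arrowProdEquivProdArrow (Fin n) _ _))
    rw [← Fintype.sum_equiv e.symm (fun w => g w.1 w.2.1 w.2.2) _ (fun w => rfl)]
    simp_rw [Fintype.sum_prod_type]
  rw [he]
  refine le_trans ?_ (Finset.sum_le_sum fun j _ => hρ j n)
  rw [Finset.sum_comm]
  refine Finset.sum_le_sum fun z _ => ?_
  rw [← Finset.mul_sum]
  refine mul_le_mul_of_nonneg_left ?_ (Finset.prod_nonneg fun i _ => hP _ _ _)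
  have h0 : ∀ j, (0 : ℝ) ≤
      if n * μ j < ∑ i, f j (z i).1 (z i).2.1 (z i).2.2 then 1 else 0 := fun j => by
    split_ifs <;> norm_num
  split_ifs with hj
  · obtain ⟨j, hj⟩ := hj
    refine le_trans ?_ (Finset.single_le_sum (fun j _ => h0 j) (Finset.mem_univ j))
    rw [if_pos hj]
  · exact Finset.sum_nonneg fun j _ => h0 j

lemma prod_le_of_sum_logb_le {n : ℕ} (a b : Fin n → ℝ) (ha : ∀ i, 0 < a i)
    (hb : ∀ i, 0 < b i) {μ : ℝ} (h : ∑ i, Real.logb 2 (a i / b i) ≤ n * μ) :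
    ∏ i, a i ≤ (2 : ℝ) ^ (n * μ) * ∏ i, b i := by
  have h1 : ∑ i, Real.logb 2 (a i / b i) = Real.logb 2 (∏ i, a i / b i) := by
    rw [Real.logb_prod]
    exact fun i _ => (div_pos (ha i) (hb i)).ne'
  have h2 : 0 < ∏ i, a i / b i := Finset.prod_pos fun i _ => div_pos (ha i) (hb i)
  rw [h1, Real.logb_le_iff_le_rpow one_lt_two h2, Finset.prod_div_distrib,
    div_le_iff₀ (Finset.prod_pos fun i _ => hb i)] at h
  exact h

lemma exists_codebook_sizes {K₁ K₂ K₃ Q : ℝ} (hK₁ : 0 < K₁) (hK₂ : 0 < K₂) (hK₃ : 0 < K₃)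
    (hQ : 4 ≤ Q) (h₁ : 1 ≤ K₁ * Q) (h₂ : 1 ≤ K₂ * Q) (h₃ : 1 ≤ K₂ * Q * Q / K₃) :
    ∃ M L B : ℕ, 0 < M ∧ 0 < L ∧ 0 < B ∧
      Real.exp (-(M / K₁)) + Real.exp (-(L / K₂)) + L * (1 / K₃) / B ≤ 4 / Q ∧
      (M * B : ℕ) ≤ K₁ * K₂ * Q ^ 4 / K₃ := by
  have hQ0 : 0 < Q := by linarith
  have hceil : ∀ r : ℝ, 1 ≤ r → 0 < ⌈r⌉₊ ∧ r ≤ ⌈r⌉₊ ∧ (⌈r⌉₊ : ℝ) ≤ 2 * r := fun r hr =>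
    ⟨Nat.ceil_pos.mpr (by linarith), Nat.le_ceil r, by
      have := Nat.ceil_lt_add_one (show 0 ≤ r by linarith)
      linarith⟩
  obtain ⟨M0, M1, M2⟩ := hceil _ h₁
  obtain ⟨L0, L1, L2⟩ := hceil _ h₂
  obtain ⟨B0, B1, B2⟩ := hceil _ h₃
  have hexp : ∀ r, Q ≤ r → Real.exp (-r) ≤ 1 / Q := fun r hr => by
    rw [Real.exp_neg, ← one_div]
    refine one_div_le_one_div_of_le hQ0 ?_
    linarith [Real.add_one_le_exp r]
  refine ⟨_, _, _, M0, L0, B0, ?_, ?_⟩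
  · have e1 := hexp (⌈K₁ * Q⌉₊ / K₁) (by rw [le_div_iff₀ hK₁]; linarith)
    have e2 := hexp (⌈K₂ * Q⌉₊ / K₂) (by rw [le_div_iff₀ hK₂]; linarith)
    have e3 : (⌈K₂ * Q⌉₊ : ℝ) * (1 / K₃) / ⌈K₂ * Q * Q / K₃⌉₊ ≤ 2 / Q := by
      calc (⌈K₂ * Q⌉₊ : ℝ) * (1 / K₃) / ⌈K₂ * Q * Q / K₃⌉₊
          ≤ (2 * (K₂ * Q)) * (1 / K₃) / (K₂ * Q * Q / K₃) := by gcongr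
        _ = 2 / Q := by field_simp
    calc _ ≤ 1 / Q + 1 / Q + 2 / Q := add_le_add (add_le_add e1 e2) e3
      _ = 4 / Q := by ring
  · rw [Nat.cast_mul]
    calc (⌈K₁ * Q⌉₊ : ℝ) * ⌈K₂ * Q * Q / K₃⌉₊
        ≤ (2 * (K₁ * Q)) * (2 * (K₂ * Q * Q / K₃)) := by gcongr
      _ = 4 * (K₁ * K₂ * Q ^ 3 / K₃) := by ring
      _ ≤ Q * (K₁ * K₂ * Q ^ 3 / K₃) := by gcongr
      _ = K₁ * K₂ * Q ^ 4 / K₃ := by ring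

end Asymptotics

section LetterLaws

variable {PX : X → ℝ} {PW : A → X → Y → ℝ} {U : Type*} [Fintype U]
  {γ : X → U → ℝ} {η : U → A} {qA : A → ℝ} {qU : A → U → ℝ} {V : U → Y → ℝ}
  {α : X → A → ℝ} {v : A → Y → ℝ}

open Classical in
lemma sum_prod_le_of_likelihood_ratio (hqU : ∀ a u, 0 ≤ qU a u) (hV : ∀ u y, 0 ≤ V u y)
    (hv : ∀ a y, v a y = ∑ u, qU a u * V u y) {n : ℕ} {K : ℝ} (hK : 0 < K)
    (S : (Fin n → U) → Prop) (as : Fin n → A) (ys : Fin n → Y)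
    (hS : ∀ us, S us → K * ∏ i, v (as i) (ys i) ≤ ∏ i, V (us i) (ys i) ∧
      0 < ∏ i, v (as i) (ys i)) :
    ∑ us : Fin n → U, (∏ i, qU (as i) (us i)) * (if S us then 1 else 0) ≤ 1 / K := by
  by_cases hpos : 0 < ∏ i, v (as i) (ys i)
  · have h1 : ∀ us : Fin n → U, (∏ i, qU (as i) (us i)) * (if S us then 1 else 0) ≤
        (∏ i, qU (as i) (us i) * V (us i) (ys i)) / (K * ∏ i, v (as i) (ys i)) := by
      intro us
      rw [Finset.prod_mul_distrib, mul_div_assoc]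
      refine mul_le_mul_of_nonneg_left ?_ (Finset.prod_nonneg fun i _ => hqU _ _)
      split_ifs with h
      · rw [le_div_iff₀ (mul_pos hK hpos), one_mul]
        exact (hS us h).1
      · exact div_nonneg (Finset.prod_nonneg fun i _ => hV _ _) (mul_pos hK hpos).le
    refine (Finset.sum_le_sum fun us _ => h1 us).trans (le_of_eq ?_)
    rw [← Finset.sum_div, sum_prod_word fun i u => qU (as i) u * V u (ys i)]
    simp_rw [← hv]
    field_simp
  · have h1 : ∀ us, ¬ S us := fun us h => hpos (hS us h).2
    simp [h1, hK.le]

open Classical in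
lemma achievable_of_letter_laws (hPX : IsPMF PX) (hPW : ∀ a x, IsPMF (PW a x))
    {dist : X → Xh → ℝ} {cost : A → ℝ} (hdist : ∀ x xh, 0 ≤ dist x xh)
    (hcost : ∀ a, 0 ≤ cost a) (hγ : ∀ x u, 0 ≤ γ x u) (hγ1 : ∀ x, ∑ u, γ x u = 1)
    (hqA : ∀ a, 0 ≤ qA a) (hqA1 : ∑ a, qA a = 1) (hqU : ∀ a u, 0 ≤ qU a u)
    (hqU1 : ∀ a, ∑ u, qU a u = 1) (hα : ∀ x a, α x a = ∑ u, if η u = a then γ x u else 0)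
    (hV : ∀ u y, 0 ≤ V u y) (hv : ∀ a y, v a y = ∑ u, qU a u * V u y)
    (hpos : ∀ x u y, 0 < PX x * γ x u * PW (η u) x y → 0 < γ x u ∧ 0 < α x (η u) ∧
      0 < qA (η u) ∧ 0 < qU (η u) u ∧ 0 < V u y ∧ 0 < v (η u) y)
    {I₁ I₂ I₃ D C : ℝ} (hI₁ : 0 ≤ I₁) (hI₂ : 0 ≤ I₂) (hI₃ : I₃ ≤ I₂)
    (h₁ : ∑ x, ∑ u, ∑ y, PX x * γ x u * PW (η u) x y *
      Real.logb 2 (α x (η u) / qA (η u)) = I₁)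
    (h₂ : ∑ x, ∑ u, ∑ y, PX x * γ x u * PW (η u) x y *
      Real.logb 2 (γ x u / (α x (η u) * qU (η u) u)) = I₂)
    (h₃ : ∑ x, ∑ u, ∑ y, PX x * γ x u * PW (η u) x y *
      Real.logb 2 (V u y / v (η u) y) = I₃)
    (φ : U → Y → Xh) (hD0 : 0 ≤ D) (hC0 : 0 ≤ C)
    (hD : ∑ x, ∑ u, ∑ y, PX x * γ x u * PW (η u) x y * dist x (φ u y) ≤ D)
    (hC : ∑ x, ∑ u, ∑ y, PX x * γ x u * PW (η u) x y * cost (η u) ≤ C)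
    {δ : ℝ} (hδ : 0 < δ) : Achievable PX PW dist cost (I₁ + I₂ - I₃ + 7 * δ) D C := by
  intro ε hε
  obtain ⟨k, hk0, hkD, hkC⟩ : ∃ k : ℝ, 0 < k ∧ (∀ x xh, dist x xh ≤ k) ∧ ∀ a, cost a ≤ k := by
    refine ⟨1 + ∑ x, ∑ xh, dist x xh + ∑ a, cost a, ?_, fun x xh => ?_, fun a => ?_⟩
    · have := Finset.sum_nonneg fun x (_ : x ∈ univ) => Finset.sum_nonneg fun xh (_ : xh ∈ univ) =>
        hdist x xh
      have := Finset.sum_nonneg fun a (_ : a ∈ univ) => hcost a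
      linarith
    · have h1 := Finset.single_le_sum (fun xh _ => hdist x xh) (Finset.mem_univ xh)
      have h2 := Finset.single_le_sum (f := fun x => ∑ xh, dist x xh)
        (fun x _ => Finset.sum_nonneg fun xh _ => hdist x xh) (Finset.mem_univ x)
      have := Finset.sum_nonneg fun a (_ : a ∈ univ) => hcost a
      linarith
    · have h1 := Finset.single_le_sum (fun a _ => hcost a) (Finset.mem_univ a)
      have := Finset.sum_nonneg fun x (_ : x ∈ univ) => Finset.sum_nonneg fun xh (_ : xh ∈ univ) =>
        hdist x xh
      linarith
  have hP : ∀ x u y, 0 ≤ PX x * γ x u * PW (η u) x y := fun x u y =>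
    mul_nonneg (mul_nonneg (hPX.1 x) (hγ x u)) ((hPW _ _).1 y)
  have hP1 : ∑ x, ∑ u, ∑ y, PX x * γ x u * PW (η u) x y = 1 := by
    simp_rw [← Finset.mul_sum, (hPW _ _).2, mul_one, ← Finset.mul_sum, hγ1, mul_one]
    exact hPX.2
  obtain ⟨r, hr, hrle⟩ := exists_decay_of_expectation_lt
    (fun x u y => PX x * γ x u * PW (η u) x y) hP hP1
    (![fun x u _ => Real.logb 2 (α x (η u) / qA (η u)),
      fun x u _ => Real.logb 2 (γ x u / (α x (η u) * qU (η u) u)),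
      fun _ u y => Real.logb 2 (v (η u) y / V u y),
      fun x u y => dist x (φ u y), fun _ u _ => cost (η u)] : Fin 5 → X → U → Y → ℝ)
    ![I₁ + δ, I₂ + δ, -(I₃ - δ), D + ε / 2, C + ε / 2] (by
      have hinv : ∀ u y, Real.logb 2 (v (η u) y / V u y) = -Real.logb 2 (V u y / v (η u) y) :=
        fun u y => by rw [← Real.logb_inv, inv_div]
      simp only [Fin.forall_fin_succ, Matrix.cons_val_zero, Matrix.cons_val_succ, h₁, h₂, hinv,
        mul_neg, Finset.sum_neg_distrib, h₃]
      refine ⟨by linarith, by linarith, by linarith, by linarith, by linarith, fun i => i.elim0⟩)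
  obtain ⟨s, hs0, hs1, hsε⟩ : ∃ s : ℝ, 0 < s ∧ s < 1 ∧ k * (4 * s) ≤ ε / 2 := by
    refine ⟨min (1 / 2) (ε / (8 * k)), by positivity, ?_, ?_⟩
    · exact lt_of_le_of_lt (min_le_left _ _) (by norm_num)
    · calc k * (4 * min (1 / 2) (ε / (8 * k))) ≤ k * (4 * (ε / (8 * k))) := by
            gcongr
            exact min_le_right _ _
        _ = ε / 2 := by field_simp; ring
  have hQ : Filter.Tendsto (fun n : ℕ => (2 : ℝ) ^ ((n : ℝ) * δ)) Filter.atTop Filter.atTop := by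
    have h := tendsto_pow_atTop_atTop_of_one_lt
      (Real.one_lt_rpow (x := 2) one_lt_two hδ)
    refine h.congr fun n => ?_
    rw [← Real.rpow_natCast, ← Real.rpow_mul zero_le_two, mul_comm]
  obtain ⟨N, hN⟩ := Filter.eventually_atTop.mp
    (((hr.eventually (gt_mem_nhds (pow_pos hs0 3))).and
      (hQ.eventually_ge_atTop 4)).and (hQ.eventually_ge_atTop (4 / s)))
  refine ⟨N, fun n hn => ?_⟩
  obtain ⟨⟨hrn, hQ4⟩, hQs⟩ := hN n hn
  have hQ0 : (0 : ℝ) < 2 ^ ((n : ℝ) * δ) := by positivity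
  have hpow : ∀ a b : ℝ, (2 : ℝ) ^ a * 2 ^ b = 2 ^ (a + b) := fun a b =>
    (Real.rpow_add two_pos a b).symm
  have hdiv : ∀ a b : ℝ, (2 : ℝ) ^ a / 2 ^ b = 2 ^ (a - b) := fun a b =>
    (Real.rpow_sub two_pos a b).symm
  have hone : ∀ a : ℝ, 0 ≤ a → 1 ≤ (2 : ℝ) ^ ((n : ℝ) * a) := fun a ha =>
    Real.one_le_rpow one_le_two (by positivity)
  obtain ⟨M, L, B, hM, hL, hB, hexp, hMB⟩ := exists_codebook_sizes
    (K₁ := (2 : ℝ) ^ ((n : ℝ) * (I₁ + δ))) (K₂ := (2 : ℝ) ^ ((n : ℝ) * (I₂ + δ)))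
    (K₃ := (2 : ℝ) ^ ((n : ℝ) * (I₃ - δ))) (by positivity) (by positivity) (by positivity)
    hQ4 (by rw [hpow, ← mul_add]; exact hone _ (by linarith))
    (by rw [hpow, ← mul_add]; exact hone _ (by linarith))
    (by rw [hpow, hpow, hdiv, ← mul_add, ← mul_add, ← mul_sub]; exact hone _ (by linarith))
  have hMB' : M * B ≤ ⌊(2 : ℝ) ^ ((n : ℝ) * (I₁ + I₂ - I₃ + 7 * δ))⌋₊ := by
    refine Nat.le_floor (hMB.trans (le_of_eq ?_))
    rw [← Real.rpow_natCast, ← Real.rpow_mul zero_le_two, hpow, hpow, hdiv]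
    congr 1
    push_cast
    ring
  obtain ⟨T, hT⟩ : ∃ T : (Fin n → X) → (Fin n → U) → (Fin n → Y) → Prop, ∀ xs us ys,
      T xs us ys ↔
      ((∏ i, α (xs i) (η (us i)) ≤ (2 : ℝ) ^ ((n : ℝ) * (I₁ + δ)) * ∏ i, qA (η (us i))) ∧
      (∏ i, γ (xs i) (us i) ≤ (2 : ℝ) ^ ((n : ℝ) * (I₂ + δ)) *
        ((∏ i, α (xs i) (η (us i))) * ∏ i, qU (η (us i)) (us i))) ∧
      ((2 : ℝ) ^ ((n : ℝ) * (I₃ - δ)) * ∏ i, v (η (us i)) (ys i) ≤ ∏ i, V (us i) (ys i) ∧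
        0 < ∏ i, v (η (us i)) (ys i)) ∧
      (∑ i, dist (xs i) (φ (us i) (ys i)) ≤ n * (D + ε / 2)) ∧
      ∑ i, cost (η (us i)) ≤ n * (C + ε / 2)) := ⟨_, fun _ _ _ => Iff.rfl⟩
  obtain ⟨c, enc, dec, hcode⟩ := exists_block_code (𝒳 := Fin n → X) (𝒜 := Fin n → A)
    (𝒰 := Fin n → U) (𝒴 := Fin n → Y) (iidProb PX) (iidProb_nonneg hPX) (sum_iidProb hPX n)
    (fun xs us => ∏ i, γ (xs i) (us i)) (fun xs us => Finset.prod_nonneg fun i _ => hγ _ _)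
    (fun xs => by
      rw [sum_prod_word fun i => γ (xs i)]
      simp [hγ1])
    (fun us i => η (us i)) (sideProb PW) (sideProb_nonneg hPW) (sum_sideProb hPW)
    (fun as => ∏ i, qA (as i)) (fun as => Finset.prod_nonneg fun i _ => hqA _)
    (by
      rw [sum_prod_word fun _ => qA]
      simp [hqA1])
    (fun as us => ∏ i, qU (as i) (us i)) (fun as us => Finset.prod_nonneg fun i _ => hqU _ _)
    (fun as => by
      rw [sum_prod_word fun i => qU (as i)]
      simp [hqU1])
    (fun xs as => ∏ i, α (xs i) (as i))
    (fun xs as => by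
      simp_rw [hα]
      rw [← sum_prod_word fun i u => if η u = as i then γ (xs i) u else 0]
      refine Finset.sum_congr rfl fun us _ => ?_
      split_ifs with h
      · refine Finset.prod_congr rfl fun i _ => ?_
        rw [← h, if_pos rfl]
      · obtain ⟨i, hi⟩ := Function.ne_iff.mp h
        exact Finset.prod_eq_zero (Finset.mem_univ i) (if_neg hi))
    T (fun as us ys => (2 : ℝ) ^ ((n : ℝ) * (I₃ - δ)) * ∏ i, v (as i) (ys i) ≤
      ∏ i, V (us i) (ys i) ∧ 0 < ∏ i, v (as i) (ys i))
    (K₁ := (2 : ℝ) ^ ((n : ℝ) * (I₁ + δ))) (K₂ := (2 : ℝ) ^ ((n : ℝ) * (I₂ + δ)))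
    (κ := 1 / (2 : ℝ) ^ ((n : ℝ) * (I₃ - δ))) (by positivity) (by positivity) hs0 hs1
    (fun xs us ys h => ((hT _ _ _).mp h).1) (fun xs us ys h => ((hT _ _ _).mp h).2.1)
    (fun xs us ys h => ((hT _ _ _).mp h).2.2.1)
    (fun as ys => sum_prod_le_of_likelihood_ratio hqU hV hv (by positivity) _ as ys
      fun us h => h) (by positivity)
    (by
      refine le_trans ?_ ((hrle n).trans hrn.le)
      refine Finset.sum_le_sum fun xs _ => ?_
      rw [Finset.mul_sum]
      refine Finset.sum_le_sum fun us _ => ?_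
      rw [Finset.mul_sum, Finset.mul_sum]
      refine Finset.sum_le_sum fun ys _ => ?_
      rw [← mul_assoc, ← mul_assoc, iidProb, sideProb, ← Finset.prod_mul_distrib,
        ← Finset.prod_mul_distrib]
      rcases (Finset.prod_nonneg fun i (_ : i ∈ univ) =>
        hP (xs i) (us i) (ys i)).eq_or_lt with h0 | h0
      · rw [← h0, zero_mul, zero_mul]
      refine mul_le_mul_of_nonneg_left ?_ h0.le
      by_cases hall : ∃ j, (n : ℝ) * (![I₁ + δ, I₂ + δ, -(I₃ - δ), D + ε / 2, C + ε / 2] j) <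
        ∑ i, (![fun x u _ => Real.logb 2 (α x (η u) / qA (η u)),
          fun x u _ => Real.logb 2 (γ x u / (α x (η u) * qU (η u) u)),
          fun _ u y => Real.logb 2 (v (η u) y / V u y),
          fun x u y => dist x (φ u y), fun _ u _ => cost (η u)] : Fin 5 → X → U → Y → ℝ) j
          (xs i) (us i) (ys i)
      · rw [if_pos hall]
        split_ifs <;> norm_num
      rw [if_neg hall]
      push Not at hall
      have hp := fun i => hpos (xs i) (us i) (ys i) (lt_of_le_of_ne (hP _ _ _) fun h =>
        h0.ne' (Finset.prod_eq_zero (Finset.mem_univ i) h.symm))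
      rw [if_neg]
      push Not
      refine (hT _ _ _).mpr ⟨?_, ?_, ⟨?_, ?_⟩, hall 3, hall 4⟩
      · exact prod_le_of_sum_logb_le _ _ (fun i => (hp i).2.1) (fun i => (hp i).2.2.1) (hall 0)
      · rw [← Finset.prod_mul_distrib]
        exact prod_le_of_sum_logb_le _ _ (fun i => (hp i).1)
          (fun i => mul_pos (hp i).2.1 (hp i).2.2.2.1) (hall 1)
      · have h := prod_le_of_sum_logb_le _ _ (fun i => (hp i).2.2.2.2.2)
          (fun i => (hp i).2.2.2.2.1) (μ := -(I₃ - δ)) (hall 2)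
        rw [mul_comm]
        refine (mul_le_mul_of_nonneg_right h (by positivity)).trans (le_of_eq ?_)
        rw [mul_right_comm, hpow, ← mul_add, neg_add_cancel, mul_zero, Real.rpow_zero, one_mul]
      · exact Finset.prod_pos fun i _ => (hp i).2.2.2.2.2)
    hM hL hB
  obtain ⟨f, g, h, hfd, hfc⟩ := exists_code_of_good_event hPX hPW (dist := dist) (cost := cost)
    (η := η) φ hM hB hMB' c enc dec T
    (τD := n * (D + ε / 2)) (τC := n * (C + ε / 2)) (k := k) (e := 4 * s)
    (by positivity) (by positivity) hk0.le hkD hkC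
    (fun xs us ys h => ((hT _ _ _).mp h).2.2.2.1) (fun xs us ys h => ((hT _ _ _).mp h).2.2.2.2)
    (by
      have h4 : 4 / (2 : ℝ) ^ ((n : ℝ) * δ) ≤ s := by
        rw [div_le_iff₀ hQ0]
        rw [div_le_iff₀ hs0] at hQs
        linarith
      refine hcode.trans ?_
      linarith)
  have hlast : (n : ℝ) * k * (4 * s) ≤ n * (ε / 2) := by
    rw [mul_assoc]
    gcongr
  refine ⟨f, g, h, ?_, ?_⟩
  · linarith
  · linarith

end LetterLaws

section SingleLetterAchievability

variable {N : ℕ} {PX : X → ℝ} {PW : A → X → Y → ℝ} {PU : X → Fin N → ℝ} {η : Fin N → A}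

lemma achievable_of_isCondPMF [Nonempty X] [Nonempty Xh] {dist : X → Xh → ℝ} {cost : A → ℝ}
    (hPX : IsPMF PX) (hPXpos : ∀ x, 0 < PX x) (hPW : ∀ a x, IsPMF (PW a x))
    (hdist : ∀ x xh, 0 ≤ dist x xh) (hcost : ∀ a, 0 ≤ cost a) {D C : ℝ} (hD0 : 0 ≤ D)
    (hC0 : 0 ≤ C) (hPU : IsCondPMF PU) (hD : expDistU PX PW dist PU η ≤ D)
    (hC : expCostU PX cost PU η ≤ C) {δ : ℝ} (hδ : 0 < δ) :
    Achievable PX PW dist cost (IXAu PX PU η + IXUcondYAu PX PW PU η + δ) D C := by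
  obtain ⟨x₀⟩ := ‹Nonempty X›
  have hP := pUJoint_nonneg hPXpos hPW hPU (η := η)
  obtain ⟨p, hp⟩ : ∃ p : Fin N → ℝ, ∀ u, p u = ∑ x, PX x * PU x u := ⟨_, fun _ => rfl⟩
  have hp0 : ∀ u, 0 ≤ p u := fun u => by
    rw [hp]
    exact Finset.sum_nonneg fun x _ => mul_nonneg (hPX.1 x) ((hPU x).1 u)
  have hpA : ∀ a, pAu PX PU η a = ∑ u, if η u = a then p u else 0 := fun a => by
    rw [pAu, Finset.sum_comm]
    refine Finset.sum_congr rfl fun u _ => ?_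
    split_ifs <;> simp [hp]
  have hpA0 : ∀ a, 0 ≤ pAu PX PU η a := fun a =>
    Finset.sum_nonneg fun x _ => pXAu_nonneg hPXpos hPU x a
  have hpYU : ∀ y u, p u = 0 → pYUu PX PW PU η y u = 0 := fun y u h => by
    rw [hp, Finset.sum_eq_zero_iff_of_nonneg fun x _ => mul_nonneg (hPX.1 x) ((hPU x).1 u)] at h
    exact Finset.sum_eq_zero fun x hx => by rw [pUJoint, h x hx, zero_mul]
  have hpYU0 : ∀ y u, 0 ≤ pYUu PX PW PU η y u := fun y u => Finset.sum_nonneg fun x _ => hP x y u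
  obtain ⟨α, hα⟩ : ∃ α : X → A → ℝ, ∀ x a, α x a = ∑ u, if η u = a then PU x u else 0 :=
    ⟨_, fun _ _ => rfl⟩
  have hαX : ∀ x a, pXAu PX PU η x a = PX x * α x a := fun x a => by
    rw [hα, pXAu, Finset.mul_sum]
    refine Finset.sum_congr rfl fun u _ => ?_
    split_ifs <;> simp
  have hα0 : ∀ x a, 0 ≤ α x a := fun x a => by
    rw [hα]
    exact Finset.sum_nonneg fun u _ => by split_ifs <;> simp [(hPU x).1]
  have hα1 : ∀ x, ∑ a, α x a = 1 := fun x => by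
    simp_rw [hα]
    rw [Finset.sum_comm]
    simp [(hPU x).2]
  obtain ⟨qU, hqU⟩ : ∃ qU : A → Fin N → ℝ, ∀ a u, qU a u =
      if pAu PX PU η a = 0 then PU x₀ u else if η u = a then p u / pAu PX PU η a else 0 :=
    ⟨_, fun _ _ => rfl⟩
  have hqU0 : ∀ a u, 0 ≤ qU a u := fun a u => by
    rw [hqU]
    split_ifs
    · exact (hPU x₀).1 u
    · exact div_nonneg (hp0 u) (hpA0 a)
    · exact le_rfl
  have hqU1 : ∀ a, ∑ u, qU a u = 1 := fun a => by
    by_cases h : pAu PX PU η a = 0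
    · simp only [hqU, h, if_true]
      exact (hPU x₀).2
    · simp only [hqU, h, if_false]
      rw [← div_self h]
      nth_rewrite 2 [hpA]
      rw [Finset.sum_div]
      refine Finset.sum_congr rfl fun u _ => ?_
      split_ifs <;> simp
  obtain ⟨V, hV⟩ : ∃ V : Fin N → Y → ℝ, ∀ u y, V u y = pYUu PX PW PU η y u / p u :=
    ⟨_, fun _ _ => rfl⟩
  obtain ⟨v, hv⟩ : ∃ v : A → Y → ℝ, ∀ a y, v a y = ∑ u, qU a u * V u y :=
    ⟨_, fun _ _ => rfl⟩
  have hv' : ∀ a y, pAu PX PU η a ≠ 0 → v a y = pYAu PX PW PU η y a / pAu PX PU η a := by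
    intro a y h
    rw [hv, pYAu_eq_sum_pYUu, Finset.sum_div]
    refine Finset.sum_congr rfl fun u _ => ?_
    rw [hqU, hV, if_neg h]
    split_ifs
    · by_cases h0 : p u = 0
      · simp [h0, hpYU y u h0]
      · field_simp
    · simp
  have hpu : ∀ {x y u}, 0 < pUJoint PX PW PU η x y u → 0 < p u := fun {x y u} h =>
    lt_of_le_of_ne (hp0 u) fun h0 =>
      (pos_of_pUJoint_pos hPXpos hPW hPU h).2.2.2.2.2.ne' (hpYU y u h0.symm)
  have hqUpos : ∀ {x y u}, 0 < pUJoint PX PW PU η x y u →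
      qU (η u) u = p u / pAu PX PU η (η u) := fun {x y u} h => by
    obtain ⟨-, -, -, h4, -, -⟩ := pos_of_pUJoint_pos hPXpos hPW hPU h
    rw [hqU, if_neg h4.ne', if_pos rfl]
  have hsupp : ∀ x u y, 0 < PX x * PU x u * PW (η u) x y → 0 < PU x u ∧ 0 < α x (η u) ∧
      0 < pAu PX PU η (η u) ∧ 0 < qU (η u) u ∧ 0 < V u y ∧ 0 < v (η u) y := by
    intro x u y h
    have h' : 0 < pUJoint PX PW PU η x y u := h
    have hpu' := hpu h'
    obtain ⟨h1, h2, h3, h4, h5, h6⟩ := pos_of_pUJoint_pos hPXpos hPW hPU h'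
    refine ⟨h1, ?_, h4, ?_, ?_, ?_⟩
    · rw [hαX] at h3
      exact pos_of_mul_pos_right h3 (hPXpos x).le
    · rw [hqUpos h']
      positivity
    · rw [hV]
      positivity
    · rw [hv' _ _ h4.ne']
      positivity
  have hswap : ∀ G : X → Fin N → Y → ℝ, ∑ x, ∑ u, ∑ y, PX x * PU x u * PW (η u) x y * G x u y =
      ∑ x, ∑ y, ∑ u, pUJoint PX PW PU η x y u * G x u y := fun G =>
    Finset.sum_congr rfl fun x _ => Finset.sum_comm
  have hcollapse : ∀ G : X → Fin N → ℝ, ∑ x, ∑ u, ∑ y, PX x * PU x u * PW (η u) x y * G x u =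
      ∑ x, ∑ u, PX x * PU x u * G x u := fun G => by
    refine Finset.sum_congr rfl fun x _ => Finset.sum_congr rfl fun u _ => ?_
    rw [← Finset.sum_mul, ← Finset.mul_sum, (hPW _ x).2, mul_one]
  have hI₁ : ∑ x, ∑ u, ∑ y, PX x * PU x u * PW (η u) x y *
      Real.logb 2 (α x (η u) / pAu PX PU η (η u)) = IXAu PX PU η := by
    rw [hswap fun x u y => Real.logb 2 (α x (η u) / pAu PX PU η (η u)), IXAu_eq_sum_pUJoint hPW]
    simp_rw [hαX, mul_div_mul_left _ _ (hPXpos _).ne']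
  obtain ⟨I₂, hI₂⟩ : ∃ I, ∑ x, ∑ u, ∑ y, PX x * PU x u * PW (η u) x y *
      Real.logb 2 (PU x u / (α x (η u) * qU (η u) u)) = I := ⟨_, rfl⟩
  obtain ⟨I₃, hI₃⟩ : ∃ I, ∑ x, ∑ u, ∑ y, PX x * PU x u * PW (η u) x y *
      Real.logb 2 (V u y / v (η u) y) = I := ⟨_, rfl⟩
  have hI₂₃ : IXUcondYAu PX PW PU η = I₂ - I₃ := by
    rw [← hI₂, ← hI₃, hswap fun x u y => Real.logb 2 (PU x u / (α x (η u) * qU (η u) u)),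
      hswap fun x u y => Real.logb 2 (V u y / v (η u) y)]
    simp_rw [← Finset.sum_sub_distrib]
    refine Finset.sum_congr rfl fun x _ => Finset.sum_congr rfl fun y _ =>
      Finset.sum_congr rfl fun u _ => ?_
    rcases (hP x y u).eq_or_lt with h | h
    · simp [← h]
    have hpu' := hpu h
    obtain ⟨-, h2, h3, h4, h5, h6⟩ := pos_of_pUJoint_pos hPXpos hPW hPU h
    obtain ⟨k1, k2, k3, k4, k5, k6⟩ := hsupp x u y h
    rw [← mul_sub, ← Real.logb_div (by positivity) (by positivity), pXYAu_eq, hαX, hqUpos h, hV,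
      hv' _ _ h4.ne', pUJoint]
    have := hPXpos x
    congr 2
    field_simp
  have hI₂0 : 0 ≤ I₂ := by
    rw [← hI₂, hcollapse fun x u => Real.logb 2 (PU x u / (α x (η u) * qU (η u) u))]
    refine Finset.sum_nonneg fun x _ => ?_
    simp_rw [mul_assoc]
    rw [← Finset.mul_sum]
    refine mul_nonneg (hPX.1 x) (sum_mul_logb_div_nonneg _ _ (hPU x).1
      (fun u => mul_nonneg (hα0 _ _) (hqU0 _ _)) (fun u hu => ?_) ?_)
    · obtain ⟨y, -, hy⟩ : ∃ y ∈ (univ : Finset Y), 0 < PW (η u) x y := by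
        by_contra! h
        have := Finset.sum_nonpos h
        rw [(hPW (η u) x).2] at this
        linarith
      have h := hsupp x u y (mul_pos (mul_pos (hPXpos x) hu) hy)
      exact mul_pos h.2.1 h.2.2.2.1
    · rw [(hPU x).2]
      calc ∑ u, α x (η u) * qU (η u) u = ∑ u, qU (η u) u * α x (η u) := by
            simp_rw [mul_comm]
        _ = ∑ a, (∑ u, if η u = a then qU (η u) u else 0) * α x a :=
            (sum_fiberwise_action η (α x) fun u => qU (η u) u).symm
        _ ≤ ∑ a, 1 * α x a := by
            refine Finset.sum_le_sum fun a _ => mul_le_mul_of_nonneg_right ?_ (hα0 x a)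
            rw [← hqU1 a]
            refine Finset.sum_le_sum fun u _ => ?_
            split_ifs with h
            · rw [h]
            · exact hqU0 a u
        _ = 1 := by simp [hα1]
  have hφ : ∀ u y, ∃ xh : Xh, Finset.univ.inf' Finset.univ_nonempty
      (fun xh : Xh => ∑ x, pUJoint PX PW PU η x y u * dist x xh) =
        ∑ x, pUJoint PX PW PU η x y u * dist x xh := fun u y => by
    obtain ⟨xh, -, h⟩ := Finset.exists_mem_eq_inf' Finset.univ_nonempty
      (fun xh : Xh => ∑ x, pUJoint PX PW PU η x y u * dist x xh)
    exact ⟨xh, h⟩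
  choose φ hφ using hφ
  have h := achievable_of_letter_laws hPX hPW hdist hcost (fun x => (hPU x).1)
    (fun x => (hPU x).2) hpA0 (sum_pAu hPX hPU) hqU0 hqU1 hα
    (fun u y => by rw [hV]; exact div_nonneg (hpYU0 y u) (hp0 u)) hv hsupp
    (IXAu_nonneg hPX hPXpos hPU) hI₂0
    (by linarith [IXUcondYAu_nonneg hPXpos hPW hPU (η := η)]) hI₁ hI₂ hI₃ φ hD0 hC0
    (by
      refine le_trans (le_of_eq ?_) hD
      rw [hswap fun x u y => dist x (φ u y), expDistU]
      simp_rw [hφ]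
      rw [Finset.sum_comm]
      exact Finset.sum_congr rfl fun y _ => Finset.sum_comm)
    (by
      refine le_trans (le_of_eq ?_) hC
      exact hcollapse fun _ u => cost (η u)) (δ := δ / 7) (by positivity)
  rw [hI₂₃]
  convert h using 1
  ring

end SingleLetterAchievability

/-! ### Converse -/

section Converse

/-- Resampling one coordinate of a word of independent letters. -/
lemma sum_word_resample {Z : Type*} [Fintype Z] {n : ℕ} (w : Fin n → Z → ℝ) (i : Fin n)
    (hw : ∑ z, w i z = 1) (H : Z → (Fin n → Z) → ℝ)
    (hH : ∀ y ys z, H y (Function.update ys i z) = H y ys) :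
    ∑ ys, (∏ j, w j (ys j)) * ∑ y, w i y * H y ys = ∑ ys, (∏ j, w j (ys j)) * H (ys i) ys := by
  have hsplit : ∀ ys : Fin n → Z, ∏ j, w j (ys j) =
      w i (ys i) * ∏ j ∈ univ.erase i, w j (ys j) := fun ys =>
    (Finset.mul_prod_erase univ _ (Finset.mem_univ i)).symm
  have hupd : ∀ (ys : Fin n → Z) z, ∏ j ∈ univ.erase i, w j (Function.update ys i z j) =
      ∏ j ∈ univ.erase i, w j (ys j) := fun ys z =>
    Finset.prod_congr rfl fun j hj => by rw [Function.update_of_ne (Finset.ne_of_mem_erase hj)]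
  have hinv : Function.Involutive fun z : (Fin n → Z) × Z =>
      (Function.update z.1 i z.2, z.1 i) := fun z => by simp
  have h1 := Fintype.sum_equiv hinv.toPerm
    (fun z => (∏ j, w j (z.1 j)) * (w i z.2 * H z.2 z.1))
    (fun z => (∏ j, w j (z.1 j)) * (w i z.2 * H (z.1 i) z.1)) fun z => by
      simp only [Function.Involutive.coe_toPerm, Function.update_self, hH, hsplit, hupd]
      ring
  simp_rw [Fintype.sum_prod_type] at h1
  simp_rw [Finset.mul_sum]
  rw [h1]
  refine Finset.sum_congr rfl fun ys _ => ?_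
  rw [← Finset.mul_sum, ← Finset.sum_mul, hw, one_mul]

lemma exists_isCondPMF_of_code [Nonempty Y] [Nonempty Xh] {PX : X → ℝ} {PW : A → X → Y → ℝ}
    {dist : X → Xh → ℝ} {cost : A → ℝ} (hPX : IsPMF PX) (hPXpos : ∀ x, 0 < PX x)
    (hPW : ∀ a x, IsPMF (PW a x)) {n m : ℕ} (hn : 0 < n) (hm : 0 < m)
    (f : (Fin n → X) → Fin m) (g : Fin m → Fin n → A)
    (h : Fin m → (Fin n → Y) → Fin n → Xh) :
    ∃ (N : ℕ) (PU : X → Fin N → ℝ) (η : Fin N → A), IsCondPMF PU ∧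
      expDistU PX PW dist PU η ≤ blockDist PX PW dist f g h / n ∧
      expCostU PX cost PU η ≤ blockCost PX cost f g / n ∧
      IXAu PX PU η + IXUcondYAu PX PW PU η ≤ Real.logb 2 m / n := by
  obtain ⟨y₀⟩ := ‹Nonempty Y›
  have hn' : (0 : ℝ) < n := Nat.cast_pos.mpr hn
  have hm' : (0 : ℝ) < m := Nat.cast_pos.mpr hm
  let e := Fintype.equivFin (Fin n × Fin m × (Fin n → Y))
  obtain ⟨N, hN⟩ : ∃ N, N = Fintype.card (Fin n × Fin m × (Fin n → Y)) := ⟨_, rfl⟩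
  rw [← hN] at e
  obtain ⟨η, hη⟩ : ∃ η : Fin N → A, ∀ i t ys, η (e (i, t, ys)) = g t i :=
    ⟨fun u => g (e.symm u).2.1 (e.symm u).1, fun i t ys => by simp⟩
  obtain ⟨w, hw⟩ : ∃ w : (Fin n → X) → (Fin n → Y) → ℝ, ∀ xs ys,
      w xs ys = iidProb PX xs * sideProb PW (g (f xs)) xs ys := ⟨_, fun _ _ => rfl⟩
  have hw0 : ∀ xs ys, 0 ≤ w xs ys := fun xs ys => by
    rw [hw]
    exact mul_nonneg (iidProb_nonneg hPX _) (sideProb_nonneg hPW _ _ _)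
  have hw1 : ∀ xs, ∑ ys, w xs ys = iidProb PX xs := fun xs => by
    simp_rw [hw]
    rw [← Finset.mul_sum, sum_sideProb hPW, mul_one]
  obtain ⟨ν, hν⟩ : ∃ ν : Fin n → (Fin n → X) → (Fin n → Y) → Fin N, ∀ i xs ys,
      ν i xs ys = e (i, f xs, Function.update ys i y₀) := ⟨_, fun _ _ _ => rfl⟩
  obtain ⟨Q, hQ⟩ : ∃ Q : X → Fin N → ℝ, ∀ x u, Q x u =
      (∑ i, ∑ xs, ∑ ys, w xs ys * (if xs i = x ∧ ν i xs ys = u then 1 else 0)) / n :=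
    ⟨_, fun _ _ => rfl⟩
  have hQ0 : ∀ x u, 0 ≤ Q x u := fun x u => by
    rw [hQ]
    refine div_nonneg (Finset.sum_nonneg fun i _ => Finset.sum_nonneg fun xs _ =>
      Finset.sum_nonneg fun ys _ => mul_nonneg (hw0 _ _) ?_) hn'.le
    split_ifs <;> norm_num
  have hQsum : ∀ G : X → Fin N → ℝ, ∑ x, ∑ u, Q x u * G x u =
      (∑ i, ∑ xs, ∑ ys, w xs ys * G (xs i) (ν i xs ys)) / n := by
    intro G
    have h1 : ∀ x u, Q x u * G x u = ∑ i, ∑ xs, ∑ ys,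
        w xs ys * (if xs i = x ∧ ν i xs ys = u then G x u else 0) / n := fun x u => by
      rw [hQ, div_mul_eq_mul_div, Finset.sum_mul, Finset.sum_div]
      refine Finset.sum_congr rfl fun i _ => ?_
      rw [Finset.sum_mul, Finset.sum_div]
      refine Finset.sum_congr rfl fun xs _ => ?_
      rw [Finset.sum_mul, Finset.sum_div]
      refine Finset.sum_congr rfl fun ys _ => ?_
      split_ifs <;> simp
    simp_rw [h1]
    rw [← Fintype.sum_prod_type' (f := fun x u => ∑ i, ∑ xs, ∑ ys,
      w xs ys * (if xs i = x ∧ ν i xs ys = u then G x u else 0) / n), Finset.sum_comm,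
      Finset.sum_div]
    refine Finset.sum_congr rfl fun i _ => ?_
    rw [Finset.sum_comm, Finset.sum_div]
    refine Finset.sum_congr rfl fun xs _ => ?_
    rw [Finset.sum_comm, Finset.sum_div]
    refine Finset.sum_congr rfl fun ys _ => ?_
    rw [Finset.sum_eq_single (xs i, ν i xs ys)]
    · simp
    · rintro ⟨x, u⟩ - hne
      rw [if_neg fun h => hne (by rw [h.1, h.2])]
      simp
    · simp
  obtain ⟨PU, hPUQ⟩ : ∃ PU : X → Fin N → ℝ, ∀ x u, PX x * PU x u = Q x u :=
    ⟨fun x u => Q x u / PX x, fun x u => mul_div_cancel₀ _ (hPXpos x).ne'⟩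
  have hPU : IsCondPMF PU := by
    refine fun x => ⟨fun u => ?_, ?_⟩
    · have := hQ0 x u
      rw [← hPUQ] at this
      exact nonneg_of_mul_nonneg_right this (hPXpos x)
    · have h1 := hQsum fun x' _ => if x' = x then 1 else 0
      simp_rw [← Finset.sum_mul] at h1
      simp only [mul_ite, mul_one, mul_zero, Finset.sum_ite_eq', Finset.mem_univ, if_true] at h1
      have h2 : ∀ i : Fin n, ∑ xs, (∑ ys, w xs ys) * (if xs i = x then (1 : ℝ) else 0) = PX x := by
        intro i
        simp_rw [hw1, iidProb]
        rw [sum_word_marginal PX hPX.2 (fun x' => if x' = x then 1 else 0) i]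
        simp
      simp only [mul_ite, mul_one, mul_zero] at h2
      simp_rw [h2] at h1
      simp_rw [← hPUQ] at h1
      rw [← Finset.mul_sum] at h1
      simp only [Finset.sum_const, Finset.card_univ, Fintype.card_fin, nsmul_eq_mul] at h1
      rw [mul_div_cancel_left₀ _ hn'.ne'] at h1
      exact mul_left_cancel₀ (hPXpos x).ne' (h1.trans (mul_one _).symm)
  have hP := pUJoint_nonneg hPXpos hPW hPU (η := η)
  have key : ∀ G : X → Y → Fin N → ℝ, ∑ x, ∑ y, ∑ u, pUJoint PX PW PU η x y u * G x y u =
      (∑ i, ∑ xs, ∑ ys, w xs ys * G (xs i) (ys i) (ν i xs ys)) / n := by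
    intro G
    have h1 : ∑ x, ∑ y, ∑ u, pUJoint PX PW PU η x y u * G x y u =
        ∑ x, ∑ u, Q x u * ∑ y, PW (η u) x y * G x y u := by
      refine Finset.sum_congr rfl fun x _ => ?_
      rw [Finset.sum_comm]
      refine Finset.sum_congr rfl fun u _ => ?_
      rw [Finset.mul_sum]
      refine Finset.sum_congr rfl fun y _ => ?_
      rw [pUJoint, hPUQ, mul_assoc]
    rw [h1, hQsum]
    congr 1
    refine Finset.sum_congr rfl fun i _ => Finset.sum_congr rfl fun xs _ => ?_
    simp_rw [hw, mul_assoc, ← Finset.mul_sum, sideProb, hν, hη]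
    congr 1
    exact sum_word_resample (fun i => PW (g (f xs) i) (xs i)) i (hPW _ _).2
      (fun y ys => G (xs i) y (e (i, f xs, Function.update ys i y₀)))
      fun y ys z => by rw [Function.update_idem]
  refine ⟨N, PU, η, hPU, ?_, ?_, ?_⟩
  · calc expDistU PX PW dist PU η ≤ ∑ y, ∑ u, ∑ x, pUJoint PX PW PU η x y u *
          dist x (h (e.symm u).2.1 (Function.update (e.symm u).2.2 (e.symm u).1 y)
            (e.symm u).1) :=
          Finset.sum_le_sum fun y _ => Finset.sum_le_sum fun u _ =>
            Finset.inf'_le _ (Finset.mem_univ _)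
      _ = ∑ x, ∑ y, ∑ u, pUJoint PX PW PU η x y u *
          dist x (h (e.symm u).2.1 (Function.update (e.symm u).2.2 (e.symm u).1 y)
            (e.symm u).1) := by
          rw [Finset.sum_comm (s := univ (α := X))]
          exact Finset.sum_congr rfl fun y _ => Finset.sum_comm
      _ = blockDist PX PW dist f g h / n := by
          rw [key fun x y u => dist x (h (e.symm u).2.1
            (Function.update (e.symm u).2.2 (e.symm u).1 y) (e.symm u).1)]
          congr 1
          simp only [hν, Equiv.symm_apply_apply, Function.update_idem, Function.update_eq_self]
          rw [Finset.sum_comm]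
          refine Finset.sum_congr rfl fun xs _ => ?_
          rw [Finset.sum_comm]
          refine Finset.sum_congr rfl fun ys _ => ?_
          rw [← Finset.mul_sum, hw]
  · refine le_of_eq ?_
    have h1 := key fun _ _ u => cost (η u)
    have h2 : ∑ x, ∑ y, ∑ u, pUJoint PX PW PU η x y u * cost (η u) =
        expCostU PX cost PU η := by
      refine Finset.sum_congr rfl fun x _ => ?_
      rw [Finset.sum_comm]
      refine Finset.sum_congr rfl fun u _ => ?_
      rw [← Finset.sum_mul, sum_pUJoint hPW]
    rw [← h2, h1, blockCost]
    congr 1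
    rw [Finset.sum_comm]
    refine Finset.sum_congr rfl fun xs _ => ?_
    simp_rw [hν, hη, ← Finset.sum_mul, hw1]
    rw [← Finset.mul_sum]
  · obtain ⟨c, hc⟩ : ∃ c : X → Y → Fin N → ℝ, ∀ x y u, c x y u =
        pUJoint PX PW PU η x y u / pYUu PX PW PU η y u *
        (pYAu PX PW PU η y (η u) / pAu PX PU η (η u)) := ⟨_, fun _ _ _ => rfl⟩
    have hYU0 : ∀ y u, 0 ≤ pYUu PX PW PU η y u := fun y u =>
      Finset.sum_nonneg fun x _ => hP x y u
    have hYA0 : ∀ y a, 0 ≤ pYAu PX PW PU η y a := fun y a => by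
      rw [pYAu_eq]
      exact Finset.sum_nonneg fun x _ =>
        mul_nonneg (pXAu_nonneg hPXpos hPU x a) ((hPW a x).1 y)
    have hA0 : ∀ a, 0 ≤ pAu PX PU η a := fun a =>
      Finset.sum_nonneg fun x _ => pXAu_nonneg hPXpos hPU x a
    have hsupp : ∀ {xs ys}, 0 < w xs ys → ∀ i, 0 < PW (η (ν i xs ys)) (xs i) (ys i) ∧
        0 < c (xs i) (ys i) (ν i xs ys) := by
      intro xs ys hpos i
      have h1 : 0 < sideProb PW (g (f xs)) xs ys := by
        rw [hw] at hpos
        exact pos_of_mul_pos_right hpos (iidProb_nonneg hPX xs)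
      have h2 : 0 < PW (η (ν i xs ys)) (xs i) (ys i) := by
        rw [hν, hη]
        exact lt_of_le_of_ne ((hPW _ _).1 _) fun h0 =>
          h1.ne' (Finset.prod_eq_zero (Finset.mem_univ i) h0.symm)
      have h3 : 0 < Q (xs i) (ν i xs ys) := by
        rw [hQ]
        have hnn : ∀ i' xs' ys', 0 ≤ w xs' ys' *
            (if xs' i' = xs i ∧ ν i' xs' ys' = ν i xs ys then (1 : ℝ) else 0) :=
          fun i' xs' ys' => mul_nonneg (hw0 _ _) (by split_ifs <;> norm_num)
        refine div_pos (Finset.sum_pos' (fun i' _ => Finset.sum_nonneg fun xs' _ =>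
          Finset.sum_nonneg fun ys' _ => hnn _ _ _) ⟨i, Finset.mem_univ i, Finset.sum_pos'
            (fun xs' _ => Finset.sum_nonneg fun ys' _ => hnn _ _ _) ⟨xs, Finset.mem_univ xs,
              Finset.sum_pos' (fun ys' _ => hnn _ _ _) ⟨ys, Finset.mem_univ ys, ?_⟩⟩⟩) hn'
        simpa using hpos
      have h4 : 0 < pUJoint PX PW PU η (xs i) (ys i) (ν i xs ys) := by
        rw [pUJoint, hPUQ]
        exact mul_pos h3 h2
      obtain ⟨-, -, -, k4, k5, k6⟩ := pos_of_pUJoint_pos hPXpos hPW hPU h4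
      refine ⟨h2, ?_⟩
      rw [hc]
      positivity
    have hc0 : ∀ x y u, 0 ≤ c x y u := fun x y u => by
      rw [hc]
      exact mul_nonneg (div_nonneg (hP x y u) (hYU0 y u)) (div_nonneg (hYA0 y _) (hA0 _))
    have hcx : ∀ y u, ∑ x, c x y u ≤ pYAu PX PW PU η y (η u) / pAu PX PU η (η u) := by
      intro y u
      simp_rw [hc]
      rw [← Finset.sum_mul, ← Finset.sum_div]
      refine mul_le_of_le_one_left (div_nonneg (hYA0 y _) (hA0 _)) ?_
      exact div_self_le_one _
    have hcy : ∀ a, ∑ y, pYAu PX PW PU η y a / pAu PX PU η a ≤ 1 := fun a => by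
      rw [← Finset.sum_div, sum_pYAu hPW]
      exact div_self_le_one _
    have hsum : ∑ xs : Fin n → X, ∑ ys : Fin n → Y, ∏ i, c (xs i) (ys i) (ν i xs ys) ≤ m := by
      calc ∑ xs : Fin n → X, ∑ ys : Fin n → Y, ∏ i, c (xs i) (ys i) (ν i xs ys)
          ≤ ∑ xs : Fin n → X, ∑ ys : Fin n → Y, ∑ t,
              ∏ i, c (xs i) (ys i) (e (i, t, Function.update ys i y₀)) := by
            refine Finset.sum_le_sum fun xs _ => Finset.sum_le_sum fun ys _ => ?_
            simp_rw [hν]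
            exact Finset.single_le_sum (f := fun t => ∏ i, c (xs i) (ys i)
              (e (i, t, Function.update ys i y₀)))
              (fun t _ => Finset.prod_nonneg fun i _ => hc0 _ _ _) (Finset.mem_univ (f xs))
        _ = ∑ t, ∑ ys : Fin n → Y, ∑ xs : Fin n → X,
              ∏ i, c (xs i) (ys i) (e (i, t, Function.update ys i y₀)) := by
            rw [Finset.sum_comm, Finset.sum_comm (s := univ (α := Fin m))]
            exact Finset.sum_congr rfl fun ys _ => Finset.sum_comm
        _ ≤ ∑ t, ∑ ys : Fin n → Y, ∏ i, pYAu PX PW PU η (ys i) (g t i) /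
              pAu PX PU η (g t i) := by
            refine Finset.sum_le_sum fun t _ => Finset.sum_le_sum fun ys _ => ?_
            rw [sum_prod_word fun i x => c x (ys i) (e (i, t, Function.update ys i y₀))]
            refine Finset.prod_le_prod (fun i _ => Finset.sum_nonneg fun x _ => hc0 _ _ _)
              fun i _ => ?_
            have := hcx (ys i) (e (i, t, Function.update ys i y₀))
            rwa [hη] at this
        _ ≤ ∑ _t : Fin m, 1 := by
            refine Finset.sum_le_sum fun t _ => ?_
            rw [sum_prod_word fun i y => pYAu PX PW PU η y (g t i) / pAu PX PU η (g t i)]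
            exact Finset.prod_le_one (fun i _ => Finset.sum_nonneg fun y _ =>
              div_nonneg (hYA0 _ _) (hA0 _)) fun i _ => hcy _
        _ = m := by simp
    have hgibbs := sum_mul_logb_div_nonneg (fun z : (Fin n → X) × (Fin n → Y) => w z.1 z.2)
      (fun z => (∏ i, c (z.1 i) (z.2 i) (ν i z.1 z.2)) / m) (fun z => hw0 _ _)
      (fun z => div_nonneg (Finset.prod_nonneg fun i _ => hc0 _ _ _) hm'.le)
      (fun z hz => div_pos (Finset.prod_pos fun i _ => (hsupp hz i).2) hm') (by
        rw [← Finset.sum_div, Fintype.sum_prod_type, Fintype.sum_prod_type]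
        simp_rw [hw1]
        rw [sum_iidProb hPX]
        exact (div_le_one hm').mpr hsum)
    have hlog : ∀ xs ys, w xs ys * Real.logb 2 (w xs ys /
        ((∏ i, c (xs i) (ys i) (ν i xs ys)) / m)) = w xs ys * Real.logb 2 m -
        ∑ i, w xs ys * Real.logb 2 (c (xs i) (ys i) (ν i xs ys) /
          (PX (xs i) * PW (η (ν i xs ys)) (xs i) (ys i))) := by
      intro xs ys
      rcases (hw0 xs ys).eq_or_lt with h0 | h0
      · simp [← h0]
      have hs := hsupp h0
      rw [← Finset.mul_sum, ← mul_sub, ← Real.logb_prod _ _ fun i _ =>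
        (div_pos (hs i).2 (mul_pos (hPXpos _) (hs i).1)).ne',
        ← Real.logb_div hm'.ne' (Finset.prod_pos fun i _ =>
          div_pos (hs i).2 (mul_pos (hPXpos _) (hs i).1)).ne', Finset.prod_div_distrib,
        Finset.prod_mul_distrib]
      have hw2 : w xs ys = (∏ i, PX (xs i)) * ∏ i, PW (η (ν i xs ys)) (xs i) (ys i) := by
        rw [hw]
        simp_rw [hν, hη]
        rfl
      rw [← hw2]
      congr 2
      rw [div_div_eq_mul_div, div_div_eq_mul_div, mul_comm]
    rw [Fintype.sum_prod_type] at hgibbs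
    simp only [hlog, Finset.sum_sub_distrib] at hgibbs
    simp_rw [← Finset.sum_mul, hw1] at hgibbs
    rw [sum_iidProb hPX, one_mul] at hgibbs
    rw [objective_eq_sum_logb hPXpos hPW hPU]
    simp_rw [← hc]
    rw [key fun x y u => Real.logb 2 (c x y u / (PX x * PW (η u) x y))]
    refine div_le_div_of_nonneg_right ?_ hn'.le
    refine le_trans (le_of_eq ?_) (sub_nonneg.mp hgibbs)
    rw [Finset.sum_comm]
    exact Finset.sum_congr rfl fun xs _ => Finset.sum_comm

end Converse

/-! ### Bounding the auxiliary alphabet -/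

section Cardinality

lemma sum_subtype_of_eq_zero {ι M : Type*} [Fintype ι] [AddCommMonoid M] (p : ι → Prop)
    [DecidablePred p] {F : ι → M} (hF : ∀ i, ¬ p i → F i = 0) :
    ∑ i : {i // p i}, F i = ∑ i, F i := by
  rw [← Fintype.sum_subtype_add_sum_subtype p F,
    Finset.sum_eq_zero (f := fun i : {i // ¬ p i} => F i) fun i _ => hF _ i.2, add_zero]

/-- Carathéodory's theorem for cones. -/
lemma exists_nonneg_weights_card_le_finrank {ι E : Type*} [Fintype ι] [AddCommGroup E]
    [Module ℝ E] [FiniteDimensional ℝ E] (v : ι → E) (c : ι → ℝ) (hc : ∀ i, 0 ≤ c i) :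
    ∃ c' : ι → ℝ, (∀ i, 0 ≤ c' i) ∧ ∑ i, c' i • v i = ∑ i, c i • v i ∧
      Nat.card {i // c' i ≠ 0} ≤ Module.finrank ℝ E := by
  classical
  obtain ⟨k, hk⟩ : ∃ k, k = Nat.card {i // c i ≠ 0} := ⟨_, rfl⟩
  induction k using Nat.strong_induction_on generalizing c with
  | _ k ih =>
  by_cases hle : Nat.card {i // c i ≠ 0} ≤ Module.finrank ℝ E
  · exact ⟨c, hc, rfl, hle⟩
  have hdep : ¬ LinearIndependent ℝ fun i : {i // c i ≠ 0} => v i := fun h =>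
    hle (by rw [Nat.card_eq_fintype_card]; exact h.fintype_card_le_finrank)
  obtain ⟨g, hg, hgpos⟩ : ∃ g : {i // c i ≠ 0} → ℝ, ∑ i, g i • v i = 0 ∧ ∃ i, 0 < g i := by
    obtain ⟨g, hg, i, hi⟩ := Fintype.not_linearIndependent_iff.mp hdep
    rcases hi.lt_or_gt with h | h
    · refine ⟨-g, ?_, i, by simpa using h⟩
      simp [hg]
    · exact ⟨g, hg, i, h⟩
  obtain ⟨i₀, hi₀, hmin⟩ := Finset.exists_min_image
    (univ.filter fun i : {i // c i ≠ 0} => 0 < g i) (fun i => c i / g i)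
    (by obtain ⟨i, hi⟩ := hgpos; exact ⟨i, by simpa using hi⟩)
  simp only [Finset.mem_filter, Finset.mem_univ, true_and] at hi₀ hmin
  obtain ⟨G, hG⟩ : ∃ G : ι → ℝ, ∀ i, G i = if h : c i ≠ 0 then g ⟨i, h⟩ else 0 := ⟨_, fun _ => rfl⟩
  have hGs : ∀ i : {i // c i ≠ 0}, G i = g i := fun i => by rw [hG, dif_pos i.2]
  have hG0 : ∀ i, c i = 0 → G i = 0 := fun i h => by rw [hG, dif_neg (not_not.mpr h)]
  have hGsum : ∑ i, G i • v i = 0 := by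
    rw [← hg, ← sum_subtype_of_eq_zero (c · ≠ 0) fun i hi => by
      rw [hG0 i (not_not.mp hi), zero_smul]]
    simp_rw [hGs]
  obtain ⟨t, ht⟩ : ∃ t, t = c i₀ / g i₀ := ⟨_, rfl⟩
  have ht0 : 0 ≤ t := ht ▸ div_nonneg (hc _) hi₀.le
  have hnn : ∀ i, 0 ≤ c i - t * G i := fun i => by
    by_cases h : c i = 0
    · simp [h, hG0 i h]
    have hGi := hGs ⟨i, h⟩
    simp only at hGi
    rw [hGi]
    by_cases hgi : 0 < g ⟨i, h⟩
    · have := hmin ⟨i, h⟩ hgi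
      rw [← ht, le_div_iff₀ hgi] at this
      simpa using this
    · have := mul_nonpos_of_nonneg_of_nonpos ht0 (not_lt.mp hgi)
      linarith [hc i]
  obtain ⟨c', hc', hsum, hcard⟩ := ih (Nat.card {i // c i - t * G i ≠ 0}) (by
      rw [hk, Nat.card_eq_fintype_card, Nat.card_eq_fintype_card]
      refine Fintype.card_lt_of_injective_of_notMem
        (fun i => ⟨i.1, fun h => i.2 (by rw [h, hG0 _ h]; simp)⟩)
        (fun i j hij => Subtype.ext (by simpa using hij)) (b := i₀) ?_
      rintro ⟨j, hj⟩
      apply j.2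
      have hji : j.1 = i₀.1 := congrArg Subtype.val hj
      rw [hji, hGs, ht, div_mul_cancel₀ _ hi₀.ne', sub_self]) _ hnn rfl
  refine ⟨c', hc', hsum.trans ?_, hcard⟩
  simp_rw [sub_smul, Finset.sum_sub_distrib, mul_smul]
  rw [← Finset.smul_sum, hGsum, smul_zero, sub_zero]

variable {N : ℕ} {PX : X → ℝ} {PW : A → X → Y → ℝ} {PU : X → Fin N → ℝ} {η : Fin N → A}

lemma letterTerm_smul (a : A) (v : X → ℝ) {c : ℝ} (hc : 0 ≤ c) :
    letterTerm PX PW a (fun x => c * v x) = c * letterTerm PX PW a v := by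
  rcases hc.eq_or_lt with h0 | h0
  · simp [letterTerm, ← h0]
  have hlog : ∀ s : ℝ, c * s * Real.logb 2 (c * s) =
      c * (s * Real.logb 2 c) + c * (s * Real.logb 2 s) := fun s => by
    rcases eq_or_ne s 0 with rfl | hs
    · simp
    · rw [Real.logb_mul h0.ne' hs]
      ring
  have h1 : ∑ x, ∑ y, v x * PW a x y * Real.logb 2 c =
      ∑ y, (∑ x, v x * PW a x y) * Real.logb 2 c := by
    rw [Finset.sum_comm]
    simp_rw [Finset.sum_mul]
  have h2 : ∀ y, ∑ x, c * v x * PW a x y = c * ∑ x, v x * PW a x y := fun y => by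
    simp_rw [mul_assoc, ← Finset.mul_sum]
  simp_rw [letterTerm, h2, hlog, mul_assoc c (v _) (PW _ _ _), hlog, mul_assoc c,
    Finset.sum_add_distrib, ← Finset.mul_sum, h1]
  ring

lemma letterDist_smul [Nonempty Xh] (dist : X → Xh → ℝ) (a : A) (v : X → ℝ) {c : ℝ}
    (hc : 0 ≤ c) :
    letterDist PW dist a (fun x => c * v x) = c * letterDist PW dist a v := by
  simp_rw [letterDist, mul_assoc c, ← Finset.mul_sum]
  rw [Finset.mul_sum]
  exact Finset.sum_congr rfl fun y _ => (Finset.apply_inf'_eq_inf'_comp Finset.univ_nonempty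
    (fun r : ℝ => c * r) fun r s => mul_min_of_nonneg _ _ hc).symm

lemma exists_isCondPMF_card_le [Nonempty Xh] {dist : X → Xh → ℝ} {cost : A → ℝ}
    (hPX : ∀ x, 0 < PX x) (hPW : ∀ a x, IsPMF (PW a x)) (hPU : IsCondPMF PU) :
    ∃ n ≤ Fintype.card X * Fintype.card A + 2, ∃ (PU' : X → Fin n → ℝ) (η' : Fin n → A),
      IsCondPMF PU' ∧ expDistU PX PW dist PU' η' = expDistU PX PW dist PU η ∧
      expCostU PX cost PU' η' = expCostU PX cost PU η ∧
      IXAu PX PU' η' + IXUcondYAu PX PW PU' η' = IXAu PX PU η + IXUcondYAu PX PW PU η := by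
  classical
  obtain ⟨c, hc, hsum, hcard⟩ := exists_nonneg_weights_card_le_finrank
    (fun u => ((fun z => if η u = z.2 then PX z.1 * PU z.1 u else 0,
      letterTerm PX PW (η u) (fun x => PX x * PU x u),
      letterDist PW dist (η u) (fun x => PX x * PU x u)) : (X × A → ℝ) × ℝ × ℝ))
    (fun _ => 1) (fun _ => zero_le_one)
  simp only [one_smul] at hsum
  have hdim : Module.finrank ℝ ((X × A → ℝ) × ℝ × ℝ) = Fintype.card X * Fintype.card A + 2 := by
    simp [Module.finrank_prod]
  rw [hdim] at hcard
  have hsum1 : ∀ x a, ∑ u, c u * (if η u = a then PX x * PU x u else 0) =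
      pXAu PX PU η x a := fun x a => by
    have := congrFun (congrArg Prod.fst hsum) (x, a)
    simpa [Prod.fst_sum, Finset.sum_apply, pXAu] using this
  have hsum2 := congrArg (fun z => z.2.1) hsum
  have hsum3 := congrArg (fun z => z.2.2) hsum
  simp only [Prod.snd_sum, Prod.fst_sum, Prod.smul_snd, Prod.smul_fst, smul_eq_mul] at hsum2 hsum3
  let e := Finite.equivFin {u // c u ≠ 0}
  have hre : ∀ F : Fin N → ℝ, ∑ j, c (e.symm j) * F (e.symm j) = ∑ u, c u * F u := fun F => by
    rw [Equiv.sum_comp e.symm fun u => c u * F u]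
    exact sum_subtype_of_eq_zero (F := fun u => c u * F u) (c · ≠ 0) fun u hu => by
      rw [not_not.mp hu, zero_mul]
  have hq : ∀ x a, pXAu PX (fun x j => c (e.symm j) * PU x (e.symm j))
      (fun j => η (e.symm j)) x a = pXAu PX PU η x a := fun x a => by
    rw [← hsum1, ← hre, pXAu]
    refine Finset.sum_congr rfl fun j _ => ?_
    split_ifs
    · ring
    · simp
  have hPU' : IsCondPMF fun x j => c (e.symm j) * PU x (e.symm j) := fun x => by
    refine ⟨fun j => mul_nonneg (hc _) ((hPU x).1 _), ?_⟩
    have h1 : ∑ a, pXAu PX (fun x j => c (e.symm j) * PU x (e.symm j))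
        (fun j => η (e.symm j)) x a = PX x := by
      simp_rw [hq]
      exact sum_pXAu x hPU
    simp_rw [pXAu] at h1
    rw [Finset.sum_comm] at h1
    simp only [Finset.sum_ite_eq, Finset.mem_univ, if_true, ← Finset.mul_sum] at h1
    exact mul_left_cancel₀ (hPX x).ne' (h1.trans (mul_one _).symm)
  have hcomm : ∀ x j, PX x * (c (e.symm j) * PU x (e.symm j)) =
      c (e.symm j) * (PX x * PU x (e.symm j)) := fun x j => by ring
  refine ⟨_, hcard, fun x j => c (e.symm j) * PU x (e.symm j), fun j => η (e.symm j), hPU',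
    ?_, ?_, ?_⟩
  · rw [expDistU_eq_sum_letterDist, expDistU_eq_sum_letterDist, ← hsum3, ← hre]
    simp_rw [hcomm, letterDist_smul dist _ _ (hc _)]
  · rw [expCostU_eq_sum_pXAu, expCostU_eq_sum_pXAu]
    simp_rw [hq]
  · rw [objective_eq_terms hPX hPW hPU', objective_eq_terms hPX hPW hPU]
    congr 1
    · rw [← hsum2, ← hre]
      simp_rw [hcomm, letterTerm_smul _ _ (hc _)]
    · congr 1
      funext x a
      exact hq x a

end Cardinality

/-! ### Compactness -/

section Compactness

variable {PX : X → ℝ} {PW : A → X → Y → ℝ}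

lemma continuous_mul_logb : Continuous fun t : ℝ => t * Real.logb 2 t := by
  simp_rw [Real.logb, ← mul_div_assoc]
  exact Real.continuous_mul_log.div_const _

lemma isCompact_isCondPMF (n : ℕ) : IsCompact {PU : X → Fin n → ℝ | IsCondPMF PU} := by
  have h := isCompact_univ_pi fun _ : X => isCompact_stdSimplex ℝ (Fin n)
  convert h using 1
  ext PU
  simp [IsCondPMF, IsPMF, stdSimplex]

lemma continuous_expDistU [Nonempty Xh] (dist : X → Xh → ℝ) {n : ℕ} (η : Fin n → A) :
    Continuous fun PU => expDistU PX PW dist PU η := by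
  unfold expDistU pUJoint
  refine continuous_finsetSum _ fun y _ => continuous_finsetSum _ fun u _ =>
    Continuous.finset_inf'_apply _ fun xh _ => ?_
  fun_prop

lemma continuous_expCostU (cost : A → ℝ) {n : ℕ} (η : Fin n → A) :
    Continuous fun PU => expCostU PX cost PU η := by
  unfold expCostU
  fun_prop

lemma continuous_letterTerm (a : A) : Continuous fun v => letterTerm PX PW a v := by
  unfold letterTerm
  refine ((continuous_finsetSum _ fun x _ => continuous_finsetSum _ fun y _ =>
    continuous_mul_logb.comp ?_).sub (continuous_finsetSum _ fun y _ =>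
      continuous_mul_logb.comp ?_)).sub ?_ <;> fun_prop

lemma continuous_actionTerm : Continuous fun q => actionTerm PW q := by
  unfold actionTerm
  refine (continuous_finsetSum _ fun y _ => continuous_finsetSum _ fun a _ =>
    continuous_mul_logb.comp ?_).sub (continuous_finsetSum _ fun a _ =>
      continuous_mul_logb.comp ?_) <;> fun_prop

lemma continuousOn_objective (hPX : ∀ x, 0 < PX x) (hPW : ∀ a x, IsPMF (PW a x)) {n : ℕ}
    (η : Fin n → A) :
    ContinuousOn (fun PU => IXAu PX PU η + IXUcondYAu PX PW PU η) {PU | IsCondPMF PU} := by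
  refine ContinuousOn.congr (Continuous.continuousOn ?_)
    fun PU hPU => objective_eq_terms hPX hPW hPU
  refine (continuous_finsetSum _ fun u _ => (continuous_letterTerm (η u)).comp ?_).add
    (continuous_actionTerm.comp ?_)
  · fun_prop
  · refine continuous_pi fun x => continuous_pi fun a => continuous_finsetSum _ fun u _ => ?_
    split_ifs <;> fun_prop

lemma exists_slack_of_infeasible [Nonempty Xh] (hPX : ∀ x, 0 < PX x)
    (hPW : ∀ a x, IsPMF (PW a x)) (dist : X → Xh → ℝ) (cost : A → ℝ) {D C R : ℝ} {n : ℕ}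
    (η : Fin n → A) (h : ∀ PU : X → Fin n → ℝ, IsCondPMF PU →
      IXAu PX PU η + IXUcondYAu PX PW PU η ≤ R → expDistU PX PW dist PU η ≤ D →
      ¬ expCostU PX cost PU η ≤ C) :
    ∃ ε > 0, ∀ PU : X → Fin n → ℝ, IsCondPMF PU →
      IXAu PX PU η + IXUcondYAu PX PW PU η ≤ R → expDistU PX PW dist PU η ≤ D + ε →
      ¬ expCostU PX cost PU η ≤ C + ε := by
  obtain ⟨S, hS⟩ : ∃ S : Set (X → Fin n → ℝ), S = {PU | IsCondPMF PU} ∩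
    (fun PU => IXAu PX PU η + IXUcondYAu PX PW PU η) ⁻¹' Set.Iic R := ⟨_, rfl⟩
  have hcl : IsClosed {PU : X → Fin n → ℝ | IsCondPMF PU} := (isCompact_isCondPMF n).isClosed
  have hcpt : IsCompact S := by
    refine (isCompact_isCondPMF n).of_isClosed_subset ?_ (hS ▸ Set.inter_subset_left)
    rw [hS]
    exact (continuousOn_objective hPX hPW η).preimage_isClosed_of_isClosed hcl isClosed_Iic
  rcases S.eq_empty_or_nonempty with hemp | hne
  · refine ⟨1, one_pos, fun PU hPU hR => absurd (?_ : PU ∈ S) (by simp [hemp])⟩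
    rw [hS]
    exact ⟨hPU, hR⟩
  obtain ⟨P, hP, hmin⟩ := hcpt.exists_isMinOn hne
    (((continuous_expDistU dist η).sub continuous_const).max
      ((continuous_expCostU cost η).sub continuous_const)).continuousOn
      (f := fun PU => max (expDistU PX PW dist PU η - D) (expCostU PX cost PU η - C))
  obtain ⟨e, he⟩ : ∃ e, e = max (expDistU PX PW dist P η - D) (expCostU PX cost P η - C) :=
    ⟨_, rfl⟩
  have he0 : 0 < e := by
    rw [hS] at hP
    by_contra! hle
    rw [he, max_le_iff] at hle
    exact h P hP.1 hP.2 (by linarith) (by linarith)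
  refine ⟨e / 2, half_pos he0, fun PU hPU hR hD hC => ?_⟩
  have hm : PU ∈ S := hS ▸ ⟨hPU, hR⟩
  have h1 := hmin hm
  simp only [Set.mem_ofPred_eq, ← he] at h1
  have h2 := h1.trans (max_le (by linarith) (by linarith) : _ ≤ e / 2)
  linarith

lemma exists_isCondPMF_of_forall_slack [Nonempty Xh] (hPX : ∀ x, 0 < PX x)
    (hPW : ∀ a x, IsPMF (PW a x)) (dist : X → Xh → ℝ) (cost : A → ℝ) {D C R : ℝ} {B : ℕ}
    (h : ∀ ε > 0, ∃ n ≤ B, ∃ (PU : X → Fin n → ℝ) (η : Fin n → A), IsCondPMF PU ∧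
      IXAu PX PU η + IXUcondYAu PX PW PU η ≤ R ∧ expDistU PX PW dist PU η ≤ D + ε ∧
      expCostU PX cost PU η ≤ C + ε) :
    ∃ n ≤ B, ∃ (PU : X → Fin n → ℝ) (η : Fin n → A), IsCondPMF PU ∧
      IXAu PX PU η + IXUcondYAu PX PW PU η ≤ R ∧ expDistU PX PW dist PU η ≤ D ∧
      expCostU PX cost PU η ≤ C := by
  by_contra! hno
  choose e he0 he using fun z : (n : Fin (B + 1)) × (Fin n → A) =>
    exists_slack_of_infeasible hPX hPW dist cost z.2 (D := D) (C := C) (R := R)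
      fun PU hPU hR hD => (hno z.1 (Nat.lt_succ_iff.mp z.1.2) PU z.2 hPU hR hD).not_ge
  have : Nonempty ((n : Fin (B + 1)) × (Fin n → A)) := ⟨⟨0, Fin.elim0⟩⟩
  obtain ⟨z₀, hz₀⟩ := Finite.exists_min e
  obtain ⟨n, hn, PU, η, hPU, hR, hD, hC⟩ := h (e z₀) (he0 z₀)
  have hz := hz₀ ⟨⟨n, Nat.lt_succ_iff.mpr hn⟩, η⟩
  exact he ⟨⟨n, Nat.lt_succ_iff.mpr hn⟩, η⟩ PU hPU hR (by linarith) (by linarith)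

end Compactness

/-! ### Operational characterization -/

section Operational

variable {PX : X → ℝ} {PW : A → X → Y → ℝ} {dist : X → Xh → ℝ} {cost : A → ℝ} {D C : ℝ}

lemma Achievable.exists_code [Nonempty X] {R : ℝ} (h : Achievable PX PW dist cost R D C) {ε : ℝ}
    (hε : 0 < ε) :
    ∃ n m : ℕ, 0 < n ∧ 0 < m ∧ (m : ℝ) ≤ 2 ^ (n * R) ∧
      ∃ (f : (Fin n → X) → Fin m) (g : Fin m → Fin n → A) (h : Fin m → (Fin n → Y) → Fin n → Xh),
        blockDist PX PW dist f g h ≤ n * (D + ε) ∧ blockCost PX cost f g ≤ n * (C + ε) := by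
  obtain ⟨N, hN⟩ := h ε hε
  obtain ⟨f, g, k, hfgk⟩ := hN (max N 1) (le_max_left _ _)
  exact ⟨_, _, lt_max_of_lt_right one_pos, Fin.pos (f fun _ => Classical.arbitrary X),
    Nat.floor_le (by positivity), f, g, k, hfgk⟩

lemma Achievable.exists_isCondPMF [Nonempty X] [Nonempty Y] [Nonempty Xh] (hPX : IsPMF PX)
    (hPXpos : ∀ x, 0 < PX x) (hPW : ∀ a x, IsPMF (PW a x)) {R : ℝ}
    (h : Achievable PX PW dist cost R D C) :
    ∃ n ≤ Fintype.card X * Fintype.card A + 2, ∃ (PU : X → Fin n → ℝ) (η : Fin n → A),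
      IsCondPMF PU ∧ IXAu PX PU η + IXUcondYAu PX PW PU η ≤ R ∧
      expDistU PX PW dist PU η ≤ D ∧ expCostU PX cost PU η ≤ C := by
  refine exists_isCondPMF_of_forall_slack hPXpos hPW dist cost fun ε hε => ?_
  obtain ⟨n, m, hn, hm, hmR, f, g, k, hD, hC⟩ := h.exists_code hε
  have hn' : (0 : ℝ) < n := Nat.cast_pos.mpr hn
  have hm' : (0 : ℝ) < m := Nat.cast_pos.mpr hm
  obtain ⟨N, PU, η, hPU, hD1, hC1, hR1⟩ :=
    exists_isCondPMF_of_code (dist := dist) (cost := cost) hPX hPXpos hPW hn hm f g k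
  obtain ⟨N', hN', PU', η', hPU', hD2, hC2, hR2⟩ :=
    exists_isCondPMF_card_le (dist := dist) (cost := cost) (η := η) hPXpos hPW hPU
  refine ⟨N', hN', PU', η', hPU', hR2.trans_le (hR1.trans ?_), hD2.trans_le (hD1.trans ?_),
    hC2.trans_le (hC1.trans ?_)⟩
  · rw [div_le_iff₀ hn', Real.logb_le_iff_le_rpow one_lt_two hm', mul_comm R]
    exact hmR
  · rwa [div_le_iff₀' hn']
  · rwa [div_le_iff₀' hn']

lemma exists_isCondPMF_of_nonneg [Nonempty A] [Nonempty Xh] (PX : X → ℝ) (PW : A → X → Y → ℝ)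
    (hdist0 : ∀ x, ∃ xh, dist x xh = 0) (hcost0 : ∃ a, cost a = 0) (hD : 0 ≤ D) (hC : 0 ≤ C) :
    ∃ n ≤ Fintype.card X * Fintype.card A + 2, ∃ (PU : X → Fin n → ℝ) (η : Fin n → A),
      IsCondPMF PU ∧ expDistU PX PW dist PU η ≤ D ∧ expCostU PX cost PU η ≤ C := by
  obtain ⟨a₀, ha₀⟩ := hcost0
  choose r hr using hdist0
  let e := Fintype.equivFin X
  refine ⟨Fintype.card X, (Nat.le_mul_of_pos_right _ Fintype.card_pos).trans (Nat.le_add_right _ _),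
    fun x u => if e x = u then 1 else 0, fun _ => a₀, fun x => ⟨fun u => ?_, by simp⟩, ?_, ?_⟩
  · dsimp only
    split_ifs <;> simp
  · refine (Finset.sum_nonpos fun y _ => Finset.sum_nonpos fun u _ =>
      (Finset.inf'_le _ (Finset.mem_univ (r (e.symm u)))).trans
        (Finset.sum_nonpos fun x _ => ?_)).trans hD
    rw [pUJoint]
    split_ifs with hx
    · simp [← hx, hr]
    · simp
  · simp [expCostU, ha₀, hC]

end Operational

/-- The operational rate-distortion-cost function of the source coding
problem with action-dependent side information equals the single-letter expression
`min I(X;A) + I(X;U|Y,A)`, minimized over auxiliary alphabets of size at most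
`|X||A| + 2`, conditional pmfs `P_{U|X}` and functions `η : U → A`, subject to
`E[d(X, X̂ᵒᵖᵗ(U,Y))] ≤ D` and `E[Δ(A)] ≤ C`. -/
theorem operational_rate_distortion_cost
    {X Y A Xh : Type} [Fintype X] [Fintype Y] [Fintype A] [Fintype Xh]
    [DecidableEq X] [DecidableEq Y] [DecidableEq A] [DecidableEq Xh]
    [Nonempty X] [Nonempty Y] [Nonempty A] [Nonempty Xh]
    (PX : X → ℝ) (PW : A → X → Y → ℝ) (dist : X → Xh → ℝ) (cost : A → ℝ)
    (hPX : IsPMF PX) (hPXpos : ∀ x, 0 < PX x)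
    (hPW : ∀ a x, IsPMF (PW a x))
    (hdist : ∀ x xh, 0 ≤ dist x xh) (hdist0 : ∀ x, ∃ xh, dist x xh = 0)
    (hcost : ∀ a, 0 ≤ cost a) (hcost0 : ∃ a, cost a = 0)
    (D C : ℝ) (hD : 0 ≤ D) (hC : 0 ≤ C) :
    opRDC PX PW dist cost D C = RDCUbdd PX PW dist cost D C := by
  obtain ⟨n₀, hn₀, PU₀, η₀, hPU₀, hD₀, hC₀⟩ :=
    exists_isCondPMF_of_nonneg PX PW hdist0 hcost0 hD hC
  have hnonneg : ∀ {n : ℕ} {PU : X → Fin n → ℝ} {η : Fin n → A}, IsCondPMF PU →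
      0 ≤ IXAu PX PU η + IXUcondYAu PX PW PU η := fun hPU =>
    add_nonneg (IXAu_nonneg hPX hPXpos hPU) (IXUcondYAu_nonneg hPXpos hPW hPU)
  have hach : ∀ {n : ℕ} {PU : X → Fin n → ℝ} {η : Fin n → A}, IsCondPMF PU →
      expDistU PX PW dist PU η ≤ D → expCostU PX cost PU η ≤ C → ∀ {δ : ℝ}, 0 < δ →
      Achievable PX PW dist cost (IXAu PX PU η + IXUcondYAu PX PW PU η + δ) D C :=
    fun hPU h1 h2 _ hδ =>
      achievable_of_isCondPMF hPX hPXpos hPW hdist hcost hD hC hPU h1 h2 hδ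
  rw [opRDC, RDCUbdd]
  refine le_antisymm ?_ ?_
  · refine le_csInf ⟨_, n₀, hn₀, PU₀, η₀, hPU₀, hD₀, hC₀, rfl⟩ ?_
    rintro r ⟨n, -, PU, η, hPU, h1, h2, rfl⟩
    refine le_of_forall_pos_le_add fun δ hδ => csInf_le ⟨0, fun R hR => ?_⟩ (hach hPU h1 h2 hδ)
    obtain ⟨n, -, PU, η, hPU, hle, -⟩ := Achievable.exists_isCondPMF hPX hPXpos hPW hR
    exact (hnonneg hPU).trans hle
  · refine le_csInf ⟨_, hach hPU₀ hD₀ hC₀ one_pos⟩ fun R hR => ?_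
    obtain ⟨n, hn, PU, η, hPU, hle, h1, h2⟩ := Achievable.exists_isCondPMF hPX hPXpos hPW hR
    refine le_trans (csInf_le ⟨0, ?_⟩ ?_) hle
    swap
    · exact ⟨n, hn, PU, η, hPU, h1, h2, rfl⟩
    rintro r ⟨n, -, PU, η, hPU, -, -, rfl⟩
    exact hnonneg hPU
end
end

section
/- The single-letter minimization min I(X;A) + I(X;U|Y,A) over finite alphabets 𝒰, conditional pmfs P_{U|X} and functions η : 𝒰 → 𝒜 subject to E[d(X, X̂^opt(U,Y))] ≤ D and E[Δ(A)] ≤ C is equal to the Shannon-strategy minimization min I(X;a(T)) + I(X;T|Y,a(T)) over conditional pmfs P_{T|X} on the strategy set 𝒯 subject to Σ_{t,x} P_X(x) P_{T|X}(t|x) Δ(a(t)) ≤ C and Σ_{t,x,y} P_{X,Y,T}(x,y,t) d(t(y),x) ≤ D; moreover the cardinality of the strategy set can be restricted as |𝒯| ≤ |𝒳||𝒜| + 2 without changing the minimum. -/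
open Finset

noncomputable section

variable {X Y A Xh : Type} [Fintype X] [Fintype Y] [Fintype A] [Fintype Xh]
  [DecidableEq X] [DecidableEq Y] [DecidableEq A] [DecidableEq Xh]


/-- Joint pmf `P_{X,Y,T}(x,y,t) = P_X(x) P_{T|X}(t|x) P_{Y|X,A}(y|x,a(t))`. -/
def pXYT (PX : X → ℝ) (PW : A → X → Y → ℝ) (PT : X → Strat Y Xh A → ℝ)
    (x : X) (y : Y) (t : Strat Y Xh A) : ℝ :=
  PX x * PT x t * PW t.2 x y

/-- Action marginal `P_A`. -/
def pA (PX : X → ℝ) (PT : X → Strat Y Xh A → ℝ) (a : A) : ℝ :=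
  ∑ x, ∑ t, if t.2 = a then PX x * PT x t else 0

/-- Marginal `P_{X,A}`. -/
def pXA (PX : X → ℝ) (PT : X → Strat Y Xh A → ℝ) (x : X) (a : A) : ℝ :=
  ∑ t, if t.2 = a then PX x * PT x t else 0

/-- Marginal `P_{Y,A}`. -/
def pYA (PX : X → ℝ) (PW : A → X → Y → ℝ) (PT : X → Strat Y Xh A → ℝ)
    (y : Y) (a : A) : ℝ :=
  ∑ x, ∑ t, if t.2 = a then pXYT PX PW PT x y t else 0

/-- Marginal `P_{X,Y,A}`. -/
def pXYA (PX : X → ℝ) (PW : A → X → Y → ℝ) (PT : X → Strat Y Xh A → ℝ)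
    (x : X) (y : Y) (a : A) : ℝ :=
  ∑ t, if t.2 = a then pXYT PX PW PT x y t else 0

/-- Marginal `P_{Y,T}`. -/
def pYT (PX : X → ℝ) (PW : A → X → Y → ℝ) (PT : X → Strat Y Xh A → ℝ)
    (y : Y) (t : Strat Y Xh A) : ℝ :=
  ∑ x, pXYT PX PW PT x y t

/-- Mutual information `I(X; a(T))` (base-2 logarithms). -/
def IXA (PX : X → ℝ) (PT : X → Strat Y Xh A → ℝ) : ℝ :=
  ∑ x, ∑ a, pXA PX PT x a * Real.logb 2 (pXA PX PT x a / (PX x * pA PX PT a))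

/-- Conditional mutual information `I(X; T | Y, a(T))` (base-2 logarithms). -/
def IXTcondYA (PX : X → ℝ) (PW : A → X → Y → ℝ) (PT : X → Strat Y Xh A → ℝ) : ℝ :=
  ∑ x, ∑ y, ∑ t, pXYT PX PW PT x y t *
    Real.logb 2 (pXYT PX PW PT x y t * pYA PX PW PT y t.2 /
      (pXYA PX PW PT x y t.2 * pYT PX PW PT y t))

/-- Average distortion `E[d(X, T(Y))]`. -/
def expDist (PX : X → ℝ) (PW : A → X → Y → ℝ) (dist : X → Xh → ℝ)
    (PT : X → Strat Y Xh A → ℝ) : ℝ :=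
  ∑ x, ∑ y, ∑ t, pXYT PX PW PT x y t * dist x (t.1 y)

/-- Average action cost `E[Δ(a(T))]`. -/
def expCost (PX : X → ℝ) (cost : A → ℝ) (PT : X → Strat Y Xh A → ℝ) : ℝ :=
  ∑ x, ∑ t, PX x * PT x t * cost t.2

/-- The rate-distortion-cost function in the Shannon-strategy formulation. -/
def RDC (PX : X → ℝ) (PW : A → X → Y → ℝ) (dist : X → Xh → ℝ) (cost : A → ℝ)
    (D C : ℝ) : ℝ :=
  sInf { r : ℝ | ∃ PT : X → Strat Y Xh A → ℝ, IsCondPMF PT ∧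
    expDist PX PW dist PT ≤ D ∧ expCost PX cost PT ≤ C ∧
    r = IXA PX PT + IXTcondYA PX PW PT }
set_option linter.unusedSectionVars false

/-- Carathéodory's theorem for cones: a nonnegative combination of finitely many vectors can be
rewritten with nonnegative weights, at most `finrank` many of which are nonzero. -/
theorem exists_nonneg_weights_card_support_le {ι V : Type*} [Fintype ι] [AddCommGroup V]
    [Module ℝ V] [FiniteDimensional ℝ V] (v : ι → V) :
    ∃ w : ι → ℝ, (∀ i, 0 ≤ w i) ∧ ∑ i, w i • v i = ∑ i, v i ∧
      #{i | w i ≠ 0} ≤ Module.finrank ℝ V := by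
  classical
  have hex : ∃ n, ∃ w : ι → ℝ, (∀ i, 0 ≤ w i) ∧ ∑ i, w i • v i = ∑ i, v i ∧
      #{i | w i ≠ 0} = n := ⟨_, fun _ => 1, fun _ => zero_le_one, by simp, rfl⟩
  obtain ⟨w, hw0, hwsum, hwcard⟩ := Nat.find_spec hex
  refine ⟨w, hw0, hwsum, ?_⟩
  by_contra! hlt
  have hdep : ¬ LinearIndepOn ℝ v (({i | w i ≠ 0} : Finset ι) : Set ι) := fun h => by
    have := LinearIndependent.fintype_card_le_finrank h
    simp only [Finset.coe_sort_coe, Fintype.card_coe] at this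
    omega
  obtain ⟨g, hg0, hgsum, j, hj⟩ : ∃ g : ι → ℝ, (∀ i, w i = 0 → g i = 0) ∧
      ∑ i, g i • v i = 0 ∧ ∃ j, 0 < g j := by
    rw [not_linearIndepOn_finset_iff] at hdep
    obtain ⟨f, hf, i, hi, hfi⟩ := hdep
    have hsum : ∑ j, (if w j ≠ 0 then f j else 0) • v j = 0 := by
      rw [← hf, Finset.sum_filter]
      exact Finset.sum_congr rfl fun j _ => by split_ifs <;> simp
    have hwi : w i ≠ 0 := by simpa using hi
    rcases lt_or_gt_of_ne hfi with h | h
    · refine ⟨fun j => -(if w j ≠ 0 then f j else 0), fun j hj => by simp [hj], ?_,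
        i, by simpa [hwi] using h⟩
      simp only [neg_smul, Finset.sum_neg_distrib, hsum, neg_zero]
    · exact ⟨fun j => if w j ≠ 0 then f j else 0, fun j hj => by simp [hj], hsum,
        i, by simpa [hwi] using h⟩
  obtain ⟨k, hk, hmin⟩ := Finset.exists_min_image ({i | 0 < g i} : Finset ι)
    (fun i => w i / g i) ⟨j, by simpa using hj⟩
  simp only [Finset.mem_filter, Finset.mem_univ, true_and] at hk hmin
  have hr : 0 ≤ w k / g k := div_nonneg (hw0 k) hk.le
  refine Nat.find_min hex (m := #{i | w i - w k / g k * g i ≠ 0}) ?_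
    ⟨fun i => w i - w k / g k * g i, fun i => ?_, ?_, rfl⟩
  · rw [← hwcard]
    refine Finset.card_lt_card (Finset.ssubset_iff_of_subset ?_ |>.2 ⟨k, ?_, ?_⟩)
    · intro i
      simp only [Finset.mem_filter, Finset.mem_univ, true_and]
      intro h h'
      exact h (by simp [h', hg0 i h'])
    · simpa using fun h => hk.ne' (hg0 k h)
    · simp [hk.ne']
  · rcases le_or_gt (g i) 0 with h | h
    · nlinarith [hw0 i, mul_nonneg hr (neg_nonneg.2 h)]
    · have := (le_div_iff₀ h).1 (hmin i h)
      linarith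
  · simp only [sub_smul, mul_smul, Finset.sum_sub_distrib, ← Finset.smul_sum, hgsum, hwsum,
      smul_zero, sub_zero]

/-- The log-sum inequality, with an additional constant factor inside the logarithms. -/
theorem logb_sum_inequality {ι : Type*} (s : Finset ι) (a b : ι → ℝ) (c e : ℝ)
    (ha : ∀ i ∈ s, 0 ≤ a i) (hab : ∀ i ∈ s, a i ≤ b i) :
    (∑ i ∈ s, a i) * Real.logb 2 ((∑ i ∈ s, a i) * c / (e * ∑ i ∈ s, b i)) ≤
      ∑ i ∈ s, a i * Real.logb 2 (a i * c / (e * b i)) := by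
  rcases eq_or_ne c 0 with rfl | hc
  · simp
  rcases eq_or_ne e 0 with rfl | he
  · simp
  set S := ∑ i ∈ s, a i with hS
  set T := ∑ i ∈ s, b i with hT
  rcases (Finset.sum_nonneg ha).eq_or_lt with h0 | hpos
  · have h := (Finset.sum_eq_zero_iff_of_nonneg ha).1 h0.symm
    rw [Finset.sum_congr rfl fun i hi => by rw [h i hi, zero_mul], hS, ← h0]
    simp
  have hTpos : 0 < T := hpos.trans_le (Finset.sum_le_sum hab)
  rw [← hS] at hpos
  simp only [Real.logb, ← mul_div_assoc, ← Finset.sum_div]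
  refine div_le_div_of_nonneg_right ?_ (Real.log_pos one_lt_two).le
  have key : ∀ i ∈ s, a i * Real.log (S * c / (e * T)) + (a i - b i * (S / T)) ≤
      a i * Real.log (a i * c / (e * b i)) := by
    intro i hi
    rcases (ha i hi).eq_or_lt with h | h
    · have hb : 0 ≤ b i := (ha i hi).trans (hab i hi)
      rw [← h]
      have : 0 ≤ b i * (S / T) := by positivity
      linarith
    · have hb : 0 < b i := h.trans_le (hab i hi)
      have h1 := Real.one_sub_inv_le_log_of_pos (x := a i * T / (b i * S)) (by positivity)
      rw [Real.log_div (by positivity) (by positivity), Real.log_mul (by positivity)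
        (by positivity), Real.log_mul (by positivity) (by positivity)] at h1
      rw [Real.log_div (by positivity) (by positivity), Real.log_mul (by positivity)
        (by positivity), Real.log_mul (by positivity) (by positivity),
        Real.log_div (by positivity) (by positivity), Real.log_mul (by positivity)
        (by positivity), Real.log_mul (by positivity) (by positivity)]
      have h2 : a i * (a i * T / (b i * S))⁻¹ = b i * (S / T) := by
        field_simp
      nlinarith [mul_le_mul_of_nonneg_left h1 h.le]
  have hsum := Finset.sum_le_sum key
  rw [Finset.sum_add_distrib, Finset.sum_sub_distrib, ← Finset.sum_mul, ← Finset.sum_mul,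
    ← hS, ← hT, mul_div_cancel₀ _ hTpos.ne'] at hsum
  linarith

/-- Two sets of reals that dominate each other from below have the same infimum. -/
theorem Real.sInf_eq_of_forall_exists_le {s t : Set ℝ} (hst : ∀ r ∈ s, ∃ r' ∈ t, r' ≤ r)
    (hts : ∀ r ∈ t, ∃ r' ∈ s, r' ≤ r) : sInf s = sInf t := by
  have hlb : lowerBounds s = lowerBounds t := by
    ext m
    refine ⟨fun hm r hr => ?_, fun hm r hr => ?_⟩
    · obtain ⟨r', hr', hle⟩ := hts r hr
      exact (hm hr').trans hle
    · obtain ⟨r', hr', hle⟩ := hst r hr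
      exact (hm hr').trans hle
  rcases s.eq_empty_or_nonempty with rfl | hs
  · rcases t.eq_empty_or_nonempty with rfl | ⟨r, hr⟩
    · rfl
    · obtain ⟨r', hr', -⟩ := hts r hr
      exact hr'.elim
  have ht : t.Nonempty := by
    obtain ⟨r, hr⟩ := hs
    obtain ⟨r', hr', -⟩ := hst r hr
    exact ⟨r', hr'⟩
  by_cases hb : BddBelow s
  · refine (Real.isGLB_sInf hs hb).unique ?_
    rw [IsGLB, hlb]
    exact Real.isGLB_sInf ht (by rwa [BddBelow, ← hlb])
  · rw [Real.sInf_of_not_bddBelow hb, Real.sInf_of_not_bddBelow (by rwa [BddBelow, ← hlb])]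

section AuxiliaryVariable

variable {ι κ : Type} [Fintype ι] [Fintype κ]

/-- Joint pmf of `(X, Y, U)` for an auxiliary variable `U` with values in `ι` and action `η U`. -/
def jointXYU (PX : X → ℝ) (PW : A → X → Y → ℝ) (P : X → ι → ℝ) (η : ι → A)
    (x : X) (y : Y) (u : ι) : ℝ :=
  PX x * P x u * PW (η u) x y

/-- Joint pmf of `(X, A)` with `A = η U`. -/
def jointXA (PX : X → ℝ) (P : X → ι → ℝ) (η : ι → A) (x : X) (a : A) : ℝ :=
  ∑ u, if η u = a then PX x * P x u else 0

/-- Joint pmf of `(X, Y, A)` with `A = η U`. -/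
def jointXYA (PX : X → ℝ) (PW : A → X → Y → ℝ) (P : X → ι → ℝ) (η : ι → A)
    (x : X) (y : Y) (a : A) : ℝ :=
  ∑ u, if η u = a then jointXYU PX PW P η x y u else 0

/-- Mutual information `I(X; A)` with `A = η U`. -/
def infoXA (PX : X → ℝ) (P : X → ι → ℝ) (η : ι → A) : ℝ :=
  ∑ x, ∑ a, jointXA PX P η x a *
    Real.logb 2 (jointXA PX P η x a / (PX x * ∑ x', jointXA PX P η x' a))

/-- The contribution of `U = u` to the conditional mutual information `I(X; U | Y, A)`. -/
def infoXUTerm (PX : X → ℝ) (PW : A → X → Y → ℝ) (P : X → ι → ℝ) (η : ι → A)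
    (x : X) (y : Y) (u : ι) : ℝ :=
  jointXYU PX PW P η x y u *
    Real.logb 2 (jointXYU PX PW P η x y u * (∑ x', jointXYA PX PW P η x' y (η u)) /
      (jointXYA PX PW P η x y (η u) * ∑ x', jointXYU PX PW P η x' y u))

/-- The rate `I(X; A) + I(X; U | Y, A)`. -/
def auxRate (PX : X → ℝ) (PW : A → X → Y → ℝ) (P : X → ι → ℝ) (η : ι → A) : ℝ :=
  infoXA PX P η + ∑ x, ∑ y, ∑ u, infoXUTerm PX PW P η x y u

theorem jointXYA_eq (PX : X → ℝ) (PW : A → X → Y → ℝ) (P : X → ι → ℝ) (η : ι → A)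
    (x : X) (y : Y) (a : A) :
    jointXYA PX PW P η x y a = jointXA PX P η x a * PW a x y := by
  simp only [jointXYA, jointXA, Finset.sum_mul, jointXYU]
  refine Finset.sum_congr rfl fun u _ => ?_
  split_ifs with h
  · rw [h]
  · simp

theorem sum_jointXA_mul (PX : X → ℝ) (P : X → ι → ℝ) (η : ι → A) (c : A → ℝ) (x : X) :
    ∑ a, jointXA PX P η x a * c a = ∑ u, PX x * P x u * c (η u) := by
  simp only [jointXA, Finset.sum_mul]
  rw [Finset.sum_comm]
  simp

theorem sum_eq_of_jointXA_eq {PX : X → ℝ} (hPX : ∀ x, 0 < PX x) {P : X → ι → ℝ} {η : ι → A}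
    {P' : X → κ → ℝ} {η' : κ → A}
    (h : ∀ x a, jointXA PX P' η' x a = jointXA PX P η x a) (x : X) :
    ∑ k, P' x k = ∑ u, P x u := by
  have h1 := sum_jointXA_mul PX P η (fun _ => 1) x
  have h2 := sum_jointXA_mul PX P' η' (fun _ => 1) x
  simp only [mul_one, ← Finset.mul_sum] at h1 h2
  refine mul_left_cancel₀ (hPX x).ne' ?_
  rw [← h1, ← h2]
  exact Finset.sum_congr rfl fun a _ => h x a

theorem cost_eq_of_jointXA_eq {PX : X → ℝ} {P : X → ι → ℝ} {η : ι → A}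
    {P' : X → κ → ℝ} {η' : κ → A}
    (h : ∀ x a, jointXA PX P' η' x a = jointXA PX P η x a) (cost : A → ℝ) :
    ∑ x, ∑ k, PX x * P' x k * cost (η' k) = ∑ x, ∑ u, PX x * P x u * cost (η u) := by
  simp only [← sum_jointXA_mul, h]

theorem infoXA_eq_of_jointXA_eq {PX : X → ℝ} {P : X → ι → ℝ} {η : ι → A}
    {P' : X → κ → ℝ} {η' : κ → A}
    (h : ∀ x a, jointXA PX P' η' x a = jointXA PX P η x a) :
    infoXA PX P' η' = infoXA PX P η := by
  simp only [infoXA, h]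

/-- The conditional pmf of `f U` given `X`. -/
def mapCond [DecidableEq κ] (f : ι → κ) (P : X → ι → ℝ) (x : X) (k : κ) : ℝ :=
  ∑ u with f u = k, P x u

theorem sum_mapCond_mul [DecidableEq κ] (f : ι → κ) (P : X → ι → ℝ) (x : X) (F : κ → ℝ) :
    ∑ k, mapCond f P x k * F k = ∑ u, P x u * F (f u) := by
  rw [← Finset.sum_fiberwise univ f]
  refine Finset.sum_congr rfl fun k _ => ?_
  rw [mapCond, Finset.sum_mul]
  refine Finset.sum_congr rfl fun u hu => ?_
  rw [(Finset.mem_filter.1 hu).2]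

theorem jointXA_mapCond [DecidableEq κ] (PX : X → ℝ) (f : ι → κ) (P : X → ι → ℝ) (η : κ → A)
    (x : X) (a : A) :
    jointXA PX (mapCond f P) η x a = jointXA PX P (η ∘ f) x a := by
  have h := sum_mapCond_mul f P x (fun k => if η k = a then PX x else 0)
  simpa [jointXA, mul_comm] using h

theorem jointXYU_mapCond [DecidableEq κ] (PX : X → ℝ) (PW : A → X → Y → ℝ) (f : ι → κ)
    (P : X → ι → ℝ) (η : κ → A) (x : X) (y : Y) (k : κ) :
    jointXYU PX PW (mapCond f P) η x y k =
      ∑ u with f u = k, jointXYU PX PW P (η ∘ f) x y u := by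
  rw [jointXYU, mapCond, Finset.mul_sum, Finset.sum_mul]
  refine Finset.sum_congr rfl fun u hu => ?_
  rw [jointXYU, Function.comp_apply, (Finset.mem_filter.1 hu).2]

theorem isCondPMF_mapCond [DecidableEq κ] (f : ι → κ) {P : X → ι → ℝ} (hP : IsCondPMF P) :
    IsCondPMF (mapCond f P) := fun x =>
  ⟨fun _ => Finset.sum_nonneg fun u _ => (hP x).1 u, by
    simpa [(hP x).2] using sum_mapCond_mul f P x (fun _ => 1)⟩

/-- Data processing: replacing `U` by a function of `U` that still determines the action does
not increase the rate. -/
theorem auxRate_mapCond_le [DecidableEq κ] {PX : X → ℝ} {PW : A → X → Y → ℝ}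
    (hPX : ∀ x, 0 ≤ PX x) (hPW : ∀ a x y, 0 ≤ PW a x y) (f : ι → κ) {P : X → ι → ℝ}
    (hP : ∀ x u, 0 ≤ P x u) (η : κ → A) :
    auxRate PX PW (mapCond f P) η ≤ auxRate PX PW P (η ∘ f) := by
  have hJ : ∀ x y u, 0 ≤ jointXYU PX PW P (η ∘ f) x y u := fun x y u =>
    mul_nonneg (mul_nonneg (hPX x) (hP x u)) (hPW _ x y)
  rw [auxRate, auxRate, infoXA_eq_of_jointXA_eq (jointXA_mapCond PX f P η)]
  gcongr with x _ y _
  rw [← Finset.sum_fiberwise univ f]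
  refine Finset.sum_le_sum fun k _ => ?_
  have hls := logb_sum_inequality {u | f u = k} (fun u => jointXYU PX PW P (η ∘ f) x y u)
    (fun u => ∑ x', jointXYU PX PW P (η ∘ f) x' y u)
    (∑ x', jointXYA PX PW P (η ∘ f) x' y (η k)) (jointXYA PX PW P (η ∘ f) x y (η k))
    (fun u _ => hJ x y u)
    (fun u _ => Finset.single_le_sum (fun x' _ => hJ x' y u) (Finset.mem_univ x))
  rw [Finset.sum_comm] at hls
  refine (le_of_eq ?_).trans (hls.trans (le_of_eq ?_))
  · simp only [infoXUTerm, jointXYU_mapCond, jointXYA_eq, jointXA_mapCond]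
  · refine Finset.sum_congr rfl fun u hu => ?_
    rw [infoXUTerm, Function.comp_apply, (Finset.mem_filter.1 hu).2]

theorem jointXYU_smul (PX : X → ℝ) (PW : A → X → Y → ℝ) (P : X → ι → ℝ) (η : ι → A)
    (w : ι → ℝ) (x : X) (y : Y) (u : ι) :
    jointXYU PX PW (fun x u => w u * P x u) η x y u = w u * jointXYU PX PW P η x y u := by
  simp only [jointXYU]
  ring

/-- Reweighting the values of `U` without changing the law of `(X, A)` rescales the terms of the
conditional mutual information. -/
theorem infoXUTerm_smul {PX : X → ℝ} (PW : A → X → Y → ℝ) {P : X → ι → ℝ} {η : ι → A}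
    {w : ι → ℝ} (h : ∀ x a, jointXA PX (fun x u => w u * P x u) η x a = jointXA PX P η x a)
    (x : X) (y : Y) (u : ι) :
    infoXUTerm PX PW (fun x u => w u * P x u) η x y u = w u * infoXUTerm PX PW P η x y u := by
  simp only [infoXUTerm, jointXYA_eq, h, jointXYU_smul, ← Finset.mul_sum]
  rcases eq_or_ne (w u) 0 with h0 | h0
  · simp [h0]
  · rw [mul_assoc, mul_left_comm _ (w u), mul_assoc (w u) _ (∑ _, _), mul_div_mul_left _ _ h0]

/-- The support of the auxiliary variable can be reduced to `|X||A| + 2` values while keeping the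
law of `(X, A)`, the rate and the average of one function of `(X, Y, U)`. -/
theorem exists_reweighting {PX : X → ℝ} (PW : A → X → Y → ℝ) (P : X → ι → ℝ) (η : ι → A)
    (F : X → Y → ι → ℝ) :
    ∃ w : ι → ℝ, (∀ u, 0 ≤ w u) ∧
      #{u | w u ≠ 0} ≤ Fintype.card X * Fintype.card A + 2 ∧
      (∀ x a, jointXA PX (fun x u => w u * P x u) η x a = jointXA PX P η x a) ∧
      auxRate PX PW (fun x u => w u * P x u) η = auxRate PX PW P η ∧
      ∑ x, ∑ y, ∑ u, jointXYU PX PW (fun x u => w u * P x u) η x y u * F x y u =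
        ∑ x, ∑ y, ∑ u, jointXYU PX PW P η x y u * F x y u := by
  obtain ⟨w, hw0, hsum, hcard⟩ := exists_nonneg_weights_card_support_le
    (V := (X × A → ℝ) × ℝ × ℝ)
    (fun u : ι => (fun p : X × A => if η u = p.2 then PX p.1 * P p.1 u else 0,
      ∑ x, ∑ y, infoXUTerm PX PW P η x y u,
      ∑ x, ∑ y, jointXYU PX PW P η x y u * F x y u))
  have hXA : ∀ x a, jointXA PX (fun x u => w u * P x u) η x a = jointXA PX P η x a := by
    intro x a
    have := congrFun (congrArg Prod.fst hsum) (x, a)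
    simp only [Prod.fst_sum, Finset.sum_apply, Prod.smul_fst, Pi.smul_apply, smul_eq_mul] at this
    rw [jointXA, jointXA, ← this]
    refine Finset.sum_congr rfl fun u _ => ?_
    split_ifs <;> ring
  have hcomm : ∀ G : X → Y → ι → ℝ,
      ∑ x, ∑ y, ∑ u, G x y u = ∑ u, ∑ x, ∑ y, G x y u := fun G => by
    simp only [fun x => Finset.sum_comm (s := (univ : Finset Y)) (t := (univ : Finset ι))
      (f := G x)]
    exact Finset.sum_comm
  refine ⟨w, hw0, ?_, hXA, ?_, ?_⟩
  · simpa [Fintype.card_prod, add_assoc] using hcard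
  · have := congrArg (fun v => v.2.1) hsum
    simp only [Prod.snd_sum, Prod.fst_sum, Prod.smul_snd, Prod.smul_fst, smul_eq_mul] at this
    rw [auxRate, auxRate, infoXA_eq_of_jointXA_eq hXA, hcomm, hcomm, ← this]
    simp only [infoXUTerm_smul PW hXA, Finset.mul_sum]
  · have := congrArg (fun v => v.2.2) hsum
    simp only [Prod.snd_sum, Prod.smul_snd, smul_eq_mul] at this
    rw [hcomm, hcomm, ← this]
    simp only [jointXYU_smul, Finset.mul_sum, mul_assoc]

end AuxiliaryVariable

theorem rate_eq_auxRate (PX : X → ℝ) (PW : A → X → Y → ℝ) (PT : X → Strat Y Xh A → ℝ) :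
    IXA PX PT + IXTcondYA PX PW PT = auxRate PX PW PT Prod.snd := rfl

theorem rateU_eq_auxRate (PX : X → ℝ) (PW : A → X → Y → ℝ) {n : ℕ} (PU : X → Fin n → ℝ)
    (η : Fin n → A) :
    IXAu PX PU η + IXUcondYAu PX PW PU η = auxRate PX PW PU η := rfl

/-- Every auxiliary variable can be turned into a Shannon strategy of the same cost and
distortion and of no larger rate. -/
theorem exists_strategy_of_auxiliary [Nonempty Xh] {PX : X → ℝ} {PW : A → X → Y → ℝ}
    (hPX : ∀ x, 0 < PX x) (hPW : ∀ a x, IsPMF (PW a x)) (dist : X → Xh → ℝ) (cost : A → ℝ)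
    {n : ℕ} {PU : X → Fin n → ℝ} (hPU : IsCondPMF PU) (η : Fin n → A) :
    ∃ PT : X → Strat Y Xh A → ℝ, IsCondPMF PT ∧
      expDist PX PW dist PT = expDistU PX PW dist PU η ∧
      expCost PX cost PT = expCostU PX cost PU η ∧
      IXA PX PT + IXTcondYA PX PW PT ≤ IXAu PX PU η + IXUcondYAu PX PW PU η := by
  choose g hg using fun (y : Y) (u : Fin n) =>
    (Finset.exists_mem_eq_inf' univ_nonempty
      (fun xh : Xh => ∑ x, pUJoint PX PW PU η x y u * dist x xh))
  let f : Fin n → Strat Y Xh A := fun u => (fun y => g y u, η u)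
  refine ⟨mapCond f PU, isCondPMF_mapCond f hPU, ?_,
    cost_eq_of_jointXA_eq (jointXA_mapCond PX f PU Prod.snd) cost, ?_⟩
  · have h1 : ∀ x y, ∑ t, pXYT PX PW (mapCond f PU) x y t * dist x (t.1 y) =
        ∑ u, pUJoint PX PW PU η x y u * dist x (g y u) := fun x y => by
      have h := sum_mapCond_mul f PU x (fun t => PX x * PW t.2 x y * dist x (t.1 y))
      refine Eq.trans (Finset.sum_congr rfl fun t _ => ?_)
        (h.trans (Finset.sum_congr rfl fun u _ => ?_))
      · rw [pXYT]; ring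
      · simp only [pUJoint, f]; ring
    simp only [expDist, expDistU, h1]
    rw [Finset.sum_comm]
    refine Finset.sum_congr rfl fun y _ => ?_
    rw [Finset.sum_comm]
    exact Finset.sum_congr rfl fun u _ => (hg y u).2.symm
  · rw [rate_eq_auxRate, rateU_eq_auxRate]
    exact auxRate_mapCond_le (fun x => (hPX x).le) (fun a x => (hPW a x).1) f
      (fun x => (hPU x).1) Prod.snd

/-- Every Shannon strategy is an auxiliary variable of the same cost and of no larger distortion
and rate. -/
theorem exists_auxiliary_of_strategy [Nonempty Xh] {PX : X → ℝ} {PW : A → X → Y → ℝ}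
    (hPX : ∀ x, 0 < PX x) (hPW : ∀ a x, IsPMF (PW a x)) (dist : X → Xh → ℝ) (cost : A → ℝ)
    {PT : X → Strat Y Xh A → ℝ} (hPT : IsCondPMF PT) :
    ∃ n : ℕ, ∃ PU : X → Fin n → ℝ, ∃ η : Fin n → A, IsCondPMF PU ∧
      expDistU PX PW dist PU η ≤ expDist PX PW dist PT ∧
      expCostU PX cost PU η = expCost PX cost PT ∧
      IXAu PX PU η + IXUcondYAu PX PW PU η ≤ IXA PX PT + IXTcondYA PX PW PT := by
  let f := Fintype.equivFin (Strat Y Xh A)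
  have hη : (Prod.snd ∘ f.symm) ∘ f = (Prod.snd : Strat Y Xh A → A) := by
    ext t
    simp
  refine ⟨_, mapCond f PT, Prod.snd ∘ f.symm, isCondPMF_mapCond f hPT, ?_, ?_, ?_⟩
  · have h1 : ∀ x y, ∑ t, pXYT PX PW PT x y t * dist x (t.1 y) =
        ∑ u, pUJoint PX PW (mapCond f PT) (Prod.snd ∘ f.symm) x y u *
          dist x ((f.symm u).1 y) := fun x y => by
      have h := sum_mapCond_mul f PT x
        (fun u => PX x * PW (f.symm u).2 x y * dist x ((f.symm u).1 y))
      refine Eq.symm (Eq.trans (Finset.sum_congr rfl fun u _ => ?_)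
        (h.trans (Finset.sum_congr rfl fun t _ => ?_)))
      · simp only [pUJoint, Function.comp_apply]; ring
      · simp only [pXYT, Equiv.symm_apply_apply]; ring
    simp only [expDist, expDistU, h1]
    rw [Finset.sum_comm (s := (univ : Finset X))]
    refine Finset.sum_le_sum fun y _ => ?_
    rw [Finset.sum_comm (s := (univ : Finset X))]
    exact Finset.sum_le_sum fun u _ => Finset.inf'_le _ (Finset.mem_univ ((f.symm u).1 y))
  · have h := cost_eq_of_jointXA_eq (jointXA_mapCond PX f PT (Prod.snd ∘ f.symm)) cost
    rw [hη] at h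
    exact h
  · have h := auxRate_mapCond_le (fun x => (hPX x).le) (fun a x => (hPW a x).1) f
      (fun x => (hPT x).1) (Prod.snd ∘ f.symm)
    rw [hη] at h
    exact h

/-- The number of strategies in use can be reduced to `|X||A| + 2` without changing cost,
distortion and rate. -/
theorem exists_strategy_ncard_le {PX : X → ℝ} (hPX : ∀ x, 0 < PX x) (PW : A → X → Y → ℝ)
    (dist : X → Xh → ℝ) (cost : A → ℝ) {PT : X → Strat Y Xh A → ℝ} (hPT : IsCondPMF PT) :
    ∃ PT' : X → Strat Y Xh A → ℝ, IsCondPMF PT' ∧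
      Set.ncard { t : Strat Y Xh A | ∃ x, PT' x t ≠ 0 } ≤
        Fintype.card X * Fintype.card A + 2 ∧
      expDist PX PW dist PT' = expDist PX PW dist PT ∧
      expCost PX cost PT' = expCost PX cost PT ∧
      IXA PX PT' + IXTcondYA PX PW PT' = IXA PX PT + IXTcondYA PX PW PT := by
  obtain ⟨w, hw0, hcard, hXA, hrate, hdist⟩ := exists_reweighting (PX := PX) PW PT Prod.snd
    (fun x y t => dist x (t.1 y))
  refine ⟨fun x t => w t * PT x t, fun x => ⟨fun t => mul_nonneg (hw0 t) ((hPT x).1 t), ?_⟩,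
    ?_, hdist, cost_eq_of_jointXA_eq hXA cost, hrate⟩
  · rw [sum_eq_of_jointXA_eq hPX hXA, (hPT x).2]
  · refine le_trans ?_ hcard
    rw [← Set.ncard_coe_finset]
    refine Set.ncard_le_ncard ?_ (Finset.finite_toSet _)
    rintro t ⟨x, hx⟩
    simpa using left_ne_zero_of_mul hx

/-- The single-letter minimization over auxiliary variables `U` and
functions `η : U → A` equals the Shannon-strategy minimization, and in the latter the
set of strategies actually used can be restricted to have cardinality at most
`|X||A| + 2` without changing the minimum. -/
theorem shannon_strategy_formulation
    {X Y A Xh : Type} [Fintype X] [Fintype Y] [Fintype A] [Fintype Xh]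
    [DecidableEq X] [DecidableEq Y] [DecidableEq A] [DecidableEq Xh]
    [Nonempty X] [Nonempty Y] [Nonempty A] [Nonempty Xh]
    (PX : X → ℝ) (PW : A → X → Y → ℝ) (dist : X → Xh → ℝ) (cost : A → ℝ)
    (hPX : IsPMF PX) (hPXpos : ∀ x, 0 < PX x)
    (hPW : ∀ a x, IsPMF (PW a x))
    (hdist : ∀ x xh, 0 ≤ dist x xh) (hdist0 : ∀ x, ∃ xh, dist x xh = 0)
    (hcost : ∀ a, 0 ≤ cost a) (hcost0 : ∃ a, cost a = 0)
    (D C : ℝ) (hD : 0 ≤ D) (hC : 0 ≤ C) :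
    RDCU PX PW dist cost D C = RDC PX PW dist cost D C ∧
    RDC PX PW dist cost D C =
      sInf { r : ℝ | ∃ PT : X → Strat Y Xh A → ℝ, IsCondPMF PT ∧
        Set.ncard { t : Strat Y Xh A | ∃ x, PT x t ≠ 0 } ≤
          Fintype.card X * Fintype.card A + 2 ∧
        expDist PX PW dist PT ≤ D ∧ expCost PX cost PT ≤ C ∧
        r = IXA PX PT + IXTcondYA PX PW PT } := by
  refine ⟨Real.sInf_eq_of_forall_exists_le ?_ ?_, Real.sInf_eq_of_forall_exists_le ?_ ?_⟩
  · rintro _ ⟨n, PU, η, hPU, hdistU, hcostU, rfl⟩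
    obtain ⟨PT, hPT, hd, hc, hr⟩ :=
      exists_strategy_of_auxiliary hPXpos hPW dist cost hPU η
    exact ⟨_, ⟨PT, hPT, hd.trans_le hdistU, hc.trans_le hcostU, rfl⟩, hr⟩
  · rintro _ ⟨PT, hPT, hdistT, hcostT, rfl⟩
    obtain ⟨n, PU, η, hPU, hd, hc, hr⟩ :=
      exists_auxiliary_of_strategy hPXpos hPW dist cost hPT
    exact ⟨_, ⟨n, PU, η, hPU, hd.trans hdistT, hc.trans_le hcostT, rfl⟩, hr⟩
  · rintro _ ⟨PT, hPT, hdistT, hcostT, rfl⟩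
    obtain ⟨PT', hPT', hcard, hd, hc, hr⟩ :=
      exists_strategy_ncard_le hPXpos PW dist cost hPT
    exact ⟨_, ⟨PT', hPT', hcard, hd.trans_le hdistT, hc.trans_le hcostT, rfl⟩, hr.le⟩
  · rintro _ ⟨PT, hPT, -, hdistT, hcostT, rfl⟩
    exact ⟨_, ⟨PT, hPT, hdistT, hcostT, rfl⟩, le_rfl⟩
end
end
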